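/- Let Ω ⊆ ℝ^n be open, Λ a weight vector, and a ∈ S_Λ(Ω) a zero-order symbol (i.e. a ∈ S_{m,Λ}(Ω) with m ≡ 1). For u ∈ C_c^∞(Ω) define a(x,D)u(x) = (2π)^{-n} ∫_{ℝ^n} e^{i x·ξ} a(x,ξ) û(ξ) dξ, where û(ξ) = ∫ e^{-i x·ξ} u(x) dx. Then for every 1 < p < ∞, every ψ ∈ C_c^∞(Ω), and every compact K ⊂ Ω there exists a constant C > 0 such that ‖ψ · a(·,D)u‖_{L^p(ℝ^n)} ≤ C ‖u‖_{L^p(ℝ^n)} for all u ∈ C_c^∞(Ω) with supp u ⊆ K. -/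

import Mathlib

open scoped BigOperators RealInnerProductSpace
open MeasureTheory

noncomputable section

abbrev Euc (n : ℕ) := EuclideanSpace ℝ (Fin n)

/-- The Japanese bracket `⟨ξ⟩ = (1+|ξ|²)^{1/2}`. -/
def jb {n : ℕ} (ξ : Euc n) : ℝ := Real.sqrt (1 + ‖ξ‖ ^ 2)

variable {n : ℕ} {F : Type*} [NormedAddCommGroup F] [NormedSpace ℝ F]

/-- Partial derivative in direction `j`. -/
def pd (j : Fin n) (f : Euc n → F) : Euc n → F :=
  fun ξ => fderiv ℝ f ξ (EuclideanSpace.single j 1)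

/-- Iterated partial derivative `∂^α`. -/
def mpd (α : Fin n → ℕ) (f : Euc n → F) : Euc n → F :=
  (List.finRange n).foldr (fun j g => (pd j)^[α j] g) f

/-- Partial derivative in the `x` variable of a symbol. -/
def xpd (j : Fin n) (a : Euc n → Euc n → F) : Euc n → Euc n → F :=
  fun x ξ => fderiv ℝ (fun y => a y ξ) x (EuclideanSpace.single j 1)

/-- Iterated `x`-derivative `∂_x^β` of a symbol. -/
def xmpd (β : Fin n → ℕ) (a : Euc n → Euc n → F) : Euc n → Euc n → F :=
  (List.finRange n).foldr (fun j g => (xpd j)^[β j] g) a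

/-- The mixed derivative `∂_ξ^α ∂_x^β a`. -/
def smpd (α β : Fin n → ℕ) (a : Euc n → Euc n → F) : Euc n → Euc n → F :=
  fun x ξ => mpd α (xmpd β a x) ξ

/-- `Λ = (λ_1,…,λ_n)` is a weight vector: positive continuous components satisfying
the polynomial growth (PG), (M) and slowly varying (SW) conditions. -/
def IsWeightVector (Λ : Fin n → Euc n → ℝ) : Prop :=
  (∀ j, Continuous (Λ j)) ∧ (∀ j ξ, 0 < Λ j ξ) ∧
  ∃ C c : ℝ, 0 < C ∧ 0 < c ∧
    (∀ j ξ, c * jb ξ ^ c ≤ Λ j ξ ∧ Λ j ξ ≤ C * jb ξ ^ C) ∧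
    (∀ j (ξ : Euc n), c * |ξ j| ≤ Λ j ξ) ∧
    (∀ ξ η : Euc n, ∑ k, |ξ k - η k| * (Λ k η)⁻¹ ≤ c →
      ∀ j, C⁻¹ * Λ j ξ ≤ Λ j η ∧ Λ j η ≤ C * Λ j ξ)

/-- `m` is an admissible weight associated to the weight vector `Λ`:
positive, continuous, temperate and slowly varying (SW1). -/
def IsAdmissible (Λ : Fin n → Euc n → ℝ) (m : Euc n → ℝ) : Prop :=
  Continuous m ∧ (∀ ξ, 0 < m ξ) ∧
  ∃ N C c : ℝ, 0 < N ∧ 0 < C ∧ 0 < c ∧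
    (∀ ξ η : Euc n, m η ≤ C * m ξ * (1 + ‖η - ξ‖) ^ N) ∧
    (∀ ξ η : Euc n, ∑ k, |ξ k - η k| * (Λ k η)⁻¹ ≤ c →
      C⁻¹ * m ξ ≤ m η ∧ m η ≤ C * m ξ)

/-- The symbol class `S_{m,Λ}(Ω)`. -/
def IsSymbol (Ω : Set (Euc n)) (m : Euc n → ℝ) (Λ : Fin n → Euc n → ℝ)
    (a : Euc n → Euc n → ℂ) : Prop :=
  ContDiffOn ℝ (⊤ : ℕ∞) (fun p : Euc n × Euc n => a p.1 p.2) (Ω ×ˢ Set.univ) ∧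
  ∀ K : Set (Euc n), IsCompact K → K ⊆ Ω → ∀ α β : Fin n → ℕ,
    ∃ c > 0, ∀ x ∈ K, ∀ ξ, ‖smpd α β a x ξ‖ ≤ c * m ξ * (∏ k, Λ k ξ ^ α k)⁻¹

/-- The regularizing class `S^{-∞}(Ω)`. -/
def IsSmoothing (Ω : Set (Euc n)) (a : Euc n → Euc n → ℂ) : Prop :=
  ContDiffOn ℝ (⊤ : ℕ∞) (fun p : Euc n × Euc n => a p.1 p.2) (Ω ×ˢ Set.univ) ∧
  ∀ K : Set (Euc n), IsCompact K → K ⊆ Ω → ∀ (μ : ℝ) (α β : Fin n → ℕ),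
    ∃ c > 0, ∀ x ∈ K, ∀ ξ, ‖smpd α β a x ξ‖ ≤ c * jb ξ ^ (μ - ∑ k, (α k : ℝ))

/-- The `Λ`-neighborhood `X_{εΛ}` of a set `X ⊆ ℝ^n`. -/
def lamNbhd (Λ : Fin n → Euc n → ℝ) (ε : ℝ) (X : Set (Euc n)) : Set (Euc n) :=
  ⋃ ξ0 ∈ X, {ξ : Euc n | ∀ j, |ξ j - ξ0 j| < ε * Λ j ξ0}


/-- The pseudodifferential operator `a(x,D)u(x) = (2π)^{-n} ∫ e^{ix·ξ} a(x,ξ) û(ξ) dξ`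
with `û(ξ) = ∫ e^{-ix·ξ} u(x) dx`. -/
def pdo {n : ℕ} (a : Euc n → Euc n → ℂ) (u : Euc n → ℂ) : Euc n → ℂ :=
  fun x => (((2 * Real.pi) ^ n : ℝ)⁻¹ : ℂ) *
    ∫ ξ : Euc n, Complex.exp (Complex.I * (⟪x, ξ⟫ : ℝ)) * a x ξ *
      ∫ y : Euc n, Complex.exp (-(Complex.I * (⟪y, ξ⟫ : ℝ))) * u y


end

open scoped BigOperators RealInnerProductSpace
open MeasureTheory

noncomputable section

/-- Dyadic intervals. -/
def dyad (q : ℤ × ℤ) : Set ℝ := Set.Ico ((q.2 : ℝ) * 2 ^ q.1) ((q.2 + 1 : ℝ) * 2 ^ q.1)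

lemma dyad_measurable (q : ℤ × ℤ) : MeasurableSet (dyad q) := measurableSet_Ico

lemma dyad_volume (q : ℤ × ℤ) : volume (dyad q) = ENNReal.ofReal (2 ^ q.1) := by
  unfold dyad
  rw [Real.volume_Ico]
  congr 1
  ring

lemma mem_dyad_floor (k : ℤ) (x : ℝ) : x ∈ dyad (k, ⌊x / 2 ^ k⌋) := by
  have h2 : (0:ℝ) < 2 ^ k := by positivity
  constructor
  · have := Int.floor_le (x / 2 ^ k)
    rwa [le_div_iff₀ h2] at this
  · have := Int.lt_floor_add_one (x / 2 ^ k)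
    rwa [div_lt_iff₀ h2] at this

lemma dyad_eq_floor {k j : ℤ} {x : ℝ} (h : x ∈ dyad (k, j)) : j = ⌊x / 2 ^ k⌋ := by
  have h2 : (0:ℝ) < 2 ^ k := by positivity
  symm
  rw [Int.floor_eq_iff, le_div_iff₀ h2, div_lt_iff₀ h2]
  exact h

lemma dyad_nested {k k' j j' : ℤ} (hk : k ≤ k') {x : ℝ} (h : x ∈ dyad (k, j))
    (h' : x ∈ dyad (k', j')) : dyad (k, j) ⊆ dyad (k', j') := by
  obtain ⟨m, rfl⟩ : ∃ m : ℕ, k' = k + m := ⟨(k' - k).toNat, by omega⟩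
  have h2 : (0:ℝ) < 2 ^ k := by positivity
  have e : (2:ℝ) ^ (k + (m:ℤ)) = 2 ^ m * 2 ^ k := by
    rw [zpow_add₀ (by norm_num)]; simp [mul_comm]
  unfold dyad at *
  simp only [Set.mem_Ico, e] at *
  have a1 : (j' : ℝ) * 2 ^ m < j + 1 := by
    have : (j' : ℝ) * 2 ^ m * 2 ^ k < (j + 1) * 2 ^ k := by
      rw [mul_assoc]; exact lt_of_le_of_lt h'.1 h.2
    exact lt_of_mul_lt_mul_right this h2.le
  have a2 : (j : ℝ) < (j' + 1) * 2 ^ m := by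
    have : (j : ℝ) * 2 ^ k < (j' + 1) * 2 ^ m * 2 ^ k := by
      rw [mul_assoc]; exact lt_of_le_of_lt h.1 h'.2
    exact lt_of_mul_lt_mul_right this h2.le
  have b1 : j' * 2 ^ m ≤ j := by
    have : j' * 2 ^ m < j + 1 := by exact_mod_cast a1
    omega
  have b2 : j + 1 ≤ (j' + 1) * 2 ^ m := by
    have : j < (j' + 1) * 2 ^ m := by exact_mod_cast a2
    omega
  have c1 : (j' : ℝ) * 2 ^ m ≤ j := by exact_mod_cast b1
  have c2 : (j : ℝ) + 1 ≤ (j' + 1) * 2 ^ m := by exact_mod_cast b2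
  apply Set.Ico_subset_Ico
  · rw [← mul_assoc]; exact mul_le_mul_of_nonneg_right c1 h2.le
  · rw [← mul_assoc]; exact mul_le_mul_of_nonneg_right c2 h2.le

/-- Calderón–Zygmund selection. -/
lemma cz_selection (f : ℝ → ℝ) (hf : Continuous f) (h0 : ∀ x, 0 ≤ f x) (hi : Integrable f)
    (l : ℝ) (hl : 0 < l) :
    ∃ J : Set (ℤ × ℤ), (Pairwise fun q q' : J => Disjoint (dyad q) (dyad q')) ∧
      (∀ q ∈ J, l * 2 ^ q.1 < ∫ x in dyad q, f x ∧ ∫ x in dyad q, f x ≤ 2 * l * 2 ^ q.1) ∧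
      ∀ x, x ∉ ⋃ q : J, dyad q → f x ≤ l := by
  have hset : ∀ q q', dyad q ⊆ dyad q' → ∫ x in dyad q, f x ≤ ∫ x in dyad q', f x := by
    intro q q' h
    exact setIntegral_mono_set hi.integrableOn (Filter.Eventually.of_forall h0)
      (Filter.Eventually.of_forall h)
  refine ⟨{q | l * 2 ^ q.1 < ∫ x in dyad q, f x ∧
    ∀ q' : ℤ × ℤ, q.1 < q'.1 → dyad q ⊆ dyad q' → ∫ x in dyad q', f x ≤ l * 2 ^ q'.1},
    ?_, ?_, ?_⟩
  · rintro ⟨⟨k, j⟩, hq⟩ ⟨⟨k', j'⟩, hq'⟩ hne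
    simp only [Set.mem_ofPred_eq] at hq hq'
    rw [Set.disjoint_left]
    intro x hx hx'
    simp only at hx hx'
    rcases lt_trichotomy k k' with hlt | heq | hgt
    · exact absurd (hq.2 _ hlt (dyad_nested hlt.le hx hx')) (not_le.2 hq'.1)
    · subst heq
      apply hne
      have := (dyad_eq_floor hx).trans (dyad_eq_floor hx').symm
      subst this; rfl
    · exact absurd (hq'.2 _ hgt (dyad_nested hgt.le hx' hx)) (not_le.2 hq.1)
  · rintro ⟨k, j⟩ ⟨h1, h2⟩
    refine ⟨h1, ?_⟩
    simp only at h1 h2 ⊢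
    have hx : (j : ℝ) * 2 ^ k ∈ dyad (k, j) := by
      have : (0:ℝ) < 2 ^ k := by positivity
      constructor <;> simp only <;> nlinarith
    have hs := dyad_nested (show k ≤ k + 1 by omega) hx (mem_dyad_floor (k+1) _)
    have := h2 (k+1, _) (by simp) hs
    refine (hset _ _ hs).trans (this.trans (le_of_eq ?_))
    simp only
    rw [zpow_add₀ (by norm_num)]; ring
  · intro x hx
    by_contra hfx
    push Not at hfx
    apply hx
    -- nonempty
    obtain ⟨m, hm1, hm2⟩ := exists_between hfx
    have hnb : ∀ᶠ y in nhds x, m < f y := hf.continuousAt.eventually (lt_mem_nhds hm2)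
    obtain ⟨δ, hδ, hball⟩ := Metric.eventually_nhds_iff.1 hnb
    obtain ⟨N, hN⟩ := exists_pow_lt_of_lt_one hδ (show (1/2:ℝ) < 1 by norm_num)
    have hne : ∃ k : ℤ, l * 2 ^ k < ∫ y in dyad (k, ⌊x / 2 ^ k⌋), f y := by
      refine ⟨-N, ?_⟩
      have h2 : (2:ℝ) ^ (-(N:ℤ)) < δ := by
        rw [zpow_neg, zpow_natCast]; simpa using hN
      have hxx := mem_dyad_floor (-N) x
      have hv : volume.real (dyad (-N, ⌊x / 2 ^ (-(N:ℤ))⌋)) = 2 ^ (-(N:ℤ)) := by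
        rw [measureReal_def, dyad_volume, ENNReal.toReal_ofReal (by positivity)]
      have : ∫ y in dyad (-N, ⌊x / 2 ^ (-(N:ℤ))⌋), m ≤ ∫ y in dyad (-N, ⌊x / 2 ^ (-(N:ℤ))⌋), f y := by
        apply setIntegral_mono_on _ hi.integrableOn (dyad_measurable _)
        · intro y hy
          apply le_of_lt
          apply hball
          unfold dyad at hxx hy
          simp only [Set.mem_Ico] at hxx hy
          rw [Real.dist_eq, abs_lt]
          constructor <;> nlinarith
        · apply integrableOn_const
          · rw [dyad_volume]; exact ENNReal.ofReal_ne_top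
          · simp
      rw [setIntegral_const, hv, smul_eq_mul] at this
      refine lt_of_lt_of_le ?_ this
      rw [mul_comm]
      exact mul_lt_mul_of_pos_left hm1 (by positivity)
    have hbd : ∃ b : ℤ, ∀ k : ℤ, l * 2 ^ k < ∫ y in dyad (k, ⌊x / 2 ^ k⌋), f y → k ≤ b := by
      obtain ⟨b, hb⟩ := pow_unbounded_of_one_lt ((∫ y, f y) / l) (show (1:ℝ) < 2 by norm_num)
      refine ⟨b, fun k hk => ?_⟩
      by_contra hkb
      push Not at hkb
      have h1 : ∫ y in dyad (k, ⌊x / 2 ^ k⌋), f y ≤ ∫ y, f y :=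
        setIntegral_le_integral hi (Filter.Eventually.of_forall h0)
      have h3 : (2:ℝ) ^ b ≤ 2 ^ k := by
        rw [← zpow_natCast]; exact zpow_le_zpow_right₀ (by norm_num) hkb.le
      rw [div_lt_iff₀ hl] at hb
      nlinarith
    obtain ⟨k, hk, hmax⟩ := Int.exists_greatest_of_bdd hbd hne
    rw [Set.mem_iUnion]
    refine ⟨⟨(k, ⌊x / 2 ^ k⌋), hk, ?_⟩, mem_dyad_floor k x⟩
    rintro ⟨k', j'⟩ hlt hs
    simp only at hlt ⊢
    have hx' := hs (mem_dyad_floor k x)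
    by_contra hc
    push Not at hc
    have := dyad_eq_floor hx'
    subst this
    have := hmax k' hc
    omega

end

open scoped BigOperators RealInnerProductSpace
open MeasureTheory

noncomputable section

set_option linter.unusedSectionVars false
section cz
variable {H1 H2 : Type*} [NormedAddCommGroup H1] [NormedSpace ℝ H1] [CompleteSpace H1]
  [NormedAddCommGroup H2] [NormedSpace ℝ H2] [CompleteSpace H2]

/-- Convolution operator with operator valued kernel. -/
def czop (K : ℝ → H1 →L[ℝ] H2) (f : ℝ → H1) (x : ℝ) : H2 := ∫ y, K (x - y) (f y)

lemma czop_integrable {K : ℝ → H1 →L[ℝ] H2} (hK : Continuous K) {B : ℝ} (hB : ∀ t, ‖K t‖ ≤ B)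
    {f : ℝ → H1} (hf : Integrable f) (x : ℝ) : Integrable (fun y => K (x - y) (f y)) := by
  refine Integrable.mono' (hf.norm.const_mul B) ?_ ?_
  · have h1 : AEStronglyMeasurable (fun y => K (x - y)) volume :=
      (hK.comp (by fun_prop : Continuous fun y : ℝ => x - y)).aestronglyMeasurable
    exact isBoundedBilinearMap_apply.continuous.comp_aestronglyMeasurable₂ h1 hf.1
  · filter_upwards with y
    exact (ContinuousLinearMap.le_opNorm _ _).trans
      (mul_le_mul_of_nonneg_right (hB _) (norm_nonneg _))

lemma czop_continuous {K : ℝ → H1 →L[ℝ] H2} (hK : Continuous K) {B : ℝ} (hB : ∀ t, ‖K t‖ ≤ B)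
    {f : ℝ → H1} (hf : Integrable f) : Continuous (czop K f) := by
  unfold czop
  refine continuous_of_dominated (bound := fun y => B * ‖f y‖)
    (fun x => (czop_integrable hK hB hf x).1) ?_ (hf.norm.const_mul B) ?_
  · intro x
    filter_upwards with y
    exact (ContinuousLinearMap.le_opNorm _ _).trans
      (mul_le_mul_of_nonneg_right (hB _) (norm_nonneg _))
  · filter_upwards with y
    fun_prop

/-- Center of a dyadic interval -/
def dcen (q : ℤ × ℤ) : ℝ := (q.2 + 1/2 : ℝ) * 2 ^ q.1

/-- Doubled dyadic interval. -/
def dstar (q : ℤ × ℤ) : Set ℝ := {x | |x - dcen q| < 2 ^ q.1}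

lemma dstar_measurable (q : ℤ × ℤ) : MeasurableSet (dstar q) := by
  apply IsOpen.measurableSet
  exact isOpen_lt (by fun_prop) continuous_const

lemma dstar_volume (q : ℤ × ℤ) : volume (dstar q) = 2 * volume (dyad q) := by
  have : dstar q = Metric.ball (dcen q) (2 ^ q.1) := by
    ext x; simp [dstar, Real.dist_eq]
  rw [this, Real.volume_ball, dyad_volume, ENNReal.ofReal_mul (by norm_num)]
  simp

lemma dyad_dist (q : ℤ × ℤ) {y : ℝ} (hy : y ∈ dyad q) : 2 * |y - dcen q| ≤ 2 ^ q.1 := by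
  unfold dyad at hy
  unfold dcen
  have h1 := hy.1
  have h2 := hy.2
  have : |y - (q.2 + 1/2 : ℝ) * 2 ^ q.1| ≤ 2 ^ q.1 / 2 := by
    rw [abs_le]; constructor <;> linarith
  linarith

lemma bad_part {K : ℝ → H1 →L[ℝ] H2} (hK : Continuous K) {B : ℝ} (hB : ∀ t, ‖K t‖ ≤ B)
    {A : ENNReal} (hA : ∀ y, ∫⁻ x in {x | 2 * |y| ≤ |x|}, ‖K (x - y) - K x‖ₑ ≤ A)
    {b : ℝ → H1} (hb : Integrable b) (q : ℤ × ℤ) (h0 : ∫ y in dyad q, b y = 0) :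
    ∫⁻ x in (dstar q)ᶜ, ‖∫ y in dyad q, K (x - y) (b y)‖ₑ ≤ A * ∫⁻ y in dyad q, ‖b y‖ₑ := by
  have hH : ∀ y ∈ dyad q, ∫⁻ x in (dstar q)ᶜ, ‖K (x - y) - K (x - dcen q)‖ₑ ≤ A := by
    intro y hy
    calc ∫⁻ x in (dstar q)ᶜ, ‖K (x - y) - K (x - dcen q)‖ₑ
        = ∫⁻ x, (dstar q)ᶜ.indicator (fun x => ‖K (x - y) - K (x - dcen q)‖ₑ) x := by
          rw [lintegral_indicator (dstar_measurable q).compl]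
      _ ≤ ∫⁻ x, ({x | 2 * |y - dcen q| ≤ |x|}.indicator
            (fun x => ‖K (x - (y - dcen q)) - K x‖ₑ)) (x - dcen q) := by
          apply lintegral_mono
          intro x
          by_cases hx : x ∈ (dstar q)ᶜ
          · simp only
            rw [Set.indicator_of_mem hx, Set.indicator_of_mem]
            · simp
            · simp only [dstar, Set.mem_compl_iff, Set.mem_ofPred_eq, not_lt] at hx ⊢
              exact (dyad_dist q hy).trans hx
          · rw [Set.indicator_of_notMem hx]; exact zero_le
      _ = ∫⁻ x, ({x | 2 * |y - dcen q| ≤ |x|}.indicator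
            (fun x => ‖K (x - (y - dcen q)) - K x‖ₑ)) x :=
          lintegral_sub_right_eq_self _ _
      _ ≤ A := by
          rw [lintegral_indicator]
          · exact hA _
          · exact (isClosed_le (by fun_prop) (by fun_prop)).measurableSet
  have h1 : ∀ x, ∫ y in dyad q, K (x - y) (b y)
      = ∫ y in dyad q, (K (x - y) - K (x - dcen q)) (b y) := by
    intro x
    simp only [sub_apply]
    rw [integral_sub (czop_integrable hK hB hb x).integrableOn
      ((K (x - dcen q)).integrable_comp hb).integrableOn,
      ContinuousLinearMap.integral_comp_comm _ hb.integrableOn, h0]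
    simp
  calc ∫⁻ x in (dstar q)ᶜ, ‖∫ y in dyad q, K (x - y) (b y)‖ₑ
      ≤ ∫⁻ x in (dstar q)ᶜ, ∫⁻ y in dyad q, ‖K (x - y) - K (x - dcen q)‖ₑ * ‖b y‖ₑ := by
        apply lintegral_mono
        intro x
        simp only
        rw [h1]
        refine (enorm_integral_le_lintegral_enorm _).trans (lintegral_mono fun y => ?_)
        exact ContinuousLinearMap.le_opENorm _ _
    _ = ∫⁻ y in dyad q, ∫⁻ x in (dstar q)ᶜ, ‖K (x - y) - K (x - dcen q)‖ₑ * ‖b y‖ₑ := by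
        apply lintegral_lintegral_swap
        refine AEMeasurable.mul (f := fun z : ℝ × ℝ => ‖K (z.1 - z.2) - K (z.1 - dcen q)‖ₑ)
          (g := fun z : ℝ × ℝ => ‖b z.2‖ₑ) ?_ ?_
        · have : Continuous fun z : ℝ × ℝ => ‖K (z.1 - z.2) - K (z.1 - dcen q)‖ₑ := by
            apply Continuous.enorm
            fun_prop
          exact this.measurable.aemeasurable
        · exact (hb.1.restrict (s := dyad q)).enorm.comp_snd
    _ = ∫⁻ y in dyad q, (∫⁻ x in (dstar q)ᶜ, ‖K (x - y) - K (x - dcen q)‖ₑ) * ‖b y‖ₑ := by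
        congr 1
        ext y
        rw [lintegral_mul_const]
        apply Continuous.measurable
        apply Continuous.enorm
        fun_prop
    _ ≤ ∫⁻ y in dyad q, A * ‖b y‖ₑ := by
        apply setLIntegral_mono' (dyad_measurable q)
        intro y hy
        gcongr
        exact hH y hy
    _ = A * ∫⁻ y in dyad q, ‖b y‖ₑ := by
        rw [lintegral_const_mul'' _ hb.1.restrict.enorm]

end cz
end

open scoped BigOperators RealInnerProductSpace
open MeasureTheory

noncomputable section

set_option linter.unusedSectionVars false
section cz
variable {H1 H2 : Type*} [NormedAddCommGroup H1] [NormedSpace ℝ H1] [CompleteSpace H1]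
  [NormedAddCommGroup H2] [NormedSpace ℝ H2] [CompleteSpace H2]

/-- The Calderón–Zygmund decomposition. -/
lemma cz_decomp {f : ℝ → H1} (hf : Continuous f) (hfi : Integrable f) {l : ℝ} (hl : 0 < l) :
    ∃ (J : Set (ℤ × ℤ)) (g : ℝ → H1), (Pairwise fun q q' : J => Disjoint (dyad q) (dyad q')) ∧
      Integrable g ∧ (∀ x, ‖g x‖ ≤ 2 * l) ∧
      (∀ x, x ∉ ⋃ q : J, dyad q → g x = f x) ∧
      (∀ x, x ∉ ⋃ q : J, dyad q → ‖f x‖ ≤ l) ∧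
      (∀ q : J, ∫ x in dyad q, (f x - g x) = 0) ∧
      (∀ q : J, ∫⁻ x in dyad q, ‖f x - g x‖ₑ ≤ ENNReal.ofReal (4 * l) * volume (dyad q)) ∧
      (∀ q : J, ENNReal.ofReal l * volume (dyad q) ≤
        2 * ∫⁻ x in dyad q, {x | l / 2 < ‖f x‖}.indicator (fun x => ‖f x‖ₑ) x) := by
  classical
  obtain ⟨J, hdis, hJ, hout⟩ := cz_selection (fun x => ‖f x‖) hf.norm (fun _ => norm_nonneg _)
    hfi.norm l hl
  have hvol : ∀ q : ℤ × ℤ, volume (dyad q) = ENNReal.ofReal (2 ^ q.1) := dyad_volume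
  have hvr : ∀ q : ℤ × ℤ, volume.real (dyad q) = 2 ^ q.1 := fun q => by
    rw [measureReal_def, hvol, ENNReal.toReal_ofReal (by positivity)]
  set m : ℤ × ℤ → H1 := fun q => ((2:ℝ) ^ q.1)⁻¹ • ∫ x in dyad q, f x with hm
  have hmn : ∀ q ∈ J, ‖m q‖ ≤ ((2:ℝ) ^ q.1)⁻¹ * ∫ x in dyad q, ‖f x‖ := by
    intro q hq
    rw [hm, norm_smul, Real.norm_of_nonneg (by positivity)]
    gcongr
    exact norm_integral_le_integral_norm _
  have hmn2 : ∀ q ∈ J, ‖m q‖ ≤ 2 * l := by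
    intro q hq
    refine (hmn q hq).trans ?_
    rw [inv_mul_le_iff₀ (by positivity)]
    have := (hJ q hq).2
    linarith
  let g : ℝ → H1 := fun x => if h : ∃ q : J, x ∈ dyad q then m h.choose else f x
  have hgI : ∀ (q : J), ∀ x ∈ dyad q, g x = m q := by
    intro q x hx
    have h : ∃ q : J, x ∈ dyad q := ⟨q, hx⟩
    simp only [g, dif_pos h]
    congr 2
    by_contra hne
    exact Set.disjoint_left.1 (hdis hne) h.choose_spec hx
  have hgO : ∀ x, x ∉ ⋃ q : J, dyad q → g x = f x := by
    intro x hx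
    simp only [Set.mem_iUnion] at hx
    simp only [g, dif_neg hx]
  have hmeasU : MeasurableSet (⋃ q : J, dyad q) := MeasurableSet.iUnion fun q => dyad_measurable q
  have hgm : AEStronglyMeasurable g volume := by
    have : g = (⋃ q : J, dyad q).piecewise g f := by
      ext x
      by_cases hx : x ∈ ⋃ q : J, dyad q
      · rw [Set.piecewise_eq_of_mem _ _ _ hx]
      · rw [Set.piecewise_eq_of_notMem _ _ _ hx, hgO x hx]
    rw [this]
    refine AEStronglyMeasurable.piecewise hmeasU ?_ hfi.1.restrict
    rw [aestronglyMeasurable_iUnion_iff]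
    intro q
    refine (aestronglyMeasurable_const (b := m q)).congr ?_
    refine ae_restrict_of_forall_mem (dyad_measurable q) fun x hx => (hgI q x hx).symm
  have hcI : ∀ q : J, ∫⁻ x in dyad q, ‖g x‖ₑ ≤ ∫⁻ x in dyad q, ‖f x‖ₑ := by
    intro q
    rw [setLIntegral_congr_fun (g := fun _ => ‖m q‖ₑ) (dyad_measurable q)
      (fun x hx => by simp only [hgI q x hx])]
    rw [lintegral_const, Measure.restrict_apply_univ, hvol]
    have h1 := hmn q q.2
    have h2 : ENNReal.ofReal (∫ x in dyad q, ‖f x‖) = ∫⁻ x in dyad q, ‖f x‖ₑ := by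
      rw [ofReal_integral_norm_eq_lintegral_enorm hfi.integrableOn]
    rw [← h2, ← ofReal_norm, ← ENNReal.ofReal_mul (norm_nonneg _)]
    apply ENNReal.ofReal_le_ofReal
    rw [← div_eq_inv_mul, le_div_iff₀ (by positivity)] at h1
    exact h1
  have hgi : Integrable g := by
    refine ⟨hgm, ?_⟩
    rw [hasFiniteIntegral_iff_enorm]
    have hfin := hfi.2
    rw [hasFiniteIntegral_iff_enorm] at hfin
    refine lt_of_le_of_lt ?_ hfin
    rw [← lintegral_add_compl _ hmeasU, ← lintegral_add_compl (fun x => ‖f x‖ₑ) hmeasU]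
    refine add_le_add ?_ ?_
    · rw [lintegral_iUnion (fun q : J => dyad_measurable q) hdis,
        lintegral_iUnion (fun q : J => dyad_measurable q) hdis]
      exact ENNReal.tsum_le_tsum hcI
    · apply le_of_eq
      exact setLIntegral_congr_fun hmeasU.compl (fun x hx => by simp only [hgO x hx])
  refine ⟨J, g, hdis, hgi, ?_, hgO, hout, ?_, ?_, ?_⟩
  · intro x
    by_cases hx : x ∈ ⋃ q : J, dyad q
    · obtain ⟨q, hq⟩ := Set.mem_iUnion.1 hx
      rw [hgI q x hq]; exact hmn2 q q.2
    · rw [hgO x hx]; have := hout x hx; linarith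
  · intro q
    rw [integral_sub hfi.integrableOn hgi.integrableOn,
      setIntegral_congr_fun (g := fun _ => m q) (dyad_measurable q) (fun x hx => hgI q x hx),
      setIntegral_const, hvr, hm]
    simp only
    rw [smul_smul, mul_inv_cancel₀ (by positivity), one_smul, sub_self]
  · intro q
    calc ∫⁻ x in dyad q, ‖f x - g x‖ₑ ≤ ∫⁻ x in dyad q, (‖f x‖ₑ + ‖g x‖ₑ) := 
          lintegral_mono fun x => enorm_sub_le
      _ = (∫⁻ x in dyad q, ‖f x‖ₑ) + ∫⁻ x in dyad q, ‖g x‖ₑ := by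
          rw [lintegral_add_left' hfi.1.restrict.enorm]
      _ ≤ (∫⁻ x in dyad q, ‖f x‖ₑ) + ∫⁻ x in dyad q, ‖f x‖ₑ := by gcongr _ + ?_; exact hcI q
      _ ≤ ENNReal.ofReal (4 * l) * volume (dyad q) := by
          rw [← ofReal_integral_norm_eq_lintegral_enorm hfi.integrableOn, hvol,
            ← ENNReal.ofReal_add (by positivity) (by positivity),
            ← ENNReal.ofReal_mul (by positivity)]
          apply ENNReal.ofReal_le_ofReal
          have := (hJ q q.2).2
          linarith
  · intro q
    have h1 := (hJ q q.2).1
    have h2 : ENNReal.ofReal (l * 2 ^ (q:ℤ × ℤ).1) ≤ ∫⁻ x in dyad q, ‖f x‖ₑ := by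
      rw [← ofReal_integral_norm_eq_lintegral_enorm hfi.integrableOn]
      exact ENNReal.ofReal_le_ofReal h1.le
    have h3 : ∫⁻ x in dyad q, ‖f x‖ₑ ≤ (∫⁻ x in dyad q,
        {x | l / 2 < ‖f x‖}.indicator (fun x => ‖f x‖ₑ) x) + ENNReal.ofReal (l / 2 * 2 ^ (q:ℤ × ℤ).1) := by
      calc ∫⁻ x in dyad q, ‖f x‖ₑ ≤ ∫⁻ x in dyad q,
          ({x | l / 2 < ‖f x‖}.indicator (fun x => ‖f x‖ₑ) x + ENNReal.ofReal (l/2)) := by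
            apply lintegral_mono
            intro x
            by_cases hx : l / 2 < ‖f x‖
            · simp only
              rw [Set.indicator_of_mem (by exact hx)]
              exact le_self_add
            · simp only
              rw [Set.indicator_of_notMem (by exact hx), zero_add, ← ofReal_norm]
              exact ENNReal.ofReal_le_ofReal (not_lt.1 hx)
        _ = _ := by
            rw [lintegral_add_right _ measurable_const, lintegral_const,
              Measure.restrict_apply_univ, hvol, ENNReal.ofReal_mul (by positivity)]
    have h4 := h2.trans h3
    rw [show l * 2 ^ (q:ℤ × ℤ).1 = l / 2 * 2 ^ (q:ℤ × ℤ).1 + l / 2 * 2 ^ (q:ℤ × ℤ).1 by ring,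
      ENNReal.ofReal_add (by positivity) (by positivity),
      ENNReal.add_le_add_iff_right ENNReal.ofReal_ne_top] at h4
    rw [hvol, ← ENNReal.ofReal_mul hl.le,
      show l * 2 ^ (q:ℤ × ℤ).1 = 2 * (l / 2 * 2 ^ (q:ℤ × ℤ).1) by ring,
      ENNReal.ofReal_mul (by norm_num)]
    simp only [ENNReal.ofReal_ofNat]
    gcongr

lemma cz_weak {K : ℝ → H1 →L[ℝ] H2} (hK : Continuous K) {B : ℝ} (hB : ∀ t, ‖K t‖ ≤ B)
    {A : ENNReal} (hA1 : 1 ≤ A)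
    (hA : ∀ y, ∫⁻ x in {x | 2 * |y| ≤ |x|}, ‖K (x - y) - K x‖ₑ ≤ A)
    (hL2 : ∀ f : ℝ → H1, Integrable f → (∃ M, ∀ x, ‖f x‖ ≤ M) →
      ∫⁻ x, ‖czop K f x‖ₑ ^ 2 ≤ A ^ 2 * ∫⁻ x, ‖f x‖ₑ ^ 2)
    {f : ℝ → H1} (hf : Continuous f) (hfi : Integrable f) {l : ℝ} (hl : 0 < l) :
    volume {x | 2 * l < ‖czop K f x‖} ≤
      A ^ 2 * (20 * (∫⁻ x, {x | l / 2 < ‖f x‖}.indicator (fun x => ‖f x‖ₑ) x) / ENNReal.ofReal l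
        + (∫⁻ x, {x | ‖f x‖ ≤ l}.indicator (fun x => ‖f x‖ₑ ^ 2) x) / ENNReal.ofReal l ^ 2) := by
  obtain ⟨J, g, hdis, hgi, hgb, hgO, hfO, hb0, hb1, hV⟩ := cz_decomp hf hfi hl
  set F1 := ∫⁻ x, {x | l / 2 < ‖f x‖}.indicator (fun x => ‖f x‖ₑ) x with hF1
  set F2 := ∫⁻ x, {x | ‖f x‖ ≤ l}.indicator (fun x => ‖f x‖ₑ ^ 2) x with hF2
  set L := ENNReal.ofReal l with hLdef
  have hL0 : L ≠ 0 := by rw [hLdef]; simpa using hl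
  have hLt : L ≠ ⊤ := ENNReal.ofReal_ne_top
  have h4L : ENNReal.ofReal (4 * l) = 4 * L := by
    rw [ENNReal.ofReal_mul (by norm_num)]; simp [hLdef]
  have h2L : ENNReal.ofReal (2 * l) = 2 * L := by
    rw [ENNReal.ofReal_mul (by norm_num)]; simp [hLdef]
  rw [h4L] at hb1
  set U := ⋃ q : J, dyad q with hU
  set V := volume U with hVdef
  have hUm : MeasurableSet U := MeasurableSet.iUnion fun q => dyad_measurable q
  have hVs : V = ∑' q : J, volume (dyad q) := measure_iUnion hdis fun q => dyad_measurable q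
  -- bound on V
  have hV1 : V ≤ 2 * F1 / L := by
    rw [ENNReal.le_div_iff_mul_le (Or.inl hL0) (Or.inl hLt), mul_comm, hVs, ← ENNReal.tsum_mul_left]
    calc ∑' q : J, L * volume (dyad q) ≤ ∑' q : J,
        2 * ∫⁻ x in dyad q, {x | l / 2 < ‖f x‖}.indicator (fun x => ‖f x‖ₑ) x :=
          ENNReal.tsum_le_tsum hV
      _ = 2 * ∫⁻ x in U, {x | l / 2 < ‖f x‖}.indicator (fun x => ‖f x‖ₑ) x := by
          rw [ENNReal.tsum_mul_left, hU, lintegral_iUnion (fun q : J => dyad_measurable q) hdis]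
      _ ≤ 2 * F1 := by
          gcongr
          exact setLIntegral_le_lintegral _ _
  -- good part
  have hg2 : ∫⁻ x, ‖g x‖ₑ ^ 2 ≤ 4 * L ^ 2 * V + F2 := by
    rw [← lintegral_add_compl _ hUm]
    gcongr
    · calc ∫⁻ x in U, ‖g x‖ₑ ^ 2 ≤ ∫⁻ x in U, (2 * L) ^ 2 := by
            apply lintegral_mono
            intro x
            simp only
            gcongr
            rw [← h2L, ← ofReal_norm]
            exact ENNReal.ofReal_le_ofReal (hgb x)
        _ = 4 * L ^ 2 * V := by
            rw [lintegral_const, Measure.restrict_apply_univ, mul_pow, hVdef]; norm_num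
    · calc ∫⁻ x in Uᶜ, ‖g x‖ₑ ^ 2
          ≤ ∫⁻ x in Uᶜ, {x | ‖f x‖ ≤ l}.indicator (fun x => ‖f x‖ₑ ^ 2) x := by
            apply setLIntegral_mono' hUm.compl
            intro x hx
            rw [hgO x hx, Set.indicator_of_mem (show x ∈ {x | ‖f x‖ ≤ l} from hfO x hx)]
        _ ≤ F2 := setLIntegral_le_lintegral _ _
  have hTg := hL2 g hgi ⟨_, hgb⟩
  have hTgc : Continuous (czop K g) := czop_continuous hK hB hgi
  have h1 : volume {x | L ≤ ‖czop K g x‖ₑ} ≤ A ^ 2 * (4 * V) + A ^ 2 * (F2 / L ^ 2) := by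
    have e1 : {x | L ≤ ‖czop K g x‖ₑ} ⊆ {x | L ^ 2 ≤ ‖czop K g x‖ₑ ^ 2} := by
      intro x hx
      have hx' : L ≤ ‖czop K g x‖ₑ := hx
      show L ^ 2 ≤ ‖czop K g x‖ₑ ^ 2
      gcongr
    have hL20 : L ^ 2 ≠ 0 := pow_ne_zero 2 hL0
    have hL2t : L ^ 2 ≠ ⊤ := ENNReal.pow_ne_top hLt
    have e2 : volume {x | L ^ 2 ≤ ‖czop K g x‖ₑ ^ 2} ≤ (∫⁻ x, ‖czop K g x‖ₑ ^ 2) / L ^ 2 :=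
      meas_ge_le_lintegral_div (by fun_prop) hL20 hL2t
    refine (measure_mono e1).trans (e2.trans ?_)
    rw [ENNReal.div_le_iff hL20 hL2t]
    refine hTg.trans ((mul_le_mul_right hg2 _).trans (le_of_eq ?_))
    rw [add_mul, mul_add, mul_assoc (A ^ 2) (F2 / L ^ 2), ENNReal.div_mul_cancel hL20 hL2t]
    ring
  -- bad part
  set b : ℝ → H1 := fun x => f x - g x with hb
  have hbi : Integrable b := hfi.sub hgi
  have hbO : ∀ x, x ∉ U → b x = 0 := by
    intro x hx; simp [hb, hgO x hx]
  set W := ⋃ q : J, dstar q with hW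
  have hWm : MeasurableSet W := MeasurableSet.iUnion fun q => dstar_measurable q
  have h2 : volume W ≤ 2 * V := by
    refine (measure_iUnion_le _).trans ?_
    rw [hVs, ← ENNReal.tsum_mul_left]
    exact ENNReal.tsum_le_tsum fun q => (dstar_volume _).le
  have hTbc : Continuous (czop K b) := czop_continuous hK hB hbi
  have hTb : ∀ x, ‖czop K b x‖ₑ ≤ ∑' q : J, ‖∫ y in dyad q, K (x - y) (b y)‖ₑ := by
    intro x
    have hintg := czop_integrable hK hB hbi x
    have : czop K b x = ∫ y in U, K (x - y) (b y) := by
      unfold czop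
      rw [setIntegral_eq_integral_of_forall_compl_eq_zero]
      intro y hy
      rw [hbO y hy, map_zero]
    rw [this, hU, integral_iUnion (fun q : J => dyad_measurable q) hdis hintg.integrableOn]
    exact enorm_tsum_le_tsum_enorm
  have h3i : ∫⁻ x in Wᶜ, ‖czop K b x‖ₑ ≤ 4 * A * L * V := by
    calc ∫⁻ x in Wᶜ, ‖czop K b x‖ₑ ≤ ∫⁻ x in Wᶜ, ∑' q : J, ‖∫ y in dyad q, K (x - y) (b y)‖ₑ :=
          lintegral_mono fun x => hTb x
      _ = ∑' q : J, ∫⁻ x in Wᶜ, ‖∫ y in dyad q, K (x - y) (b y)‖ₑ := by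
          rw [lintegral_tsum]
          intro q
          have hc : Continuous fun x => ∫ y in dyad q, K (x - y) (b y) := by
            have := czop_continuous hK hB (hbi.indicator (dyad_measurable q))
            refine this.congr fun x => ?_
            unfold czop
            rw [← integral_indicator (dyad_measurable q)]
            congr 1
            ext y
            by_cases hy : y ∈ dyad (q : ℤ × ℤ)
            · simp [hy]
            · simp [hy]
          exact hc.enorm.measurable.aemeasurable
      _ ≤ ∑' q : J, A * (4 * L * volume (dyad q)) := by
          apply ENNReal.tsum_le_tsum
          intro q
          calc ∫⁻ x in Wᶜ, ‖∫ y in dyad q, K (x - y) (b y)‖ₑ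
              ≤ ∫⁻ x in (dstar q)ᶜ, ‖∫ y in dyad q, K (x - y) (b y)‖ₑ := by
                apply lintegral_mono_set
                apply Set.compl_subset_compl.2
                exact Set.subset_iUnion (fun q : J => dstar q) q
            _ ≤ A * ∫⁻ y in dyad q, ‖b y‖ₑ := bad_part hK hB hA hbi q (hb0 q)
            _ ≤ _ := by gcongr; exact hb1 q
      _ = 4 * A * L * V := by
          rw [ENNReal.tsum_mul_left, ENNReal.tsum_mul_left, ← hVs]; ring
  have h3 : volume {x | x ∈ Wᶜ ∧ L ≤ ‖czop K b x‖ₑ} ≤ 4 * A * V := by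
    have e : {x | x ∈ Wᶜ ∧ L ≤ ‖czop K b x‖ₑ} = {x | L ≤ ‖czop K b x‖ₑ} ∩ Wᶜ := by
      ext x; exact and_comm
    rw [e, ← Measure.restrict_apply' hWm.compl]
    refine (meas_ge_le_lintegral_div (by fun_prop) hL0 hLt).trans ?_
    rw [ENNReal.div_le_iff hL0 hLt]
    refine h3i.trans (le_of_eq (by ring))
  -- combine
  have hsub : {x | 2 * l < ‖czop K f x‖} ⊆
      ({x | L ≤ ‖czop K g x‖ₑ} ∪ W) ∪ {x | x ∈ Wᶜ ∧ L ≤ ‖czop K b x‖ₑ} := by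
    intro x hx
    have hx' : 2 * l < ‖czop K f x‖ := hx
    have hsum : czop K f x = czop K g x + czop K b x := by
      unfold czop
      rw [← integral_add (czop_integrable hK hB hgi x) (czop_integrable hK hB hbi x)]
      congr 1
      ext y
      simp [hb]
    by_cases h : l ≤ ‖czop K g x‖
    · left; left
      change L ≤ ‖czop K g x‖ₑ
      rw [← ofReal_norm]; exact ENNReal.ofReal_le_ofReal h
    · by_cases hxW : x ∈ W
      · left; right; exact hxW
      · right
        refine ⟨hxW, ?_⟩
        rw [← ofReal_norm]; apply ENNReal.ofReal_le_ofReal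
        have := norm_add_le (czop K g x) (czop K b x)
        rw [← hsum] at this
        linarith
  have hAA : A ≤ A ^ 2 := by
    calc A = 1 * A := (one_mul _).symm
      _ ≤ A * A := by gcongr
      _ = A ^ 2 := (sq A).symm
  have h1A : 1 ≤ A ^ 2 := hA1.trans hAA
  calc volume {x | 2 * l < ‖czop K f x‖}
      ≤ (A ^ 2 * (4 * V) + A ^ 2 * (F2 / L ^ 2)) + 2 * V + 4 * A * V := by
        refine (measure_mono hsub).trans ((measure_union_le _ _).trans ?_)
        refine add_le_add ((measure_union_le _ _).trans ?_) h3
        exact add_le_add h1 h2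
    _ ≤ (A ^ 2 * (4 * V) + A ^ 2 * (F2 / L ^ 2)) + 2 * (A ^ 2) * V + 4 * A ^ 2 * V := by
        gcongr
        calc (2 : ENNReal) = 2 * 1 := (mul_one _).symm
          _ ≤ 2 * A ^ 2 := by gcongr
    _ = A ^ 2 * (10 * V + F2 / L ^ 2) := by ring
    _ ≤ A ^ 2 * (10 * (2 * F1 / L) + F2 / L ^ 2) := by gcongr
    _ = _ := by
        congr 2
        rw [← mul_div_assoc, ← mul_assoc]; norm_num

end cz
end

open scoped BigOperators RealInnerProductSpace
open MeasureTheory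

noncomputable section

set_option linter.unusedSectionVars false

lemma lc_one {p s : ℝ} (hp : 1 < p) (hs : 0 ≤ s) :
    ∫⁻ t in Set.Ioi (0:ℝ), {t | t / 2 < s}.indicator (fun t => ENNReal.ofReal (t ^ (p - 2))) t
      = ENNReal.ofReal ((2 * s) ^ (p - 1) / (p - 1)) := by
  have hset : {t : ℝ | t / 2 < s} = Set.Iio (2 * s) := by
    ext t; simp only [Set.mem_ofPred_eq, Set.mem_Iio]; constructor <;> intro h <;> linarith
  have hI : IntervalIntegrable (fun t : ℝ => t ^ (p - 2)) volume 0 (2 * s) :=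
    intervalIntegral.intervalIntegrable_rpow' (by linarith)
  rw [hset, lintegral_indicator measurableSet_Iio, Measure.restrict_restrict measurableSet_Iio,
    Set.inter_comm, Set.Ioi_inter_Iio, setLIntegral_congr Ioo_ae_eq_Ioc,
    ← ofReal_integral_eq_lintegral_ofReal, ← intervalIntegral.integral_of_le (by positivity),
    integral_rpow (Or.inl (by linarith))]
  · congr 1
    rw [show p - 2 + 1 = p - 1 by ring, Real.zero_rpow (by linarith), sub_zero]
  · exact (intervalIntegrable_iff_integrableOn_Ioc_of_le (by positivity)).1 hI
  · filter_upwards [self_mem_ae_restrict measurableSet_Ioc] with t ht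
    exact Real.rpow_nonneg ht.1.le _

lemma lc_two {p s : ℝ} (hp : p < 2) (hs : 0 < s) :
    ∫⁻ t in Set.Ioi (0:ℝ), {t | s ≤ t}.indicator (fun t => ENNReal.ofReal (t ^ (p - 3))) t
      = ENNReal.ofReal (s ^ (p - 2) / (2 - p)) := by
  have hset : {t : ℝ | s ≤ t} = Set.Ici s := rfl
  rw [hset, lintegral_indicator measurableSet_Ici, Measure.restrict_restrict measurableSet_Ici,
    Set.inter_eq_left.2 (show Set.Ici s ⊆ Set.Ioi 0 from fun x hx => lt_of_lt_of_le hs hx),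
    setLIntegral_congr Ioi_ae_eq_Ici.symm,
    ← ofReal_integral_eq_lintegral_ofReal, integral_Ioi_rpow_of_lt (by linarith) hs]
  · congr 1
    rw [show p - 3 + 1 = p - 2 by ring, neg_div, ← div_neg, neg_sub]
  · exact integrableOn_Ioi_rpow_of_lt (by linarith) hs
  · filter_upwards [self_mem_ae_restrict measurableSet_Ioi] with t ht
    exact Real.rpow_nonneg (hs.trans ht).le _

/-- The constant of the strong type estimate. -/
def czC (p : ℝ) : ℝ := 2 ^ p * (p * (20 * (2 ^ (p - 1) / (p - 1)) + 1 / (2 - p)))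

section cz
variable {H1 H2 : Type*} [NormedAddCommGroup H1] [NormedSpace ℝ H1] [CompleteSpace H1]
  [NormedAddCommGroup H2] [NormedSpace ℝ H2] [CompleteSpace H2]

lemma lc_oneF {f : ℝ → H1} (hf : Continuous f) {p : ℝ} (hp : 1 < p) :
    ∫⁻ t in Set.Ioi (0:ℝ), (∫⁻ x, {x | t / 2 < ‖f x‖}.indicator (fun x => ‖f x‖ₑ) x) *
      ENNReal.ofReal (t ^ (p - 2)) = ENNReal.ofReal (2 ^ (p - 1) / (p - 1)) * ∫⁻ x, ‖f x‖ₑ ^ p := by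
  have hm : Measurable fun q : ℝ × ℝ => 
      {q : ℝ × ℝ | q.1 / 2 < ‖f q.2‖}.indicator
        (fun q => ‖f q.2‖ₑ * ENNReal.ofReal (q.1 ^ (p - 2))) q := by
    apply Measurable.indicator
    · have h1 : Measurable fun q : ℝ × ℝ => ‖f q.2‖ₑ := hf.enorm.measurable.comp measurable_snd
      fun_prop
    · exact measurableSet_lt (measurable_fst.div_const 2) (hf.norm.measurable.comp measurable_snd)
  calc _ = ∫⁻ t in Set.Ioi (0:ℝ), ∫⁻ x, {q : ℝ × ℝ | q.1 / 2 < ‖f q.2‖}.indicator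
        (fun q => ‖f q.2‖ₑ * ENNReal.ofReal (q.1 ^ (p - 2))) (t, x) := by
        congr 1; ext t
        rw [← lintegral_mul_const' _ _ ENNReal.ofReal_ne_top]
        congr 1; ext x
        by_cases h : t / 2 < ‖f x‖ <;> simp [Set.indicator, h]
    _ = ∫⁻ x, ∫⁻ t in Set.Ioi (0:ℝ), {q : ℝ × ℝ | q.1 / 2 < ‖f q.2‖}.indicator
        (fun q => ‖f q.2‖ₑ * ENNReal.ofReal (q.1 ^ (p - 2))) (t, x) := by
        rw [lintegral_lintegral_swap hm.aemeasurable]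
    _ = ∫⁻ x, ENNReal.ofReal (2 ^ (p - 1) / (p - 1)) * ‖f x‖ₑ ^ p := by
        congr 1; ext x
        have := lc_one (s := ‖f x‖) hp (norm_nonneg _)
        calc _ = ∫⁻ t in Set.Ioi (0:ℝ), ‖f x‖ₑ * {t | t / 2 < ‖f x‖}.indicator
              (fun t => ENNReal.ofReal (t ^ (p - 2))) t := by
              congr 1; ext t
              by_cases h : t / 2 < ‖f x‖ <;> simp [Set.indicator, h]
          _ = _ := by
              rw [lintegral_const_mul' _ _ enorm_ne_top, this, ← ofReal_norm,
                ENNReal.ofReal_rpow_of_nonneg (norm_nonneg _) (by linarith),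
                ← ENNReal.ofReal_mul (norm_nonneg _), ← ENNReal.ofReal_mul]
              · congr 1
                rw [Real.mul_rpow (by norm_num) (norm_nonneg _)]
                have : ‖f x‖ ^ p = ‖f x‖ * ‖f x‖ ^ (p - 1) := by
                  rw [← Real.rpow_one_add' (norm_nonneg _) (by linarith)]; congr 1; ring
                rw [this]; ring
              · have : 0 < p - 1 := by linarith
                positivity
    _ = _ := lintegral_const_mul' _ _ ENNReal.ofReal_ne_top

lemma lc_twoF {f : ℝ → H1} (hf : Continuous f) {p : ℝ} (hp0 : 0 < p) (hp : p < 2) :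
    ∫⁻ t in Set.Ioi (0:ℝ), (∫⁻ x, {x | ‖f x‖ ≤ t}.indicator (fun x => ‖f x‖ₑ ^ 2) x) *
      ENNReal.ofReal (t ^ (p - 3)) = ENNReal.ofReal (1 / (2 - p)) * ∫⁻ x, ‖f x‖ₑ ^ p := by
  have hm : Measurable fun q : ℝ × ℝ => 
      {q : ℝ × ℝ | ‖f q.2‖ ≤ q.1}.indicator
        (fun q => ‖f q.2‖ₑ ^ 2 * ENNReal.ofReal (q.1 ^ (p - 3))) q := by
    apply Measurable.indicator
    · have h1 : Measurable fun q : ℝ × ℝ => ‖f q.2‖ₑ := hf.enorm.measurable.comp measurable_snd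
      fun_prop
    · exact measurableSet_le (hf.norm.measurable.comp measurable_snd) measurable_fst
  calc _ = ∫⁻ t in Set.Ioi (0:ℝ), ∫⁻ x, {q : ℝ × ℝ | ‖f q.2‖ ≤ q.1}.indicator
        (fun q => ‖f q.2‖ₑ ^ 2 * ENNReal.ofReal (q.1 ^ (p - 3))) (t, x) := by
        congr 1; ext t
        rw [← lintegral_mul_const' _ _ ENNReal.ofReal_ne_top]
        congr 1; ext x
        by_cases h : ‖f x‖ ≤ t <;> simp [Set.indicator, h]
    _ = ∫⁻ x, ∫⁻ t in Set.Ioi (0:ℝ), {q : ℝ × ℝ | ‖f q.2‖ ≤ q.1}.indicator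
        (fun q => ‖f q.2‖ₑ ^ 2 * ENNReal.ofReal (q.1 ^ (p - 3))) (t, x) := by
        rw [lintegral_lintegral_swap hm.aemeasurable]
    _ = ∫⁻ x, ENNReal.ofReal (1 / (2 - p)) * ‖f x‖ₑ ^ p := by
        congr 1; ext x
        calc _ = ∫⁻ t in Set.Ioi (0:ℝ), ‖f x‖ₑ ^ 2 * {t | ‖f x‖ ≤ t}.indicator
              (fun t => ENNReal.ofReal (t ^ (p - 3))) t := by
              congr 1; ext t
              by_cases h : ‖f x‖ ≤ t <;> simp [Set.indicator, h]
          _ = _ := by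
              rw [lintegral_const_mul' _ _ (ENNReal.pow_ne_top enorm_ne_top)]
              rcases eq_or_ne (f x) 0 with h0 | h0
              · simp [h0, ENNReal.zero_rpow_of_pos hp0]
              have h0' : 0 < ‖f x‖ := norm_pos_iff.2 h0
              rw [lc_two hp h0', ← ofReal_norm,
                ENNReal.ofReal_rpow_of_pos h0', ← ENNReal.ofReal_pow (norm_nonneg _),
                ← ENNReal.ofReal_mul (by positivity), ← ENNReal.ofReal_mul]
              · congr 1
                have : ‖f x‖ ^ p = ‖f x‖ ^ 2 * ‖f x‖ ^ (p - 2) := by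
                  rw [← Real.rpow_natCast, ← Real.rpow_add h0']; congr 1; push_cast; ring
                rw [this]; ring
              · have : 0 < 2 - p := by linarith
                positivity
    _ = _ := lintegral_const_mul' _ _ ENNReal.ofReal_ne_top

/-- Strong type estimate for `1 < p < 2`. -/
lemma cz_strong {K : ℝ → H1 →L[ℝ] H2} (hK : Continuous K) {B : ℝ} (hB : ∀ t, ‖K t‖ ≤ B)
    {A : ENNReal} (hA1 : 1 ≤ A) (hAt : A ≠ ⊤)
    (hA : ∀ y, ∫⁻ x in {x | 2 * |y| ≤ |x|}, ‖K (x - y) - K x‖ₑ ≤ A)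
    (hL2 : ∀ f : ℝ → H1, Integrable f → (∃ M, ∀ x, ‖f x‖ ≤ M) →
      ∫⁻ x, ‖czop K f x‖ₑ ^ 2 ≤ A ^ 2 * ∫⁻ x, ‖f x‖ₑ ^ 2)
    {f : ℝ → H1} (hf : Continuous f) (hfi : Integrable f) {p : ℝ} (hp1 : 1 < p) (hp2 : p < 2) :
    ∫⁻ x, ‖czop K f x‖ₑ ^ p ≤ ENNReal.ofReal (czC p) * A ^ 2 * ∫⁻ x, ‖f x‖ₑ ^ p := by
  have hTc : Continuous (czop K f) := czop_continuous hK hB hfi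
  have hp0 : 0 < p := by linarith
  have h1 := lintegral_rpow_eq_lintegral_meas_lt_mul volume
    (f := fun x => ‖czop K f x‖ / 2) (Filter.Eventually.of_forall fun x => by positivity)
    ((hTc.norm.div_const 2).measurable.aemeasurable) hp0
  have h2 : ∫⁻ x, ‖czop K f x‖ₑ ^ p = ENNReal.ofReal (2 ^ p) *
      ∫⁻ x, ENNReal.ofReal ((‖czop K f x‖ / 2) ^ p) := by
    rw [← lintegral_const_mul' _ _ ENNReal.ofReal_ne_top]
    congr 1; ext x
    rw [← ENNReal.ofReal_mul (by positivity), ← Real.mul_rpow (by norm_num) (by positivity),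
      mul_div_cancel₀ _ (by norm_num), ← ofReal_norm,
      ENNReal.ofReal_rpow_of_nonneg (norm_nonneg _) hp0.le]
  have h3 : ∫⁻ t in Set.Ioi (0:ℝ), volume {x | t < ‖czop K f x‖ / 2} * ENNReal.ofReal (t ^ (p - 1))
      ≤ A ^ 2 * (20 * (ENNReal.ofReal (2 ^ (p - 1) / (p - 1)) * ∫⁻ x, ‖f x‖ₑ ^ p) +
        ENNReal.ofReal (1 / (2 - p)) * ∫⁻ x, ‖f x‖ₑ ^ p) := by
    have hm : Measurable fun t : ℝ => 20 * ((∫⁻ x, {x | t / 2 < ‖f x‖}.indicator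
        (fun x => ‖f x‖ₑ) x) * ENNReal.ofReal (t ^ (p - 2))) := by
      have : Measurable fun q : ℝ × ℝ => {q : ℝ × ℝ | q.1 / 2 < ‖f q.2‖}.indicator
          (fun q => ‖f q.2‖ₑ) q := by
        apply Measurable.indicator
        · have h1 : Measurable fun q : ℝ × ℝ => ‖f q.2‖ₑ := hf.enorm.measurable.comp measurable_snd
          fun_prop
        · exact measurableSet_lt (measurable_fst.div_const 2) (hf.norm.measurable.comp measurable_snd)
      have h := this.lintegral_prod_right' (ν := (volume : Measure ℝ))
      have h' : Measurable fun t : ℝ => ∫⁻ x, {x | t / 2 < ‖f x‖}.indicator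
        (fun x => ‖f x‖ₑ) x := h
      fun_prop
    rw [← lc_oneF hf hp1, ← lc_twoF hf hp0 hp2, ← lintegral_const_mul' _ _ (by norm_num),
      ← lintegral_add_left hm,
      ← lintegral_const_mul' _ _ (ENNReal.pow_ne_top hAt)]
    apply setLIntegral_mono' measurableSet_Ioi
    intro t ht
    have ht' : 0 < t := ht
    have hw := cz_weak hK hB hA1 hA hL2 hf hfi ht'
    have hs : {x | t < ‖czop K f x‖ / 2} = {x | 2 * t < ‖czop K f x‖} := by
      ext x; simp only [Set.mem_ofPred_eq]; constructor <;> intro h <;> linarith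
    rw [hs]
    refine (mul_le_mul_left hw _).trans (le_of_eq ?_)
    rw [mul_assoc, add_mul]
    congr 2
    · rw [mul_div_assoc, mul_assoc, div_eq_mul_inv, mul_assoc, ← ENNReal.ofReal_inv_of_pos ht',
        ← ENNReal.ofReal_mul (by positivity), ← Real.rpow_neg_one, ← Real.rpow_add ht']
      ring_nf
    · rw [div_eq_mul_inv, mul_assoc, ← ENNReal.ofReal_pow ht'.le,
        ← ENNReal.ofReal_inv_of_pos (by positivity),
        ← ENNReal.ofReal_mul (by positivity), ← Real.rpow_natCast, ← Real.rpow_neg ht'.le,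
        ← Real.rpow_add ht']
      push_cast
      ring_nf
  rw [h2, h1]
  have hq1 : 0 < p - 1 := by linarith
  have hq2 : 0 < 2 - p := by linarith
  calc _ ≤ ENNReal.ofReal (2 ^ p) * (ENNReal.ofReal p * (A ^ 2 * (20 * (ENNReal.ofReal (2 ^ (p - 1) / (p - 1)) * ∫⁻ x, ‖f x‖ₑ ^ p) +
        ENNReal.ofReal (1 / (2 - p)) * ∫⁻ x, ‖f x‖ₑ ^ p))) := by gcongr
    _ = _ := by
        unfold czC
        rw [ENNReal.ofReal_mul (by positivity), ENNReal.ofReal_mul (by positivity),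
          ENNReal.ofReal_add (by positivity) (by positivity), ENNReal.ofReal_mul (by positivity)]
        simp only [ENNReal.ofReal_ofNat]
        ring
end cz

end

open scoped BigOperators RealInnerProductSpace
open MeasureTheory

noncomputable section

set_option linter.unusedSectionVars false

section dual
variable {H : Type*} [NormedAddCommGroup H] [InnerProductSpace ℝ H]

lemma continuous_norm_rpow_smul {p : ℝ} (hp : 1 < p) : Continuous fun h : H => ‖h‖ ^ (p - 2) • h := by
  rw [continuous_iff_continuousAt]
  intro h
  rcases eq_or_ne h 0 with rfl | h0
  · unfold ContinuousAt
    simp only [smul_zero]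
    rw [tendsto_zero_iff_norm_tendsto_zero]
    have : Filter.Tendsto (fun h : H => ‖h‖ ^ (p - 1)) (nhds 0) (nhds 0) := by
      have hc : Continuous fun h : H => ‖h‖ ^ (p - 1) :=
        continuous_norm.rpow_const fun x => Or.inr (by linarith)
      have := hc.tendsto 0
      simpa [Real.zero_rpow (show p - 1 ≠ 0 by linarith)] using this
    refine squeeze_zero (fun _ => norm_nonneg _) (fun h => ?_) this
    rcases eq_or_ne h 0 with rfl | h0
    · simp [Real.zero_rpow (show p - 1 ≠ 0 by linarith)]
    rw [norm_smul, Real.norm_of_nonneg (by positivity), show p - 1 = p - 2 + 1 by ring,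
      Real.rpow_add_one (norm_ne_zero_iff.2 h0)]
  · exact (continuous_norm.continuousAt.rpow_const (Or.inl (norm_ne_zero_iff.2 h0))).smul
      continuousAt_id

variable {X : Type*} [NormedAddCommGroup X] [ProperSpace X] [MeasurableSpace X] [BorelSpace X]

lemma dual_bound {μ : Measure X} [IsFiniteMeasureOnCompacts μ] {v : X → H} (hv : Continuous v)
    {p q : ℝ} (hpq : p.HolderConjugate q) {C : ENNReal}
    (h : ∀ g : X → H, Continuous g → HasCompactSupport g →
      ENNReal.ofReal (∫ x, ⟪g x, v x⟫ ∂μ) ≤ C * (∫⁻ x, ‖g x‖ₑ ^ q ∂μ) ^ (1 / q)) :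
    ∫⁻ x, ‖v x‖ₑ ^ p ∂μ ≤ C ^ p := by
  have hp1 := hpq.lt
  have hp0 : 0 < p := by linarith
  have hq1 := hpq.symm.lt
  have key : ∀ R : ℕ, ∫⁻ x in Metric.closedBall 0 R, ‖v x‖ₑ ^ p ∂μ ≤ C ^ p := by
    intro R
    set χ : X → ℝ := fun x => max 0 (min 1 (R + 1 - ‖x‖)) with hχ
    have hχc : Continuous χ := by fun_prop
    have hχ0 : ∀ x, 0 ≤ χ x := fun x => le_max_left _ _
    have hχ1 : ∀ x, χ x ≤ 1 := fun x => max_le zero_le_one (min_le_left _ _)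
    have hχs : HasCompactSupport χ := by
      apply HasCompactSupport.intro (isCompact_closedBall 0 (R + 1 : ℝ))
      intro x hx
      have : (R:ℝ) + 1 < ‖x‖ := by simpa using hx
      simp only [hχ]
      apply max_eq_left
      exact (min_le_right _ _).trans (by linarith)
    have hχb : ∀ x ∈ Metric.closedBall (0:X) R, χ x = 1 := by
      intro x hx
      have : ‖x‖ ≤ R := by simpa using hx
      simp only [hχ]
      rw [min_eq_left (by linarith), max_eq_right zero_le_one]
    set g : X → H := fun x => χ x • (‖v x‖ ^ (p - 2) • v x) with hg
    have hgc : Continuous g := hχc.smul ((continuous_norm_rpow_smul hp1).comp hv)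
    have hgs : HasCompactSupport g := hχs.smul_right
    have hin : ∀ x, ⟪g x, v x⟫ = χ x * ‖v x‖ ^ p := by
      intro x
      simp only [hg]
      rw [real_inner_smul_left, real_inner_smul_left, real_inner_self_eq_norm_sq]
      rcases eq_or_ne (v x) 0 with h0 | h0
      · simp [h0, Real.zero_rpow hp0.ne']
      rw [← Real.rpow_natCast, ← Real.rpow_add (norm_pos_iff.2 h0)]
      congr 2
      push_cast; ring
    set I := ∫⁻ x, ENNReal.ofReal (χ x * ‖v x‖ ^ p) ∂μ with hI
    have hcI : Continuous fun x => χ x * ‖v x‖ ^ p :=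
      hχc.mul (hv.norm.rpow_const fun x => Or.inr hp0.le)
    have hintg : Integrable (fun x => χ x * ‖v x‖ ^ p) μ :=
      hcI.integrable_of_hasCompactSupport hχs.mul_right
    have hnn : ∀ x, 0 ≤ χ x * ‖v x‖ ^ p := fun x =>
      mul_nonneg (hχ0 x) (Real.rpow_nonneg (norm_nonneg _) _)
    have hIe : ENNReal.ofReal (∫ x, ⟪g x, v x⟫ ∂μ) = I := by
      simp_rw [hin]
      exact ofReal_integral_eq_lintegral_ofReal hintg (Filter.Eventually.of_forall hnn)
    have hIt : I ≠ ⊤ := by rw [← hIe]; exact ENNReal.ofReal_ne_top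
    have hgq : ∫⁻ x, ‖g x‖ₑ ^ q ∂μ ≤ I := by
      apply lintegral_mono
      intro x
      simp only
      rw [← ofReal_norm, ENNReal.ofReal_rpow_of_nonneg (norm_nonneg _) (by linarith)]
      apply ENNReal.ofReal_le_ofReal
      simp only [hg]
      rcases eq_or_ne (v x) 0 with h0 | h0
      · simp [h0, Real.zero_rpow hp0.ne', Real.zero_rpow (show q ≠ 0 by linarith)]
      have hv0 := norm_pos_iff.2 h0
      rw [norm_smul, norm_smul, Real.norm_of_nonneg (hχ0 x), Real.norm_of_nonneg (by positivity),
        ← Real.rpow_add_one hv0.ne', Real.mul_rpow (hχ0 x) (by positivity), ← Real.rpow_mul hv0.le]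
      have e : (p - 2 + 1) * q = p := by
        have := hpq.sub_one_mul_conj
        linarith
      rw [e]
      gcongr
      calc χ x ^ q ≤ χ x ^ (1:ℝ) := Real.rpow_le_rpow_of_exponent_ge' (hχ0 x) (hχ1 x) (by norm_num) hq1.le
        _ = χ x := Real.rpow_one _
    have hmain : I ≤ C * I ^ (1 / q) := by
      rw [← hIe]
      refine (h g hgc hgs).trans ?_
      rw [hIe]
      gcongr
    have hIp : I ≤ C ^ p := by
      rcases eq_or_ne I 0 with h0 | h0
      · rw [h0]; exact zero_le
      have h1 : I ^ (1 / p) * I ^ (1 / q) ≤ C * I ^ (1 / q) := by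
        rw [← ENNReal.rpow_add _ _ h0 hIt]
        have : 1 / p + 1 / q = 1 := by simpa using hpq.inv_add_inv_eq_one
        rw [this, ENNReal.rpow_one]; exact hmain
      have h2 : I ^ (1 / p) ≤ C := by
        rwa [ENNReal.mul_le_mul_iff_left] at h1
        · exact (ENNReal.rpow_pos (pos_iff_ne_zero.2 h0) hIt).ne'
        · exact ENNReal.rpow_ne_top_of_nonneg (by have := hpq.symm.pos; positivity) hIt
      calc I = (I ^ (1 / p)) ^ p := by
            rw [← ENNReal.rpow_mul, one_div, inv_mul_cancel₀ hp0.ne', ENNReal.rpow_one]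
        _ ≤ C ^ p := by gcongr
    refine le_trans ?_ hIp
    rw [hI]
    calc _ ≤ ∫⁻ x in Metric.closedBall 0 R, ENNReal.ofReal (χ x * ‖v x‖ ^ p) ∂μ := by
          apply setLIntegral_mono' Metric.isClosed_closedBall.measurableSet
          intro x hx
          rw [hχb x hx, one_mul, ← ofReal_norm, ENNReal.ofReal_rpow_of_nonneg (norm_nonneg _) hp0.le]
      _ ≤ _ := setLIntegral_le_lintegral _ _
  have hun : (⋃ R : ℕ, Metric.closedBall (0:X) R) = Set.univ := Metric.iUnion_closedBall_nat 0
  rw [← setLIntegral_univ, ← hun, setLIntegral_iUnion_of_directed]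
  · exact iSup_le key
  · apply Monotone.directed_le
    intro a b hab
    exact Metric.closedBall_subset_closedBall (by exact_mod_cast hab)

end dual

end

open scoped BigOperators RealInnerProductSpace
open MeasureTheory

noncomputable section

set_option linter.unusedSectionVars false

section adj
variable {H1 H2 : Type*} [NormedAddCommGroup H1] [InnerProductSpace ℝ H1] [CompleteSpace H1]
  [NormedAddCommGroup H2] [InnerProductSpace ℝ H2] [CompleteSpace H2]

/-- The adjoint kernel. -/
def kadj (K : ℝ → H1 →L[ℝ] H2) : ℝ → H2 →L[ℝ] H1 := fun t => (K (-t)).adjoint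

lemma kadj_kadj (K : ℝ → H1 →L[ℝ] H2) : kadj (kadj K) = K := by
  ext1 t; simp [kadj]

lemma kadj_continuous {K : ℝ → H1 →L[ℝ] H2} (hK : Continuous K) : Continuous (kadj K) :=
  (ContinuousLinearMap.adjoint (𝕜 := ℝ) (E := H1) (F := H2)).continuous.comp (hK.comp continuous_neg)

lemma kadj_bound {K : ℝ → H1 →L[ℝ] H2} {B : ℝ} (hB : ∀ t, ‖K t‖ ≤ B) (t : ℝ) : ‖kadj K t‖ ≤ B := by
  unfold kadj
  rw [LinearIsometryEquiv.norm_map]; exact hB _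

lemma kadj_hormander {K : ℝ → H1 →L[ℝ] H2} {A : ENNReal}
    (hA : ∀ y, ∫⁻ x in {x | 2 * |y| ≤ |x|}, ‖K (x - y) - K x‖ₑ ≤ A) (y : ℝ) :
    ∫⁻ x in {x | 2 * |y| ≤ |x|}, ‖kadj K (x - y) - kadj K x‖ₑ ≤ A := by
  have h := hA (-y)
  have hm : ∀ y : ℝ, MeasurableSet {x : ℝ | 2 * |y| ≤ |x|} := fun y =>
    measurableSet_le measurable_const (by fun_prop)
  rw [← lintegral_indicator (hm _), ← lintegral_neg_eq_self] at h
  rw [← lintegral_indicator (hm _)]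
  refine le_trans (le_of_eq ?_) h
  congr 1; ext x
  by_cases hx : 2 * |y| ≤ |x|
  · rw [Set.indicator_of_mem (show x ∈ {x | 2 * |y| ≤ |x|} from hx),
      Set.indicator_of_mem (show -x ∈ {x | 2 * |(-y)| ≤ |x|} by simpa using hx)]
    unfold kadj
    rw [← map_sub, ← ofReal_norm, ← ofReal_norm, LinearIsometryEquiv.norm_map]
    congr 4
    ring
  · rw [Set.indicator_of_notMem (show x ∉ {x | 2 * |y| ≤ |x|} from hx),
      Set.indicator_of_notMem (show -x ∉ {x | 2 * |(-y)| ≤ |x|} by simpa using hx)]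

lemma adj_pair {K : ℝ → H1 →L[ℝ] H2} (hK : Continuous K) {B : ℝ} (hB : ∀ t, ‖K t‖ ≤ B)
    {f : ℝ → H1} {g : ℝ → H2} (hf : Integrable f) (hg : Integrable g) :
    ∫ x, ⟪f x, czop (kadj K) g x⟫ = ∫ x, ⟪czop K f x, g x⟫ := by
  have hintg : Integrable (fun z : ℝ × ℝ => ⟪K (z.2 - z.1) (f z.1), g z.2⟫) (volume.prod volume) := by
    have h1 : Integrable (fun z : ℝ × ℝ => B * (‖f z.1‖ * ‖g z.2‖)) (volume.prod volume) :=
      (hf.norm.mul_prod hg.norm).const_mul B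
    refine h1.mono' ?_ ?_
    · have h1 : AEStronglyMeasurable (fun z : ℝ × ℝ => K (z.2 - z.1)) (volume.prod volume) :=
        (hK.comp (by fun_prop : Continuous fun z : ℝ × ℝ => z.2 - z.1)).aestronglyMeasurable
      have h2 : AEStronglyMeasurable (fun z : ℝ × ℝ => f z.1) (volume.prod volume) := hf.1.comp_fst
      have h3 : AEStronglyMeasurable (fun z : ℝ × ℝ => g z.2) (volume.prod volume) := hg.1.comp_snd
      exact (isBoundedBilinearMap_apply.continuous.comp_aestronglyMeasurable₂ h1 h2).inner h3
    · filter_upwards with z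
      calc ‖⟪K (z.2 - z.1) (f z.1), g z.2⟫‖ ≤ ‖K (z.2 - z.1) (f z.1)‖ * ‖g z.2‖ := norm_inner_le_norm _ _
        _ ≤ (B * ‖f z.1‖) * ‖g z.2‖ := by
            gcongr
            exact (ContinuousLinearMap.le_opNorm _ _).trans (by gcongr; exact hB _)
        _ = _ := by ring
  calc ∫ x, ⟪f x, czop (kadj K) g x⟫ = ∫ x, ∫ y, ⟪K (y - x) (f x), g y⟫ := by
        congr 1; ext x
        unfold czop
        rw [← integral_inner (czop_integrable (kadj_continuous hK) (kadj_bound hB) hg x)]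
        congr 1; ext y
        unfold kadj
        rw [ContinuousLinearMap.adjoint_inner_right, neg_sub]
    _ = ∫ y, ∫ x, ⟪K (y - x) (f x), g y⟫ := integral_integral_swap hintg
    _ = _ := by
        congr 1; ext y
        unfold czop
        rw [real_inner_comm, ← integral_inner (czop_integrable hK hB hf y)]
        congr 1; ext x
        rw [real_inner_comm]

lemma adj_bound {K : ℝ → H1 →L[ℝ] H2} (hK : Continuous K) {B : ℝ} (hB : ∀ t, ‖K t‖ ≤ B)
    {p q : ℝ} (hpq : p.HolderConjugate q) {C : ENNReal}
    (hT : ∀ f : ℝ → H1, Continuous f → HasCompactSupport f →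
      ∫⁻ x, ‖czop K f x‖ₑ ^ q ≤ C ^ q * ∫⁻ x, ‖f x‖ₑ ^ q)
    {g : ℝ → H2} (hg : Integrable g) :
    ∫⁻ x, ‖czop (kadj K) g x‖ₑ ^ p ≤ C ^ p * ∫⁻ x, ‖g x‖ₑ ^ p := by
  have hp0 := hpq.pos
  have hq0 := hpq.symm.pos
  have hc := czop_continuous (kadj_continuous hK) (kadj_bound hB) hg
  have := dual_bound (μ := volume) hc hpq (C := C * (∫⁻ x, ‖g x‖ₑ ^ p) ^ (1 / p)) ?_
  · refine this.trans (le_of_eq ?_)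
    rw [ENNReal.mul_rpow_of_nonneg _ _ hp0.le, ← ENNReal.rpow_mul, one_div,
      inv_mul_cancel₀ hp0.ne', ENNReal.rpow_one]
  · intro f hf hfs
    have hfi : Integrable f := hf.integrable_of_hasCompactSupport hfs
    rw [adj_pair hK hB hfi hg]
    have hTc := czop_continuous hK hB hfi
    calc ENNReal.ofReal (∫ x, ⟪czop K f x, g x⟫) ≤ ‖∫ x, ⟪czop K f x, g x⟫‖ₑ := by
          rw [← ofReal_norm]; exact ENNReal.ofReal_le_ofReal (Real.le_norm_self _)
      _ ≤ ∫⁻ x, ‖⟪czop K f x, g x⟫‖ₑ := enorm_integral_le_lintegral_enorm _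
      _ ≤ ∫⁻ x, ((fun x => ‖czop K f x‖ₑ) * fun x => ‖g x‖ₑ) x := by
          apply lintegral_mono
          intro x
          simp only [Pi.mul_apply]
          rw [← ofReal_norm, ← ofReal_norm, ← ofReal_norm, ← ENNReal.ofReal_mul (norm_nonneg _)]
          exact ENNReal.ofReal_le_ofReal (norm_inner_le_norm _ _)
      _ ≤ (∫⁻ x, ‖czop K f x‖ₑ ^ q) ^ (1 / q) * (∫⁻ x, ‖g x‖ₑ ^ p) ^ (1 / p) :=
          ENNReal.lintegral_mul_le_Lp_mul_Lq _ hpq.symm hTc.enorm.measurable.aemeasurable hg.1.enorm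
      _ ≤ (C ^ q * ∫⁻ x, ‖f x‖ₑ ^ q) ^ (1 / q) * (∫⁻ x, ‖g x‖ₑ ^ p) ^ (1 / p) := by
          gcongr
          exact hT f hf hfs
      _ = _ := by
          rw [ENNReal.mul_rpow_of_nonneg _ _ (by positivity), ← ENNReal.rpow_mul C, one_div,
            mul_inv_cancel₀ hq0.ne', ENNReal.rpow_one]
          ring

/-- Constant for all `1 < p < ∞`. -/
def czD (p : ℝ) : ℝ := if p < 2 then czC p ^ (1 / p) else if p = 2 then 1 else
  czC (p / (p - 1)) ^ (1 / (p / (p - 1)))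

lemma czC_nonneg {p : ℝ} (h1 : 1 < p) (h2 : p < 2) : 0 ≤ czC p := by
  have hq1 : 0 < p - 1 := by linarith
  have hq2 : 0 < 2 - p := by linarith
  unfold czC
  positivity

lemma cz_strong' {K : ℝ → H1 →L[ℝ] H2} (hK : Continuous K) {B : ℝ} (hB : ∀ t, ‖K t‖ ≤ B)
    {A : ENNReal} (hA1 : 1 ≤ A) (hAt : A ≠ ⊤)
    (hA : ∀ y, ∫⁻ x in {x | 2 * |y| ≤ |x|}, ‖K (x - y) - K x‖ₑ ≤ A)
    (hL2 : ∀ f : ℝ → H1, Integrable f → (∃ M, ∀ x, ‖f x‖ ≤ M) →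
      ∫⁻ x, ‖czop K f x‖ₑ ^ 2 ≤ A ^ 2 * ∫⁻ x, ‖f x‖ₑ ^ 2)
    {f : ℝ → H1} (hf : Continuous f) (hfi : Integrable f) {p : ℝ} (hp1 : 1 < p) (hp2 : p < 2) :
    ∫⁻ x, ‖czop K f x‖ₑ ^ p ≤ (ENNReal.ofReal (czC p ^ (1/p)) * A ^ 2) ^ p * ∫⁻ x, ‖f x‖ₑ ^ p := by
  refine (cz_strong hK hB hA1 hAt hA hL2 hf hfi hp1 hp2).trans ?_
  gcongr
  rw [ENNReal.mul_rpow_of_nonneg _ _ (by linarith)]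
  gcongr
  · rw [ENNReal.ofReal_rpow_of_nonneg (Real.rpow_nonneg (czC_nonneg hp1 hp2) _) (by linarith),
      ← Real.rpow_mul (czC_nonneg hp1 hp2), one_div, inv_mul_cancel₀ (by linarith), Real.rpow_one]
  · calc A ^ 2 = (A ^ 2) ^ (1:ℝ) := by rw [ENNReal.rpow_one]
      _ ≤ _ := ENNReal.rpow_le_rpow_of_exponent_le (one_le_pow₀ hA1) hp1.le

/-- Calderón–Zygmund for all `1 < p < ∞`. -/
lemma cz_full {K : ℝ → H1 →L[ℝ] H2} (hK : Continuous K) {B : ℝ} (hB : ∀ t, ‖K t‖ ≤ B)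
    {A : ENNReal} (hA1 : 1 ≤ A) (hAt : A ≠ ⊤)
    (hA : ∀ y, ∫⁻ x in {x | 2 * |y| ≤ |x|}, ‖K (x - y) - K x‖ₑ ≤ A)
    (hL2 : ∀ f : ℝ → H1, Integrable f → (∃ M, ∀ x, ‖f x‖ ≤ M) →
      ∫⁻ x, ‖czop K f x‖ₑ ^ 2 ≤ A ^ 2 * ∫⁻ x, ‖f x‖ₑ ^ 2)
    {f : ℝ → H1} (hf : Continuous f) (hfi : Integrable f) (hfb : ∃ M, ∀ x, ‖f x‖ ≤ M)
    {p : ℝ} (hp1 : 1 < p) :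
    ∫⁻ x, ‖czop K f x‖ₑ ^ p ≤ (ENNReal.ofReal (czD p) * A ^ 2) ^ p * ∫⁻ x, ‖f x‖ₑ ^ p := by
  rcases lt_trichotomy p 2 with h | h | h
  · unfold czD; rw [if_pos h]
    exact cz_strong' hK hB hA1 hAt hA hL2 hf hfi hp1 h
  · unfold czD; rw [if_neg h.not_lt, if_pos h]
    have := hL2 f hfi hfb
    subst h
    simp only [ENNReal.ofReal_one, one_mul, ENNReal.rpow_two]
    refine this.trans ?_
    gcongr
    calc A = A ^ 1 := (pow_one A).symm
      _ ≤ A ^ 2 := pow_le_pow_right₀ hA1 (by norm_num)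
  · unfold czD; rw [if_neg h.not_gt, if_neg h.ne']
    have hpq : p.HolderConjugate (p / (p - 1)) := Real.HolderConjugate.conjExponent hp1
    set q := p / (p - 1) with hq
    have hq1 := hpq.symm.lt
    have hq2 : q < 2 := by
      rw [hq, div_lt_iff₀ (by linarith)]; linarith
    have h2 : (2:ℝ).HolderConjugate 2 := Real.HolderConjugate.two_two
    have hL2' : ∀ f : ℝ → H2, Integrable f → (∃ M, ∀ x, ‖f x‖ ≤ M) →
      ∫⁻ x, ‖czop (kadj K) f x‖ₑ ^ 2 ≤ A ^ 2 * ∫⁻ x, ‖f x‖ₑ ^ 2 := by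
      intro g hg _
      have := adj_bound hK hB h2 (C := A) (fun f hf hfs => by
        have := hL2 f (hf.integrable_of_hasCompactSupport hfs)
          (hfs.exists_bound_of_continuous hf)
        simpa only [ENNReal.rpow_two] using this) hg
      simpa only [ENNReal.rpow_two] using this
    have := adj_bound (kadj_continuous hK) (kadj_bound hB) hpq
      (C := ENNReal.ofReal (czC q ^ (1/q)) * A ^ 2) (fun f hf hfs => 
        cz_strong' (kadj_continuous hK) (kadj_bound hB) hA1 hAt (kadj_hormander hA) hL2' hf
        (hf.integrable_of_hasCompactSupport hfs) hq1 hq2) hfi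
    rwa [kadj_kadj] at this

end adj

end

open scoped BigOperators RealInnerProductSpace
open MeasureTheory

noncomputable section

set_option linter.unusedSectionVars false

section l2
open scoped FourierTransform ComplexConjugate Convolution

/-- Scalar convolution. -/
def cv (κ f : ℝ → ℂ) (x : ℝ) : ℂ := ∫ y, κ (x - y) * f y

lemma cv_eq (κ f : ℝ → ℂ) : cv κ f = f ⋆[ContinuousLinearMap.mul ℂ ℂ] κ := by
  ext x
  simp only [cv, convolution, ContinuousLinearMap.mul_apply']
  congr 1; ext y; ring

lemma cv_integrable {κ f : ℝ → ℂ} (hκ : Integrable κ) (hf : Integrable f) : Integrable (cv κ f) := by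
  rw [cv_eq]; exact hf.integrable_convolution _ hκ

lemma cv_fourier {κ f : ℝ → ℂ} (hκ : Integrable κ) (hf : Integrable f) (ξ : ℝ) :
    𝓕 (cv κ f) ξ = 𝓕 κ ξ * 𝓕 f ξ := by
  rw [cv_eq, Real.fourier_mul_convolution_eq hf hκ, mul_comm]

lemma cv_continuous {κ f : ℝ → ℂ} (hκ : Continuous κ) {B : ℝ} (hB : ∀ t, ‖κ t‖ ≤ B)
    (hf : Integrable f) : Continuous (cv κ f) := by
  rw [cv_eq]
  exact BddAbove.continuous_convolution_right_of_integrable _ ⟨B, by rintro _ ⟨t, rfl⟩; exact hB t⟩ hf hκ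

lemma cv_bound {κ f : ℝ → ℂ} {B : ℝ} (hB : ∀ t, ‖κ t‖ ≤ B)
    (hf : Integrable f) (x : ℝ) : ‖cv κ f x‖ ≤ B * ∫ y, ‖f y‖ := by
  unfold cv
  rw [← integral_const_mul]
  apply norm_integral_le_of_norm_le (hf.norm.const_mul B)
  filter_upwards with y
  rw [norm_mul]; gcongr; exact hB _

lemma plancherel_pair {f h : ℝ → ℂ} (hf : Integrable f) (hh : Integrable h) (hc : Continuous h)
    (hF : Integrable (𝓕 h)) : ∫ x, conj (f x) * h x = ∫ ξ, conj (𝓕 f ξ) * 𝓕 h ξ := by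
  have := VectorFourier.integral_sesq_fourierIntegral_eq_neg_flip (innerSL ℂ : ℂ →L⋆[ℂ] ℂ →L[ℂ] ℂ)
    (L := innerₗ ℝ) (μ := volume) (ν := volume) Real.continuous_fourierChar continuous_inner hf hF
  have h2 : 𝓕⁻ (𝓕 h) = h := hc.fourierInv_fourier_eq hh hF
  have h3 : ∀ x, VectorFourier.fourierIntegral Real.fourierChar volume (-(innerₗ ℝ).flip) (𝓕 h) x
      = h x := by
    intro x
    conv_rhs => rw [← h2]
    rw [Real.fourierInv_eq]
    simp [VectorFourier.fourierIntegral]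
  simp_rw [h3] at this
  simp only [innerSL_apply_apply, RCLike.inner_apply] at this
  calc _ = ∫ x, h x * (starRingEnd ℂ) (f x) := by congr 1; ext x; ring
    _ = _ := this.symm
    _ = _ := by
      congr 1; ext x; rw [mul_comm]; rfl

/-- The reflected conjugate kernel. -/
def kst (κ : ℝ → ℂ) (t : ℝ) : ℂ := conj (κ (-t))

lemma kst_fourier (κ : ℝ → ℂ) (ξ : ℝ) : 𝓕 (kst κ) ξ = conj (𝓕 κ ξ) := by
  rw [Real.fourier_real_eq, Real.fourier_real_eq, ← integral_conj,
    ← integral_neg_eq_self]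
  congr 1; ext t
  simp only [kst, Circle.smul_def, smul_eq_mul, neg_neg, map_mul]
  congr 1
  rw [← Circle.coe_inv_eq_conj, ← AddChar.map_neg_eq_inv]
  congr 2; ring

lemma sq_int {h : ℝ → ℂ} (hi : Integrable h) {B : ℝ} (hB : ∀ t, ‖h t‖ ≤ B) :
    Integrable fun x => ‖h x‖ ^ 2 := by
  refine (hi.norm.const_mul B).mono' (hi.1.norm.pow 2) ?_
  filter_upwards with x
  rw [Real.norm_of_nonneg (by positivity), sq]
  gcongr
  exact hB x

lemma plancherel_sq {h : ℝ → ℂ} (hh : Integrable h) (hc : Continuous h)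
    (hF : Integrable (𝓕 h)) : ∫ x, ‖h x‖ ^ 2 = ∫ ξ, ‖𝓕 h ξ‖ ^ 2 := by
  have := plancherel_pair hh hh hc hF
  simp only [Complex.conj_mul'] at this
  exact_mod_cast this

lemma four_bound {f : ℝ → ℂ} (ξ : ℝ) : ‖𝓕 f ξ‖ ≤ ∫ y, ‖f y‖ := by
  rw [Real.fourier_real_eq]
  refine (norm_integral_le_integral_norm _).trans (le_of_eq ?_)
  simp

lemma four_cont {f : ℝ → ℂ} (hf : Integrable f) : Continuous (𝓕 f) :=
  VectorFourier.fourierIntegral_continuous Real.continuous_fourierChar continuous_inner hf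

lemma l2_sq {σ : Type*} [Fintype σ] {κ : σ → ℝ → ℂ} (hi : ∀ k, Integrable (κ k))
    (hc : ∀ k, Continuous (κ k)) {B : ℝ} (hB : ∀ k t, ‖κ k t‖ ≤ B)
    (hF : ∀ k, Integrable (𝓕 (κ k))) {M : ℝ} (hM0 : 0 < M) (hM : ∀ ξ, ∑ k, ‖𝓕 (κ k) ξ‖ ^ 2 ≤ M)
    {f : ℝ → ℂ} (hf : Integrable f) {B' : ℝ} (hB' : ∀ t, ‖f t‖ ≤ B') :
    ∑ k, ∫ x, ‖cv (κ k) f x‖ ^ 2 ≤ M * ∫ x, ‖f x‖ ^ 2 := by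
  have hki : ∀ k, Integrable (kst (κ k)) := fun k =>
    (RCLike.conjCLE (K := ℂ)).toContinuousLinearMap.integrable_comp (hi k).comp_neg
  have hkc : ∀ k, Continuous (kst (κ k)) := fun k => by
    unfold kst; have := hc k; fun_prop
  have hkb : ∀ k t, ‖kst (κ k) t‖ ≤ B := fun k t => by
    simp only [kst, RCLike.norm_conj]; exact hB _ _
  set W : ℝ → ℂ := fun x => ∑ k, cv (kst (κ k)) (κ k) x with hW
  have hWi : Integrable W := integrable_finsetSum _ fun k _ => cv_integrable (hki k) (hi k)
  have hWc : Continuous W := continuous_finsetSum _ fun k _ => cv_continuous (hkc k) (hkb k) (hi k)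
  obtain ⟨BW, hBW⟩ : ∃ BW, ∀ t, ‖W t‖ ≤ BW := by
    refine ⟨∑ k, B * ∫ y, ‖κ k y‖, fun t => ?_⟩
    exact (norm_sum_le _ _).trans (Finset.sum_le_sum fun k _ => cv_bound (hkb k) (hi k) t)
  set ρ : ℝ → ℝ := fun ξ => ∑ k, ‖𝓕 (κ k) ξ‖ ^ 2 with hρ
  have hρ0 : ∀ ξ, 0 ≤ ρ ξ := fun ξ => Finset.sum_nonneg fun k _ => by positivity
  have hWF : ∀ ξ, 𝓕 W ξ = (ρ ξ : ℂ) := by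
    intro ξ
    have h1 : 𝓕 W ξ = ∑ k, 𝓕 (cv (kst (κ k)) (κ k)) ξ := by
      simp only [Real.fourier_real_eq, hW, Finset.smul_sum]
      rw [integral_finsetSum]
      intro k _
      have := (Real.fourierIntegral_convergent_iff (μ := volume) (V := ℝ) ξ).2
        (cv_integrable (hki k) (hi k))
      simpa [mul_comm] using this
    rw [h1]
    simp only [hρ]
    push_cast
    refine Finset.sum_congr rfl fun k _ => ?_
    rw [cv_fourier (hki k) (hi k), kst_fourier, Complex.conj_mul']
  -- h k
  have hhi : ∀ k, Integrable (cv (κ k) f) := fun k => cv_integrable (hi k) hf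
  have hhc : ∀ k, Continuous (cv (κ k) f) := fun k => cv_continuous (hc k) (hB k) hf
  have hfc := four_cont hf
  have hfb : ∀ ξ, ‖𝓕 f ξ‖ ≤ ∫ y, ‖f y‖ := four_bound
  have hhF : ∀ k, Integrable (𝓕 (cv (κ k) f)) := by
    intro k
    have : 𝓕 (cv (κ k) f) = fun ξ => 𝓕 (κ k) ξ * 𝓕 f ξ := funext fun ξ => cv_fourier (hi k) hf ξ
    rw [this]
    exact (hF k).mul_bdd (c := ∫ y, ‖f y‖) hfc.aestronglyMeasurable (Filter.Eventually.of_forall hfb)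
  set E := ∑ k, ∫ x, ‖cv (κ k) f x‖ ^ 2 with hE
  have hintg : ∀ k, Integrable fun ξ => ‖𝓕 (κ k) ξ‖ ^ 2 * ‖𝓕 f ξ‖ ^ 2 := by
    intro k
    have := sq_int (hhF k) (B := (∫ y, ‖κ k y‖) * ∫ y, ‖f y‖) (fun ξ => by
      rw [cv_fourier (hi k) hf, norm_mul]; gcongr; exacts [four_bound ξ, four_bound ξ])
    simp_rw [cv_fourier (hi k) hf, norm_mul, mul_pow] at this
    exact this
  have hEρ : E = ∫ ξ, ρ ξ * ‖𝓕 f ξ‖ ^ 2 := by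
    rw [hE]
    simp only [hρ, Finset.sum_mul]
    rw [integral_finsetSum _ fun k _ => hintg k]
    refine Finset.sum_congr rfl fun k _ => ?_
    rw [plancherel_sq (hhi k) (hhc k) (hhF k)]
    simp_rw [cv_fourier (hi k) hf, norm_mul, mul_pow]
  have hρint : Integrable fun ξ => ρ ξ * ‖𝓕 f ξ‖ ^ 2 := by
    simp only [hρ, Finset.sum_mul]
    exact integrable_finsetSum _ fun k _ => hintg k
  -- w
  set w := cv W f with hw
  have hwi : Integrable w := cv_integrable hWi hf
  have hwc : Continuous w := cv_continuous hWc hBW hf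
  have hwf : ∀ ξ, 𝓕 w ξ = ρ ξ * 𝓕 f ξ := fun ξ => by rw [hw, cv_fourier hWi hf, hWF]
  have hρc : Continuous ρ := by
    simp only [hρ]
    exact continuous_finsetSum _ fun k _ => (four_cont (hi k)).norm.pow 2
  have hρi : Integrable ρ := by
    simp only [hρ]
    exact integrable_finsetSum _ fun k _ => sq_int (hF k) (B := ∫ y, ‖κ k y‖) fun ξ => four_bound ξ
  have hwF : Integrable (𝓕 w) := by
    have : 𝓕 w = fun ξ => (ρ ξ : ℂ) * 𝓕 f ξ := funext hwf
    rw [this]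
    exact hρi.ofReal.mul_bdd (c := ∫ y, ‖f y‖) hfc.aestronglyMeasurable (Filter.Eventually.of_forall hfb)
  have h1 : ((E : ℝ) : ℂ) = ∫ x, conj (f x) * w x := by
    rw [plancherel_pair hf hwi hwc hwF, hEρ, ← integral_complex_ofReal]
    congr 1; ext ξ
    rw [hwf, mul_left_comm, Complex.conj_mul']
    push_cast; rfl
  have hwsq : Integrable fun x => ‖w x‖ ^ 2 := sq_int hwi (cv_bound hBW hf)
  have hfsq : Integrable fun x => ‖f x‖ ^ 2 := sq_int hf hB'
  have h2 : ∫ x, ‖w x‖ ^ 2 ≤ M * E := by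
    rw [plancherel_sq hwi hwc hwF, hEρ, ← integral_const_mul]
    apply integral_mono_of_nonneg (Filter.Eventually.of_forall fun x => by positivity) (hρint.const_mul M)
    filter_upwards with ξ
    rw [hwf, norm_mul, mul_pow, Complex.norm_real, Real.norm_of_nonneg (hρ0 ξ), sq, mul_assoc]
    have := hρ0 ξ
    gcongr
    exact hM ξ
  have h3 : E ≤ ∫ x, (M / 2 * ‖f x‖ ^ 2 + (2 * M)⁻¹ * ‖w x‖ ^ 2) := by
    calc E ≤ ‖((E:ℝ):ℂ)‖ := by rw [Complex.norm_real]; exact Real.le_norm_self _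
      _ = ‖∫ x, conj (f x) * w x‖ := by rw [h1]
      _ ≤ _ := by
        apply norm_integral_le_of_norm_le ((hfsq.const_mul _).add (hwsq.const_mul _))
        filter_upwards with x
        rw [norm_mul, RCLike.norm_conj]
        show _ ≤ M / 2 * ‖f x‖ ^ 2 + (2 * M)⁻¹ * ‖w x‖ ^ 2
        have : M / 2 * ‖f x‖ ^ 2 + (2 * M)⁻¹ * ‖w x‖ ^ 2 - ‖f x‖ * ‖w x‖
          = (2 * M)⁻¹ * (M * ‖f x‖ - ‖w x‖) ^ 2 := by field_simp; ring
        have h0 : 0 ≤ (2 * M)⁻¹ * (M * ‖f x‖ - ‖w x‖) ^ 2 := by positivity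
        linarith
  rw [integral_add (hfsq.const_mul _) (hwsq.const_mul _), integral_const_mul, integral_const_mul] at h3
  have h4 : (2 * M)⁻¹ * ∫ x, ‖w x‖ ^ 2 ≤ E / 2 := by
    calc _ ≤ (2 * M)⁻¹ * (M * E) := by gcongr
      _ = _ := by field_simp
  linarith

end l2

end

open scoped BigOperators RealInnerProductSpace
open MeasureTheory

noncomputable section

set_option linter.unusedSectionVars false

section vk
variable {ι σ : Type} [Fintype ι] [Fintype σ]

lemma eu_enorm_sq (v : EuclideanSpace ℂ ι) : ‖v‖ₑ ^ 2 = ∑ i, ‖v i‖ₑ ^ 2 := by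
  simp_rw [← ofReal_norm]
  rw [← ENNReal.ofReal_pow (norm_nonneg _), EuclideanSpace.norm_sq_eq,
    ENNReal.ofReal_sum_of_nonneg (fun i _ => by positivity)]
  simp_rw [ENNReal.ofReal_pow (norm_nonneg _)]

lemma eu_enorm_rpow (v : EuclideanSpace ℂ ι) (p : ℝ) : ‖v‖ₑ ^ p = (∑ i, ‖v i‖ₑ ^ 2) ^ (p / 2) := by
  rw [← eu_enorm_sq, ← ENNReal.rpow_two, ← ENNReal.rpow_mul]
  congr 1; ring

/-- The kernel `v ↦ (c_k v_i)_{k,i}`. -/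
def vk (ι : Type) [Fintype ι] (c : σ → ℂ) : EuclideanSpace ℂ ι →L[ℝ] EuclideanSpace ℂ (σ × ι) :=
  LinearMap.mkContinuous
    { toFun := fun v => WithLp.toLp 2 fun q : σ × ι => c q.1 * v q.2
      map_add' := fun v w => by ext q; simp [mul_add]
      map_smul' := fun r v => by ext q; simp; ring }
    (∑ k, ‖c k‖) (fun v => by
      apply le_of_sq_le_sq _ (by positivity)
      rw [EuclideanSpace.norm_sq_eq, mul_pow, EuclideanSpace.norm_sq_eq]
      simp only [LinearMap.coe_mk, AddHom.coe_mk, norm_mul, mul_pow]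
      rw [Fintype.sum_prod_type]
      dsimp only
      rw [← Finset.sum_mul_sum]
      gcongr
      exact Finset.sum_sq_le_sq_sum_of_nonneg fun i _ => norm_nonneg _)

lemma vk_apply (c : σ → ℂ) (v : EuclideanSpace ℂ ι) (q : σ × ι) : vk ι c v q = c q.1 * v q.2 := rfl

lemma vk_norm (c : σ → ℂ) : ‖vk ι c‖ ≤ ∑ k, ‖c k‖ :=
  LinearMap.mkContinuous_norm_le _ (by positivity) _

lemma vk_sub (c d : σ → ℂ) : vk ι c - vk ι d = vk ι (c - d) := by
  ext v q
  simp [vk_apply, sub_mul]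

lemma vk_continuous {κ : σ → ℝ → ℂ} (hκ : ∀ k, Continuous (κ k)) :
    Continuous fun t => vk ι (fun k => κ k t) := by
  rw [continuous_iff_continuousAt]
  intro t
  rw [ContinuousAt, tendsto_iff_norm_sub_tendsto_zero]
  have h : Continuous fun s => ∑ k, ‖κ k s - κ k t‖ := by fun_prop
  have h2 := h.tendsto t
  simp only [sub_self, norm_zero, Finset.sum_const_zero] at h2
  refine squeeze_zero (fun _ => norm_nonneg _) (fun s => ?_) h2
  rw [vk_sub]
  exact vk_norm _

lemma czop_vk {κ : σ → ℝ → ℂ} (hκ : ∀ k, Continuous (κ k)) {B : ℝ} (hB : ∀ k t, ‖κ k t‖ ≤ B)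
    {f : ℝ → EuclideanSpace ℂ ι} (hf : Integrable f) (x : ℝ) (q : σ × ι) :
    czop (fun t => vk ι fun k => κ k t) f x q = cv (κ q.1) (fun y => f y q.2) x := by
  have hB' : ∀ t, ‖vk ι (fun k => κ k t)‖ ≤ ∑ k : σ, B := fun t =>
    (vk_norm _).trans (Finset.sum_le_sum fun k _ => hB k t)
  have hi := czop_integrable (vk_continuous (ι := ι) hκ) hB' hf x
  unfold czop cv
  have := (EuclideanSpace.proj (𝕜 := ℂ) q : EuclideanSpace ℂ (σ × ι) →L[ℂ] ℂ).integral_comp_comm hi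
  exact this.symm

/-- Vector-valued square function estimate in terms of kernel hypotheses. -/
lemma sq_gen {κ : σ → ℝ → ℂ} (hi : ∀ k, Integrable (κ k))
    (hc : ∀ k, Continuous (κ k)) {B : ℝ} (hB : ∀ k t, ‖κ k t‖ ≤ B)
    (hF : ∀ k, Integrable (FourierTransform.fourier (κ k)))
    {A : ℝ} (hA1 : 1 ≤ A) (hM : ∀ ξ, ∑ k, ‖FourierTransform.fourier (κ k) ξ‖ ^ 2 ≤ A ^ 2)
    (hA : ∀ y, ∑ k, ∫⁻ x in {x | 2 * |y| ≤ |x|}, ‖κ k (x - y) - κ k x‖ₑ ≤ ENNReal.ofReal A)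
    {f : ι → ℝ → ℂ} (hfc : ∀ i, Continuous (f i)) (hfi : ∀ i, Integrable (f i))
    (hfb : ∃ M, ∀ i x, ‖f i x‖ ≤ M) {p : ℝ} (hp : 1 < p) :
    ∫⁻ x, (∑ q : σ × ι, ‖cv (κ q.1) (f q.2) x‖ₑ ^ 2) ^ (p / 2) ≤
      (ENNReal.ofReal (czD p) * ENNReal.ofReal A ^ 2) ^ p *
        ∫⁻ x, (∑ i, ‖f i x‖ₑ ^ 2) ^ (p / 2) := by
  set K : ℝ → EuclideanSpace ℂ ι →L[ℝ] EuclideanSpace ℂ (σ × ι) := fun t => vk ι fun k => κ k t with hK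
  have hKc : Continuous K := vk_continuous hc
  have hKB : ∀ t, ‖K t‖ ≤ ∑ k : σ, B := fun t =>
    (vk_norm _).trans (Finset.sum_le_sum fun k _ => hB k t)
  have hH : ∀ y, ∫⁻ x in {x | 2 * |y| ≤ |x|}, ‖K (x - y) - K x‖ₑ ≤ ENNReal.ofReal A := by
    intro y
    refine le_trans ?_ (hA y)
    rw [← lintegral_finsetSum]
    · apply lintegral_mono
      intro x
      simp only [hK]
      rw [vk_sub]
      simp_rw [← ofReal_norm]
      rw [← ENNReal.ofReal_sum_of_nonneg fun i _ => norm_nonneg _]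
      exact ENNReal.ofReal_le_ofReal (vk_norm _)
    · intro k _
      have := hc k
      exact (by fun_prop : Continuous fun x => ‖κ k (x - y) - κ k x‖ₑ).measurable
  have hL2 : ∀ f : ℝ → EuclideanSpace ℂ ι, Integrable f → (∃ M, ∀ x, ‖f x‖ ≤ M) →
      ∫⁻ x, ‖czop K f x‖ₑ ^ 2 ≤ ENNReal.ofReal A ^ 2 * ∫⁻ x, ‖f x‖ₑ ^ 2 := by
    intro f hf ⟨M, hM'⟩
    have hfi : ∀ i, Integrable fun x => f x i := fun i =>
      (EuclideanSpace.proj (𝕜 := ℂ) i : EuclideanSpace ℂ ι →L[ℂ] ℂ).integrable_comp hf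
    have hfb : ∀ i x, ‖f x i‖ ≤ M := fun i x => (PiLp.norm_apply_le _ i).trans (hM' x)
    simp_rw [eu_enorm_sq]
    rw [lintegral_finsetSum]
    swap
    · intro q _
      have : Continuous fun x => czop K f x q := 
        (EuclideanSpace.proj (𝕜 := ℂ) q : EuclideanSpace ℂ (σ × ι) →L[ℂ] ℂ).continuous.comp
          (czop_continuous hKc hKB hf)
      exact this.enorm.measurable.pow_const 2
    rw [lintegral_finsetSum' _ fun i _ => (hfi i).1.enorm.pow_const 2]
    simp_rw [hK, czop_vk hc hB hf]
    rw [Fintype.sum_prod_type_right, Finset.mul_sum]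
    refine Finset.sum_le_sum fun i _ => ?_
    have := l2_sq hi hc hB hF (by positivity) hM (hfi i) (hfb i)
    have hs : ∀ h : ℝ → ℂ, Integrable (fun x => ‖h x‖ ^ 2) →
        ∫⁻ x, ‖h x‖ₑ ^ 2 = ENNReal.ofReal (∫ x, ‖h x‖ ^ 2) := by
      intro h hh
      rw [ofReal_integral_eq_lintegral_ofReal hh (Filter.Eventually.of_forall fun x => by positivity)]
      simp_rw [← ofReal_norm, ENNReal.ofReal_pow (norm_nonneg _)]
    rw [hs _ (sq_int (hfi i) (hfb i))]
    have h2 : ∀ k, Integrable fun x => ‖cv (κ k) (fun y => f y i) x‖ ^ 2 := fun k =>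
      sq_int (cv_integrable (hi k) (hfi i)) (cv_bound (hB k) (hfi i))
    simp_rw [fun k => hs _ (h2 k)]
    rw [← ENNReal.ofReal_sum_of_nonneg fun k _ => integral_nonneg fun x => by positivity,
      ← ENNReal.ofReal_pow (by positivity), ← ENNReal.ofReal_mul (by positivity)]
    exact ENNReal.ofReal_le_ofReal this
  set g : ℝ → EuclideanSpace ℂ ι := fun x => WithLp.toLp 2 fun i => f i x with hg
  have hgc : Continuous g := (PiLp.continuous_toLp 2 _).comp (continuous_pi hfc)
  obtain ⟨M, hM'⟩ := hfb
  have hgn : ∀ x, ‖g x‖ ≤ ∑ i, ‖f i x‖ := by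
    intro x
    apply le_of_sq_le_sq _ (by positivity)
    rw [EuclideanSpace.norm_sq_eq]
    exact Finset.sum_sq_le_sq_sum_of_nonneg fun i _ => norm_nonneg _
  have hgi : Integrable g := (integrable_finsetSum _ fun i _ => (hfi i).norm).mono'
    hgc.aestronglyMeasurable (Filter.Eventually.of_forall hgn)
  have hgb : ∃ M, ∀ x, ‖g x‖ ≤ M := ⟨_, fun x => (hgn x).trans (Finset.sum_le_sum fun i _ => hM' i x)⟩
  have hA1' : 1 ≤ ENNReal.ofReal A := by
    rw [← ENNReal.ofReal_one]; exact ENNReal.ofReal_le_ofReal hA1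
  have := cz_full hKc hKB hA1' ENNReal.ofReal_ne_top hH hL2 hgc hgi hgb hp
  simp_rw [eu_enorm_rpow, hK, czop_vk hc hB hgi] at this
  exact this

end vk

end

open scoped BigOperators RealInnerProductSpace
open MeasureTheory

noncomputable section

set_option linter.unusedSectionVars false

section onedim
open scoped FourierTransform SchwartzMap

lemma dy_sum : ∃ C : ℝ, 0 < C ∧ ∀ (S : Finset ℤ) (r : ℝ), 0 < r →
    ∑ k ∈ S, min ((2:ℝ) ^ k * r) (((2:ℝ) ^ k * r)⁻¹) ≤ C := by
  have hs : Summable fun m : ℤ => ((1:ℝ)/2) ^ m.natAbs := by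
    rw [summable_int_iff_summable_nat_and_neg]
    constructor <;> simpa using summable_geometric_two
  refine ⟨2 * ∑' m : ℤ, ((1:ℝ)/2) ^ m.natAbs + 1, by positivity, fun S r hr => ?_⟩
  obtain ⟨j, hj1, hj2⟩ := exists_mem_Ico_zpow hr (by norm_num : (1:ℝ) < 2)
  have hb : ∀ k : ℤ, min ((2:ℝ) ^ k * r) (((2:ℝ) ^ k * r)⁻¹) ≤ 2 * ((1:ℝ)/2) ^ (k + j).natAbs := by
    intro k
    have h2 : (0:ℝ) < 2 ^ k := by positivity
    rcases le_total 0 (k + j) with h | h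
    · refine (min_le_right _ _).trans ?_
      have e : ((1:ℝ)/2) ^ (k + j).natAbs = ((2:ℝ) ^ (k + j))⁻¹ := by
        rw [one_div, inv_pow]
        congr 1
        rw [← zpow_natCast]; congr 1; omega
      rw [e]
      have : ((2:ℝ) ^ (k + j)) ≤ 2 ^ k * r := by
        rw [zpow_add₀ (by norm_num)]; gcongr
      have h3 := inv_anti₀ (by positivity) this
      have h4 : (0:ℝ) < (2 ^ (k + j))⁻¹ := by positivity
      linarith
    · refine (min_le_left _ _).trans ?_
      have e : ((1:ℝ)/2) ^ (k + j).natAbs = ((2:ℝ) ^ (k + j)) := by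
        rw [one_div, inv_pow, ← zpow_natCast, ← zpow_neg]
        congr 1; omega
      rw [e, zpow_add₀ (by norm_num)]
      rw [zpow_add_one₀ (by norm_num)] at hj2
      nlinarith
  calc _ ≤ ∑ k ∈ S, 2 * ((1:ℝ)/2) ^ (k + j).natAbs := Finset.sum_le_sum fun k _ => hb k
    _ = 2 * ∑ k ∈ S, ((1:ℝ)/2) ^ (k + j).natAbs := by rw [Finset.mul_sum]
    _ ≤ 2 * ∑' k : ℤ, ((1:ℝ)/2) ^ (k + j).natAbs := by
        gcongr
        exact Summable.sum_le_tsum (f := fun k : ℤ => ((1:ℝ)/2) ^ (k + j).natAbs) S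
          (fun _ _ => by positivity)
          ((Equiv.addRight j).summable_iff (f := fun m : ℤ => ((1:ℝ)/2) ^ m.natAbs) |>.2 hs)
    _ = 2 * ∑' m : ℤ, ((1:ℝ)/2) ^ m.natAbs := by
        congr 1
        exact (Equiv.addRight j).tsum_eq (fun m : ℤ => ((1:ℝ)/2) ^ m.natAbs)
    _ ≤ _ := by linarith

/-- dilated and shifted kernel -/
def kap (κ : 𝓢(ℝ, ℂ)) (k : ℤ) (η : ℝ) : ℝ → ℂ :=
  fun t => (((2:ℝ) ^ k : ℝ) : ℂ) * κ ((2:ℝ) ^ k * t + η)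

lemma lint_scale {r : ℝ} (hr : 0 < r) (b : ℝ) {g : ℝ → ENNReal} (hg : Measurable g) :
    ∫⁻ x, ENNReal.ofReal r * g (r * x + b) = ∫⁻ x, g x := by
  rw [lintegral_const_mul _ (by fun_prop)]
  have h1 : ∫⁻ x, g (r * x + b) = ∫⁻ y, g (y + b) ∂(Measure.map (r * ·) volume) := by
    rw [lintegral_map (by fun_prop) (by fun_prop)]
  rw [h1, Real.map_volume_mul_left hr.ne', lintegral_smul_measure, smul_eq_mul, ← mul_assoc,
    ← ENNReal.ofReal_mul hr.le, abs_of_pos (by positivity), mul_inv_cancel₀ hr.ne',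
    ENNReal.ofReal_one, one_mul, lintegral_add_right_eq_self]

lemma kap_continuous (κ : 𝓢(ℝ, ℂ)) (k : ℤ) (η : ℝ) : Continuous (kap κ k η) := by
  unfold kap; have := κ.continuous; fun_prop

lemma kap_norm (κ : 𝓢(ℝ, ℂ)) (k : ℤ) (η t : ℝ) :
    ‖kap κ k η t‖ = (2:ℝ) ^ k * ‖κ ((2:ℝ) ^ k * t + η)‖ := by
  unfold kap
  rw [norm_mul, Complex.norm_real, Real.norm_of_nonneg (by positivity)]

/-- rapidly decreasing functions on the line -/
def RD (K : ℝ → ℂ) : Prop := Continuous K ∧ ∀ M : ℕ, ∃ B : ℝ, ∀ t, ‖K t‖ * (1 + |t|) ^ M ≤ B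

lemma RD.nonneg {K : ℝ → ℂ} (h : RD K) (M : ℕ) : ∃ B : ℝ, 0 < B ∧ ∀ t, ‖K t‖ * (1 + |t|) ^ M ≤ B := by
  obtain ⟨B, hB⟩ := h.2 M
  exact ⟨max B 1, by positivity, fun t => (hB t).trans (le_max_left _ _)⟩

lemma schwartz_RD (κ : 𝓢(ℝ, ℂ)) : RD κ := by
  refine ⟨κ.continuous, fun M => ?_⟩
  have := κ.one_add_le_sup_seminorm_apply (𝕜 := ℝ) (m := (M, 0)) (k := M) (n := 0) le_rfl le_rfl
  refine ⟨2 ^ (M, 0).1 * ((Finset.Iic (M, 0)).sup fun m => SchwartzMap.seminorm ℝ m.1 m.2) κ, fun t => ?_⟩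
  have h := this t
  rw [norm_iteratedFDeriv_zero, Real.norm_eq_abs] at h
  rw [mul_comm]
  exact h

lemma kap_RD (κ : 𝓢(ℝ, ℂ)) (k : ℤ) (η : ℝ) : RD (kap κ k η) := by
  refine ⟨kap_continuous _ _ _, fun M => ?_⟩
  obtain ⟨B, hB0, hB⟩ := (schwartz_RD κ).nonneg M
  have hr : (0:ℝ) < 2 ^ k := by positivity
  set r : ℝ := (2:ℝ) ^ k
  refine ⟨r * (B * (1 + (1 + |η|) / r) ^ M), fun t => ?_⟩
  rw [kap_norm, mul_assoc]
  refine mul_le_mul_of_nonneg_left ?_ hr.le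
  have h1 : 1 + |t| ≤ (1 + |r * t + η|) * (1 + (1 + |η|) / r) := by
    have : r * |t| ≤ |r * t + η| + |η| := by
      have := abs_add_le (r * t + η) (-η)
      rw [abs_neg] at this
      simpa [abs_mul, abs_of_pos hr] using this
    have h2 : |t| ≤ (|r * t + η| + |η|) / r := by rw [le_div_iff₀ hr]; linarith
    calc 1 + |t| ≤ 1 + (|r * t + η| + |η|) / r := by linarith
      _ ≤ 1 + ((1 + |r * t + η|) * (1 + |η|)) / r := by
          gcongr; nlinarith [abs_nonneg (r * t + η), abs_nonneg η]
      _ ≤ _ := by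
          have := abs_nonneg (r * t + η)
          rw [mul_div_assoc, mul_add]; linarith
  calc ‖κ (r * t + η)‖ * (1 + |t|) ^ M ≤ ‖κ (r * t + η)‖ * ((1 + |r * t + η|) * (1 + (1 + |η|) / r)) ^ M := by
        gcongr
    _ = (‖κ (r * t + η)‖ * (1 + |r * t + η|) ^ M) * (1 + (1 + |η|) / r) ^ M := by
        rw [mul_pow, mul_assoc]
    _ ≤ _ := by gcongr; exact hB _

lemma RD.bdd {K : ℝ → ℂ} (h : RD K) : ∃ B, ∀ t, ‖K t‖ ≤ B := by
  obtain ⟨B, hB⟩ := h.2 0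
  exact ⟨B, fun t => by simpa using hB t⟩

lemma RD.int_mul {K : ℝ → ℂ} (h : RD K) (M : ℕ) : Integrable fun t => ‖K t‖ * (1 + |t|) ^ M := by
  obtain ⟨B, hB0, hB⟩ := h.nonneg (M + 2)
  have h1 : Integrable fun t : ℝ => B * (1 + ‖t‖ ^ 2)⁻¹ := by
    simpa using integrable_inv_one_add_sq.const_mul B
  have := h.1
  refine h1.mono' (by fun_prop) (Filter.Eventually.of_forall fun t => ?_)
  rw [Real.norm_of_nonneg (by positivity)]
  have h2 := hB t
  rw [← div_eq_mul_inv, le_div_iff₀ (by positivity)]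
  refine le_trans ?_ h2
  rw [pow_add, ← mul_assoc]
  gcongr
  rw [Real.norm_eq_abs]
  nlinarith [abs_nonneg t]

lemma RD.integrable {K : ℝ → ℂ} (h : RD K) : Integrable K := by
  have := h.int_mul 0
  simp only [pow_zero, mul_one] at this
  exact (integrable_norm_iff h.1.aestronglyMeasurable).1 this

lemma kap_fourier (κ : 𝓢(ℝ, ℂ)) (k : ℤ) (η ξ : ℝ) :
    𝓕 (kap κ k η) ξ = Complex.exp (2 * Real.pi * Complex.I * (η * (ξ / (2:ℝ) ^ k) : ℝ)) *
      𝓕 (κ : ℝ → ℂ) (ξ / (2:ℝ) ^ k) := by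
  have hr : (0:ℝ) < 2 ^ k := by positivity
  rw [Real.fourier_eq', Real.fourier_eq']
  unfold kap
  set r : ℝ := (2:ℝ) ^ k
  set g : ℝ → ℂ := fun t => Complex.exp (2 * Real.pi * Complex.I * (η * (ξ / r) : ℝ)) *
      (Complex.exp (((-2 * Real.pi * ⟪t, ξ / r⟫ : ℝ) : ℂ) * Complex.I) • κ t) with hg
  have e1 : ∀ v : ℝ, Complex.exp (((-2 * Real.pi * ⟪v, ξ⟫ : ℝ) : ℂ) * Complex.I) • (((r : ℝ) : ℂ) * κ (r * v + η))
      = (r : ℂ) * g (r * v + η) := by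
    intro v
    simp only [hg, smul_eq_mul, RCLike.inner_apply, conj_trivial]
    rw [← mul_assoc (Complex.exp _) (Complex.exp _), ← Complex.exp_add]
    rw [mul_left_comm]
    congr 3
    have : (r : ℂ) ≠ 0 := by exact_mod_cast hr.ne'
    push_cast
    field_simp
    ring
  simp_rw [e1]
  rw [integral_const_mul]
  have h3 := Measure.integral_comp_mul_left (fun y => g (y + η)) r
  rw [h3, integral_add_right_eq_self g η, hg, integral_const_mul, abs_of_pos (by positivity)]
  rw [Complex.real_smul, ← mul_assoc, ← Complex.ofReal_mul, mul_inv_cancel₀ hr.ne']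
  simp


lemma kap_fourier_norm (κ : 𝓢(ℝ, ℂ)) (k : ℤ) (η ξ : ℝ) :
    ‖𝓕 (kap κ k η) ξ‖ = ‖𝓕 (κ : ℝ → ℂ) (ξ / (2:ℝ) ^ k)‖ := by
  rw [kap_fourier, norm_mul]
  have : (2 * Real.pi * Complex.I * (η * (ξ / (2:ℝ) ^ k) : ℝ) : ℂ) =
    ((2 * Real.pi * (η * (ξ / (2:ℝ) ^ k)) : ℝ) : ℂ) * Complex.I := by push_cast; ring
  rw [this, Complex.norm_exp_ofReal_mul_I, one_mul]

lemma kap_fourier_int (κ : 𝓢(ℝ, ℂ)) (k : ℤ) (η : ℝ) : Integrable (𝓕 (kap κ k η)) := by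
  have h1 : Integrable (𝓕 (κ : ℝ → ℂ)) := by
    rw [← SchwartzMap.fourier_coe]; exact (𝓕 κ).integrable
  have h2 := h1.comp_div (R := (2:ℝ) ^ k) (by positivity)
  refine (integrable_norm_iff (four_cont (kap_RD κ k η).integrable).aestronglyMeasurable).1 ?_
  simp_rw [kap_fourier_norm]
  exact h2.norm

/-- smoothness part of the Hormander condition -/
lemma kap_hor1 (κ : 𝓢(ℝ, ℂ)) : ∃ C : ℝ, 0 < C ∧ ∀ (k : ℤ) (η y : ℝ), 2 ^ k * |y| ≤ 1 →
    ∫⁻ x, ‖kap κ k η (x - y) - kap κ k η x‖ₑ ≤ ENNReal.ofReal (C * (2 ^ k * |y|)) := by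
  obtain ⟨B, hB0, hB⟩ := (schwartz_RD (SchwartzMap.derivCLM ℂ ℂ κ)).nonneg 2
  refine ⟨4 * B * (∫ x : ℝ, (1 + x ^ 2)⁻¹) + 1, ?_, fun k η y hy => ?_⟩
  · have : 0 ≤ ∫ x : ℝ, (1 + x ^ 2)⁻¹ := integral_nonneg fun x => by positivity
    positivity
  have hr : (0:ℝ) < 2 ^ k := by positivity
  have hκm : Continuous κ := κ.continuous
  set r : ℝ := (2:ℝ) ^ k with hrdef
  have e : ∀ x, ‖kap κ k η (x - y) - kap κ k η x‖ₑ =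
      ENNReal.ofReal r * (fun t => ‖κ (t - r * y) - κ t‖ₑ) (r * x + η) := by
    intro x
    simp only [kap]
    rw [← mul_sub, enorm_mul, ← hrdef, ← ofReal_norm (r : ℂ), Complex.norm_real,
      Real.norm_of_nonneg hr.le]
    congr 4
    ring_nf
  rw [lintegral_congr e, lint_scale hr η (g := fun t => ‖κ (t - r * y) - κ t‖ₑ) (by fun_prop)]
  have hpt : ∀ t : ℝ, ‖κ (t - r * y) - κ t‖ ≤ (r * |y|) * (4 * B) * (1 + t ^ 2)⁻¹ := by
    intro t
    have hseg : ∀ z ∈ Set.uIcc t (t - r * y), ‖deriv κ z‖ ≤ 4 * B * (1 + t ^ 2)⁻¹ := by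
      intro z hz
      have hzt : |z - t| ≤ 1 := by
        have := Set.abs_sub_left_of_mem_uIcc hz
        have e2 : |t - r * y - t| = r * |y| := by
          rw [sub_sub_cancel_left, abs_neg, abs_mul, abs_of_pos hr]
        linarith
      have h1 := hB z
      rw [SchwartzMap.derivCLM_apply] at h1
      rw [← div_eq_mul_inv, le_div_iff₀ (by positivity)]
      have h2 : 1 + |t| ≤ 2 * (1 + |z|) := by
        have := abs_sub_abs_le_abs_sub t z
        rw [abs_sub_comm] at this
        linarith [abs_nonneg z]
      have h3 : 1 + t ^ 2 ≤ 4 * (1 + |z|) ^ 2 := by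
        have : 1 + t ^ 2 ≤ (1 + |t|) ^ 2 := by nlinarith [abs_nonneg t, sq_abs t]
        nlinarith [abs_nonneg t]
      calc _ ≤ ‖deriv κ z‖ * (4 * (1 + |z|) ^ 2) := by gcongr
        _ = 4 * (‖deriv κ z‖ * (1 + |z|) ^ 2) := by ring
        _ ≤ _ := by linarith
    have := Convex.norm_image_sub_le_of_norm_deriv_le (𝕜 := ℝ) (fun z _ => κ.differentiableAt) hseg
      (convex_uIcc _ _) Set.left_mem_uIcc Set.right_mem_uIcc
    refine this.trans (le_of_eq ?_)
    rw [sub_sub_cancel_left, norm_neg, norm_mul, Real.norm_eq_abs, Real.norm_eq_abs, abs_of_pos hr]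
    ring
  have hintg : Integrable fun t : ℝ => (r * |y|) * (4 * B) * (1 + t ^ 2)⁻¹ :=
    integrable_inv_one_add_sq.const_mul _
  calc ∫⁻ t, ‖κ (t - r * y) - κ t‖ₑ ≤ ∫⁻ t, ENNReal.ofReal ((r * |y|) * (4 * B) * (1 + t ^ 2)⁻¹) := by
        apply lintegral_mono; intro t
        dsimp only
        rw [← ofReal_norm]
        exact ENNReal.ofReal_le_ofReal (hpt t)
    _ = ENNReal.ofReal (∫ t : ℝ, (r * |y|) * (4 * B) * (1 + t ^ 2)⁻¹) := by
        rw [ofReal_integral_eq_lintegral_ofReal hintg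
          (Filter.Eventually.of_forall fun t => by positivity)]
    _ ≤ _ := by
        apply ENNReal.ofReal_le_ofReal
        rw [integral_const_mul]
        have : 0 ≤ r * |y| := by positivity
        nlinarith

/-- decay part of the Hormander condition -/
lemma kap_hor2 (κ : 𝓢(ℝ, ℂ)) : ∃ C : ℝ, 0 < C ∧ ∀ (k : ℤ) (η y : ℝ), y ≠ 0 →
    ∫⁻ x in {x | 2 * |y| ≤ |x|}, ‖kap κ k η (x - y) - kap κ k η x‖ₑ ≤
      ENNReal.ofReal (C * (1 + |η|) * (2 ^ k * |y|)⁻¹) := by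
  refine ⟨2 * (∫ x : ℝ, ‖κ x‖ * (1 + |x|) ^ 1) + 1, ?_, fun k η y hy => ?_⟩
  · have : 0 ≤ ∫ x : ℝ, ‖κ x‖ * (1 + |x|) ^ 1 := integral_nonneg fun x => by positivity
    positivity
  have hr : (0:ℝ) < 2 ^ k := by positivity
  have hκm : Continuous κ := κ.continuous
  have hkc := kap_continuous κ k η
  have hy' : 0 < |y| := abs_pos.2 hy
  set r : ℝ := (2:ℝ) ^ k with hrdef
  set h : ℝ → ENNReal := fun x => ENNReal.ofReal (r * |x| * ‖kap κ k η x‖) with hh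
  have hhm : Measurable h := by fun_prop
  have hI : ∫⁻ x, h x ≤ ENNReal.ofReal ((1 + |η|) * ∫ x : ℝ, ‖κ x‖ * (1 + |x|) ^ 1) := by
    have e : ∀ x, h x = ENNReal.ofReal r *
        (fun t => ENNReal.ofReal (|t - η| * ‖κ t‖)) (r * x + η) := by
      intro x
      simp only [hh]
      rw [← ENNReal.ofReal_mul hr.le, kap_norm, ← hrdef]
      congr 1
      rw [add_sub_cancel_right, abs_mul, abs_of_pos hr]; ring
    rw [lintegral_congr e, lint_scale hr η (g := fun t => ENNReal.ofReal (|t - η| * ‖κ t‖)) (by fun_prop), ← integral_const_mul, ofReal_integral_eq_lintegral_ofReal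
      (((schwartz_RD κ).int_mul 1).const_mul _) (Filter.Eventually.of_forall fun t => by positivity)]
    apply lintegral_mono
    intro t
    apply ENNReal.ofReal_le_ofReal
    have h1 : |t - η| ≤ (1 + |η|) * (1 + |t|) := by
      have := abs_sub t η
      nlinarith [abs_nonneg t, abs_nonneg η]
    calc _ ≤ ((1 + |η|) * (1 + |t|)) * ‖κ t‖ := by gcongr
      _ = _ := by ring
  have hk : ∀ x, |y| ≤ |x| → ‖kap κ k η x‖ₑ ≤ ENNReal.ofReal ((r * |y|)⁻¹) * h x := by
    intro x hx
    simp only [hh]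
    rw [← ENNReal.ofReal_mul (by positivity), ← ofReal_norm]
    apply ENNReal.ofReal_le_ofReal
    have : 1 ≤ (r * |y|)⁻¹ * (r * |x|) := by
      rw [← div_eq_inv_mul, one_le_div (by positivity)]
      gcongr
    calc _ = 1 * ‖kap κ k η x‖ := (one_mul _).symm
      _ ≤ ((r * |y|)⁻¹ * (r * |x|)) * ‖kap κ k η x‖ := by gcongr
      _ = _ := by ring
  have hms : MeasurableSet {x : ℝ | 2 * |y| ≤ |x|} := measurableSet_le (by fun_prop) (by fun_prop)
  calc ∫⁻ x in {x | 2 * |y| ≤ |x|}, ‖kap κ k η (x - y) - kap κ k η x‖ₑ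
      ≤ ∫⁻ x in {x | 2 * |y| ≤ |x|}, ENNReal.ofReal ((r * |y|)⁻¹) * (h (x - y) + h x) := by
        apply setLIntegral_mono' hms
        intro x hx
        rw [Set.mem_ofPred_eq] at hx
        rw [mul_add]
        refine (enorm_sub_le).trans (add_le_add (hk _ ?_) (hk _ ?_))
        · have := abs_sub_abs_le_abs_sub x y
          linarith
        · linarith
    _ ≤ ∫⁻ x, ENNReal.ofReal ((r * |y|)⁻¹) * (h (x - y) + h x) := setLIntegral_le_lintegral _ _
    _ = ENNReal.ofReal ((r * |y|)⁻¹) * (2 * ∫⁻ x, h x) := by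
        rw [lintegral_const_mul _ (by fun_prop), lintegral_add_left (by fun_prop),
          lintegral_sub_right_eq_self, two_mul]
    _ ≤ ENNReal.ofReal ((r * |y|)⁻¹) * (2 * ENNReal.ofReal ((1 + |η|) * ∫ x : ℝ, ‖κ x‖ * (1 + |x|) ^ 1)) := by
        gcongr
    _ = ENNReal.ofReal ((r * |y|)⁻¹ * (2 * ((1 + |η|) * ∫ x : ℝ, ‖κ x‖ * (1 + |x|) ^ 1))) := by
        rw [ENNReal.ofReal_mul (p := (r * |y|)⁻¹) (by positivity), ENNReal.ofReal_mul (p := 2) (by norm_num)]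
        simp
    _ ≤ _ := by
        apply ENNReal.ofReal_le_ofReal
        have h1 : 0 ≤ (1 + |η|) * (r * |y|)⁻¹ := by positivity
        nlinarith

lemma sq1 (κ : 𝓢(ℝ, ℂ)) {C3 : ℝ} (h3 : ∀ ξ, ‖𝓕 (κ : ℝ → ℂ) ξ‖ ^ 2 ≤ C3 * min |ξ| (|ξ|⁻¹))
    {p : ℝ} (hp : 1 < p) : ∃ C : ℝ, 0 < C ∧ ∀ (η : ℝ) (S : Finset ℤ) (ι : Type) [Fintype ι]
    (f : ι → ℝ → ℂ), (∀ i, Continuous (f i)) → (∀ i, Integrable (f i)) →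
    (∃ M, ∀ i x, ‖f i x‖ ≤ M) →
    ∫⁻ x, (∑ q : S × ι, ‖cv (kap κ q.1 η) (f q.2) x‖ₑ ^ 2) ^ (p / 2) ≤
      (ENNReal.ofReal (C * (1 + |η|) ^ 2)) ^ p * ∫⁻ x, (∑ i, ‖f i x‖ₑ ^ 2) ^ (p / 2) := by
  obtain ⟨D, hD0, hD⟩ := dy_sum
  obtain ⟨C1, hC1, h1⟩ := kap_hor1 κ
  obtain ⟨C2, hC2, h2⟩ := kap_hor2 κ
  have hC3 : 0 ≤ C3 := by
    have := h3 1
    simp only [abs_one, inv_one, min_self, mul_one] at this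
    exact (by positivity : (0:ℝ) ≤ _).trans this
  set A0 : ℝ := (C1 + C2) * D + C3 * D + 1 with hA0
  have hA0p : 1 ≤ A0 := by
    have : 0 ≤ (C1 + C2) * D + C3 * D := by positivity
    linarith
  refine ⟨(|czD p| + 1) * A0 ^ 2, by positivity, fun η S ι _ f hfc hfi hfb => ?_⟩
  have hη : 1 ≤ 1 + |η| := by linarith [abs_nonneg η]
  set A : ℝ := A0 * (1 + |η|) with hA
  have hAA0 : A0 ≤ A := by rw [hA]; nlinarith
  have hA1 : 1 ≤ A := hA0p.trans hAA0
  choose B hB using fun k : S => (kap_RD κ k η).bdd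
  have hBB : ∀ k : S, B k ≤ ∑ k, |B k| := fun k =>
    (le_abs_self _).trans (Finset.single_le_sum (f := fun k => |B k|) (fun _ _ => abs_nonneg _) (Finset.mem_univ k))
  have hM : ∀ ξ, ∑ k : S, ‖𝓕 (kap κ k η) ξ‖ ^ 2 ≤ A ^ 2 := by
    intro ξ
    have : ∑ k : S, ‖𝓕 (kap κ k η) ξ‖ ^ 2 ≤ C3 * D := by
      rcases eq_or_ne ξ 0 with rfl | hξ
      · have h0 : ∀ k : S, ‖𝓕 (kap κ k η) 0‖ ^ 2 ≤ 0 := by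
          intro k
          rw [kap_fourier_norm, zero_div]
          simpa using h3 0
        exact (Finset.sum_nonpos fun k _ => h0 k).trans (by positivity)
      · have hξ' : 0 < |ξ|⁻¹ := by positivity
        refine le_trans ?_ (mul_le_mul_of_nonneg_left (hD S _ hξ') hC3)
        rw [Finset.sum_coe_sort S fun k => ‖𝓕 (kap κ k η) ξ‖ ^ 2, Finset.mul_sum]
        refine Finset.sum_le_sum fun k _ => ?_
        rw [kap_fourier_norm]
        refine (h3 _).trans (le_of_eq ?_)
        rw [abs_div, abs_of_pos (by positivity : (0:ℝ) < 2 ^ k), min_comm]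
        congr 2
        · rw [inv_div, div_eq_mul_inv]
        · rw [mul_inv, inv_inv, div_eq_inv_mul]
    have h4 : 0 ≤ (C1 + C2) * D := by positivity
    nlinarith
  have hH : ∀ y, ∑ k : S, ∫⁻ x in {x | 2 * |y| ≤ |x|}, ‖kap κ k η (x - y) - kap κ k η x‖ₑ ≤
      ENNReal.ofReal A := by
    intro y
    rcases eq_or_ne y 0 with rfl | hy
    · simp
    have hy' : 0 < |y| := by positivity
    rw [Finset.sum_coe_sort S fun k => ∫⁻ x in {x | 2 * |y| ≤ |x|}, ‖kap κ k η (x - y) - kap κ k η x‖ₑ]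
    have hk : ∀ k ∈ S, ∫⁻ x in {x | 2 * |y| ≤ |x|}, ‖kap κ k η (x - y) - kap κ k η x‖ₑ ≤
        ENNReal.ofReal ((C1 + C2) * (1 + |η|) * min ((2:ℝ) ^ k * |y|) ((2 ^ k * |y|)⁻¹)) := by
      intro k _
      have hs : 0 < (2:ℝ) ^ k * |y| := by positivity
      rcases le_total ((2:ℝ) ^ k * |y|) 1 with hle | hle
      · refine (setLIntegral_le_lintegral _ _).trans ((h1 k η y hle).trans (ENNReal.ofReal_le_ofReal ?_))
        rw [min_eq_left (hle.trans (one_le_inv_iff₀.2 ⟨hs, hle⟩))]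
        gcongr
        nlinarith
      · refine (h2 k η y hy).trans (ENNReal.ofReal_le_ofReal ?_)
        rw [min_eq_right ((inv_le_one_of_one_le₀ hle).trans hle)]
        gcongr
        linarith
    refine (Finset.sum_le_sum hk).trans ?_
    rw [← ENNReal.ofReal_sum_of_nonneg fun i _ => by positivity, ← Finset.mul_sum]
    apply ENNReal.ofReal_le_ofReal
    calc _ ≤ (C1 + C2) * (1 + |η|) * D := by gcongr; exact hD S _ hy'
      _ = ((C1 + C2) * D) * (1 + |η|) := by ring
      _ ≤ _ := by
        rw [hA]; gcongr
        have : 0 ≤ C3 * D := by positivity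
        linarith
  refine (sq_gen (κ := fun k : S => kap κ k η) (fun k => (kap_RD κ k η).integrable)
    (fun k => kap_continuous κ k η) (B := ∑ k, |B k|) (fun k t => (hB k t).trans (hBB k))
    (fun k => kap_fourier_int κ k η) hA1 hM hH hfc hfi hfb hp).trans ?_
  gcongr
  rw [← ENNReal.ofReal_pow (by positivity), ← ENNReal.ofReal_mul' (by positivity)]
  apply ENNReal.ofReal_le_ofReal
  rw [hA]
  have : czD p ≤ |czD p| + 1 := by linarith [le_abs_self (czD p)]
  calc _ ≤ (|czD p| + 1) * (A0 * (1 + |η|)) ^ 2 := by gcongr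
    _ = _ := by ring

end onedim

end

open scoped BigOperators RealInnerProductSpace
open MeasureTheory

noncomputable section

set_option linter.unusedSectionVars false

section ndim
open scoped FourierTransform SchwartzMap
variable {d : ℕ}

/-- unit line in coordinate direction j -/
abbrev ej (j : Fin d) (t : ℝ) : Euc d := EuclideanSpace.single j t

lemma ej_norm (j : Fin d) (t : ℝ) : ‖ej j t‖ = |t| := by simp [ej]

lemma ej_cont (j : Fin d) : Continuous (fun t : ℝ => ej j t) := by
  have : (fun t : ℝ => ej j t) = fun t => t • ej j 1 := by
    ext t i; simp [ej]
  rw [this]; fun_prop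

lemma ej_add (j : Fin d) (s t : ℝ) : ej j (s + t) = ej j s + ej j t := by
  ext i; simp [ej]; split_ifs <;> simp

lemma ej_neg (j : Fin d) (t : ℝ) : ej j (-t) = - ej j t := by
  ext i; simp [ej]; split_ifs <;> simp

lemma ej_inner (j : Fin d) (t : ℝ) (ξ : Euc d) : ⟪ej j t, ξ⟫ = t * ξ j := by
  simp [ej, EuclideanSpace.inner_single_left]

/-- convolution in one coordinate -/
def op (j : Fin d) (K : ℝ → ℂ) (f : Euc d → ℂ) : Euc d → ℂ :=
  fun x => ∫ t, K t * f (x - ej j t)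

/-- continuous functions with integrable decay -/
def DD (f : Euc d → ℂ) : Prop :=
  Continuous f ∧ ∃ B : ℝ, ∀ x, ‖f x‖ * (1 + ‖x‖) ^ (d + 2) ≤ B

def WW (d : ℕ) (x : Euc d) : ℝ := ((1 + ‖x‖) ^ (d + 2))⁻¹

lemma WW_pos (x : Euc d) : 0 < WW d x := by unfold WW; positivity

lemma WW_cont : Continuous (WW d) := by
  unfold WW
  exact Continuous.inv₀ (by fun_prop) fun x => by positivity

lemma WW_int : Integrable (WW d) := by
  have := integrable_one_add_norm (E := Euc d) (μ := volume) (r := (d + 2 : ℕ)) (by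
    simp only [finrank_euclideanSpace, Fintype.card_fin]; push_cast; linarith)
  refine this.congr (Filter.Eventually.of_forall fun x => ?_)
  unfold WW
  simp only
  rw [Real.rpow_neg (by positivity), Real.rpow_natCast]

lemma DD.bound {f : Euc d → ℂ} (h : DD f) : ∃ B : ℝ, 0 < B ∧ ∀ x, ‖f x‖ ≤ B * WW d x := by
  obtain ⟨B, hB⟩ := h.2
  refine ⟨max B 1, by positivity, fun x => ?_⟩
  unfold WW
  rw [← div_eq_mul_inv, le_div_iff₀ (by positivity)]
  exact (hB x).trans (le_max_left _ _)

lemma DD.of_bound {f : Euc d → ℂ} (hc : Continuous f) {B : ℝ} (h : ∀ x, ‖f x‖ ≤ B * WW d x) : DD f := by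
  refine ⟨hc, B, fun x => ?_⟩
  have := h x
  unfold WW at this
  rwa [← div_eq_mul_inv, le_div_iff₀ (by positivity)] at this

lemma WW_le_one (x : Euc d) : WW d x ≤ 1 := by
  unfold WW
  exact inv_le_one_of_one_le₀ (one_le_pow₀ (by linarith [norm_nonneg x]))

lemma DD.bdd {f : Euc d → ℂ} (h : DD f) : ∃ B : ℝ, 0 < B ∧ ∀ x, ‖f x‖ ≤ B := by
  obtain ⟨B, hB0, hB⟩ := h.bound
  exact ⟨B, hB0, fun x => (hB x).trans (by nlinarith [WW_le_one x])⟩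

lemma DD.integrable {f : Euc d → ℂ} (h : DD f) : Integrable f := by
  obtain ⟨B, hB0, hB⟩ := h.bound
  exact (WW_int.const_mul B).mono' h.1.aestronglyMeasurable (Filter.Eventually.of_forall hB)

lemma DD.of_compact {f : Euc d → ℂ} (hc : Continuous f) (hs : HasCompactSupport f) : DD f := by
  refine ⟨hc, ?_⟩
  have h1 : Continuous fun x => ‖f x‖ * (1 + ‖x‖) ^ (d + 2) := by fun_prop
  have h2 : HasCompactSupport fun x => ‖f x‖ * (1 + ‖x‖) ^ (d + 2) := hs.norm.mul_right
  obtain ⟨B, hB⟩ := h1.bounded_above_of_compact_support h2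
  exact ⟨B, fun x => (le_abs_self _).trans (hB x)⟩

lemma WW_shift (x : Euc d) (j : Fin d) (t : ℝ) : WW d (x - ej j t) ≤ WW d x * (1 + |t|) ^ (d + 2) := by
  unfold WW
  rw [← div_eq_inv_mul, inv_eq_one_div, div_le_div_iff₀ (by positivity) (by positivity), one_mul, ← mul_pow]
  gcongr
  have : ‖x‖ ≤ ‖x - ej j t‖ + |t| := by
    rw [← ej_norm j t]
    have := norm_add_le (x - ej j t) (ej j t)
    simpa using this
  nlinarith [norm_nonneg (x - ej j t), abs_nonneg t]

lemma op_term_bound {K : ℝ → ℂ} {f : Euc d → ℂ} {B : ℝ} (hB0 : 0 < B) (hB : ∀ x, ‖f x‖ ≤ B * WW d x)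
    (j : Fin d) (x : Euc d) (t : ℝ) :
    ‖K t * f (x - ej j t)‖ ≤ (B * WW d x) * (‖K t‖ * (1 + |t|) ^ (d + 2)) := by
  rw [norm_mul]
  calc _ ≤ ‖K t‖ * (B * (WW d x * (1 + |t|) ^ (d + 2))) := by
        gcongr
        exact (hB _).trans (by gcongr; exact WW_shift x j t)
    _ = _ := by ring

lemma op_term_int {K : ℝ → ℂ} (hK : RD K) {f : Euc d → ℂ} (hf : DD f) (j : Fin d) (x : Euc d) :
    Integrable fun t => K t * f (x - ej j t) := by
  obtain ⟨B, hB0, hB⟩ := hf.bound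
  have h1 := hK.1
  have h2 := hf.1
  have h3 := ej_cont j
  exact ((hK.int_mul (d + 2)).const_mul (B * WW d x)).mono'
    (by fun_prop) (Filter.Eventually.of_forall fun t => op_term_bound hB0 hB j x t)

lemma op_DD {K : ℝ → ℂ} (hK : RD K) {f : Euc d → ℂ} (hf : DD f) (j : Fin d) : DD (op j K f) := by
  obtain ⟨B, hB0, hB⟩ := hf.bound
  obtain ⟨B', hB0', hB'⟩ := hf.bdd
  have h1 := hK.1
  have h2 := hf.1
  have h3 := ej_cont j
  apply DD.of_bound (B := B * ∫ t, ‖K t‖ * (1 + |t|) ^ (d + 2))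
  · unfold op
    apply continuous_of_dominated (bound := fun t => ‖K t‖ * B')
    · intro x; fun_prop
    · intro x
      exact Filter.Eventually.of_forall fun t => by rw [norm_mul]; gcongr; exact hB' _
    · exact hK.integrable.norm.mul_const _
    · exact Filter.Eventually.of_forall fun t => by fun_prop
  · intro x
    unfold op
    refine (norm_integral_le_of_norm_le ((hK.int_mul (d + 2)).const_mul (B * WW d x))
      (Filter.Eventually.of_forall fun t => op_term_bound hB0 hB j x t)).trans (le_of_eq ?_)
    rw [integral_const_mul]; ring

lemma op_prod_int {K : ℝ → ℂ} (hK : RD K) {f : Euc d → ℂ} (hf : DD f) (j : Fin d)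
    {g : Euc d → ℂ} (hg : Continuous g) {M : ℝ} (hM : ∀ x, ‖g x‖ ≤ M) :
    Integrable (fun q : Euc d × ℝ => g q.1 * (K q.2 * f (q.1 - ej j q.2))) (volume.prod volume) := by
  obtain ⟨B, hB0, hB⟩ := hf.bound
  have h1 := hK.1
  have h2 := hf.1
  have h3 := ej_cont j
  have hM0 : 0 ≤ M := (norm_nonneg _).trans (hM 0)
  have hp := ((WW_int (d := d)).const_mul B).mul_prod (hK.int_mul (d + 2))
  refine (hp.const_mul M).mono' ?_ (Filter.Eventually.of_forall fun q => ?_)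
  · exact (by fun_prop : Continuous _).aestronglyMeasurable
  · rw [norm_mul]
    exact mul_le_mul (hM _) (op_term_bound hB0 hB j q.1 q.2) (norm_nonneg _) hM0

lemma op_swap {K : ℝ → ℂ} (hK : RD K) {f : Euc d → ℂ} (hf : DD f) (j : Fin d)
    {g : Euc d → ℂ} (hg : Continuous g) {M : ℝ} (hM : ∀ x, ‖g x‖ ≤ M) :
    ∫ x, g x * op j K f x = ∫ t, K t * ∫ x, g (x + ej j t) * f x := by
  unfold op
  simp_rw [← integral_const_mul]
  rw [integral_integral_swap (f := fun x t => g x * (K t * f (x - ej j t)))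
    (op_prod_int hK hf j hg hM)]
  congr 1; ext t
  rw [← integral_add_right_eq_self _ (ej j t)]
  congr 1; ext x
  rw [add_sub_cancel_right]; ring

lemma RD.neg {K : ℝ → ℂ} (h : RD K) : RD fun t => K (-t) := by
  refine ⟨h.1.comp continuous_neg, fun M => ?_⟩
  obtain ⟨B, hB⟩ := h.2 M
  exact ⟨B, fun t => by simpa using hB (-t)⟩

lemma op_transpose {K : ℝ → ℂ} (hK : RD K) {f g : Euc d → ℂ} (hf : DD f) (hg : DD g) (j : Fin d) :
    ∫ x, op j K f x * g x = ∫ x, f x * op j (fun t => K (-t)) g x := by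
  obtain ⟨M, _, hM⟩ := hf.bdd
  obtain ⟨M', _, hM'⟩ := hg.bdd
  rw [op_swap hK.neg hg j hf.1 hM]
  simp_rw [fun x => mul_comm (op j K f x) (g x)]
  rw [op_swap hK hf j hg.1 hM']
  rw [← integral_neg_eq_self]
  congr 1; ext t
  congr 1
  rw [← integral_add_right_eq_self _ (ej j t)]
  congr 1; ext x
  rw [ej_neg, add_assoc, add_neg_cancel, add_zero, mul_comm]

lemma op_fourier {K : ℝ → ℂ} (hK : RD K) {f : Euc d → ℂ} (hf : DD f) (j : Fin d) (ξ : Euc d) :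
    𝓕 (op j K f) ξ = 𝓕 K (ξ j) * 𝓕 f ξ := by
  rw [Real.fourier_eq', Real.fourier_eq', Real.fourier_eq']
  simp_rw [smul_eq_mul]
  rw [op_swap hK hf j (g := fun x => Complex.exp (((-2 * Real.pi * ⟪x, ξ⟫ : ℝ) : ℂ) * Complex.I))
    (by fun_prop) (M := 1) (fun x => by rw [Complex.norm_exp_ofReal_mul_I]), ← integral_mul_const]
  congr 1; ext t
  have : ∀ x : Euc d, Complex.exp (((-2 * Real.pi * ⟪x + ej j t, ξ⟫ : ℝ) : ℂ) * Complex.I) * f x =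
    Complex.exp (((-2 * Real.pi * ⟪t, ξ j⟫ : ℝ) : ℂ) * Complex.I) *
    (Complex.exp (((-2 * Real.pi * ⟪x, ξ⟫ : ℝ) : ℂ) * Complex.I) * f x) := by
    intro x
    rw [← mul_assoc, ← Complex.exp_add, inner_add_left, ej_inner]
    congr 2
    simp only [RCLike.inner_apply, conj_trivial]
    push_cast; ring
  simp_rw [this]
  rw [integral_const_mul]; ring

lemma op_comm {K L : ℝ → ℂ} (hK : RD K) (hL : RD L) {f : Euc d → ℂ} (hf : DD f) (i j : Fin d) :
    op i K (op j L f) = op j L (op i K f) := by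
  ext x
  unfold op
  obtain ⟨M, hM0, hM⟩ := hf.bdd
  simp_rw [← integral_const_mul]
  have h1 := hK.1
  have h2 := hf.1
  have h3 := hL.1
  have h4 := ej_cont i
  have h5 := ej_cont j
  rw [integral_integral_swap]
  · congr 1; ext s; congr 1; ext t
    rw [sub_right_comm]; ring
  · refine ((hK.integrable.norm.mul_prod hL.integrable.norm).mul_const M).mono'
      (by unfold Function.uncurry; exact (by fun_prop : Continuous _).aestronglyMeasurable)
      (Filter.Eventually.of_forall fun q => ?_)
    simp only [Function.uncurry]
    rw [norm_mul, norm_mul, ← mul_assoc]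
    gcongr
    exact hM _

lemma op_line {K : ℝ → ℂ} {f : Euc d → ℂ} (j : Fin d) (x : Euc d) (s : ℝ) :
    op j K f (x + ej j s) = cv K (fun y => f (x + ej j y)) s := by
  unfold op cv
  rw [← integral_sub_left_eq_self _ _ s]
  congr 1; ext t
  have : x + ej j s - ej j (s - t) = x + ej j t := by
    rw [sub_eq_add_neg s t, ej_add, ej_neg]; abel
  rw [this]

lemma line_trick (j : Fin d) {Φ : Euc d → ENNReal} (hΦ : Measurable Φ) :
    ∫⁻ x, Φ x = ∫⁻ x : Euc d, (Set.Icc (0:ℝ) 1).indicator 1 (x j) * ∫⁻ s, Φ (x + ej j s) := by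
  have hw : Measurable ((Set.Icc (0:ℝ) 1).indicator (1 : ℝ → ENNReal)) :=
    measurable_one.indicator measurableSet_Icc
  have hej := (ej_cont j).measurable
  have hcm : ∀ x : Euc d, (Set.Icc (0:ℝ) 1).indicator (1 : ℝ → ENNReal) (x j) * ∫⁻ s, Φ (x + ej j s) =
      ∫⁻ s, (Set.Icc (0:ℝ) 1).indicator (1 : ℝ → ENNReal) (x j) * Φ (x + ej j s) := fun x =>
    (lintegral_const_mul _ (by fun_prop : Measurable fun s => Φ (x + ej j s))).symm
  rw [lintegral_congr hcm]
  rw [lintegral_lintegral_swap (by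
    unfold Function.uncurry
    have hp : Measurable fun q : Euc d × ℝ => q.1 j := by fun_prop
    exact ((hw.comp hp).mul (hΦ.comp (by fun_prop))).aemeasurable)]
  have : ∀ s : ℝ, ∫⁻ x : Euc d, (Set.Icc (0:ℝ) 1).indicator 1 (x j) * Φ (x + ej j s) =
      ∫⁻ x : Euc d, (Set.Icc (0:ℝ) 1).indicator 1 (x j - s) * Φ x := by
    intro s
    rw [← lintegral_add_right_eq_self (fun x : Euc d =>
      (Set.Icc (0:ℝ) 1).indicator (1 : ℝ → ENNReal) (x j - s) * Φ x) (ej j s)]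
    congr 1; ext x
    congr 2
    simp [ej]
  simp_rw [this]
  rw [lintegral_lintegral_swap (by
    unfold Function.uncurry
    have hp : Measurable fun q : ℝ × Euc d => q.2 j - q.1 := by fun_prop
    exact ((hw.comp hp).mul (hΦ.comp (by fun_prop))).aemeasurable)]
  congr 1; ext x
  have hm : Measurable fun s : ℝ => (Set.Icc (0:ℝ) 1).indicator (1 : ℝ → ENNReal) (x j - s) :=
    hw.comp (by fun_prop)
  rw [lintegral_mul_const _ hm, lintegral_sub_left_eq_self _ (x j),
    lintegral_indicator_one measurableSet_Icc]
  simp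


lemma DD.line {f : Euc d → ℂ} (hf : DD f) (j : Fin d) (x : Euc d) :
    Integrable fun s => f (x + ej j s) := by
  obtain ⟨B, hB0, hB⟩ := hf.bound
  have h2 := hf.1
  have h3 := ej_cont j
  have h1 : Integrable fun s : ℝ => (B * (1 + ‖x‖) ^ 2) * (1 + s ^ 2)⁻¹ :=
    integrable_inv_one_add_sq.const_mul _
  refine h1.mono' (by fun_prop) (Filter.Eventually.of_forall fun s => (hB _).trans ?_)
  rw [mul_assoc]
  gcongr
  unfold WW
  rw [← div_eq_mul_inv, inv_eq_one_div, div_le_div_iff₀ (by positivity) (by positivity), one_mul]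
  have h4 : |s| ≤ ‖x + ej j s‖ + ‖x‖ := by
    rw [← ej_norm j s]
    have := norm_sub_le (x + ej j s) x
    simpa using this
  have h5 : 1 + s ^ 2 ≤ (1 + |s|) ^ 2 := by nlinarith [abs_nonneg s, sq_abs s]
  have h6 : 1 + |s| ≤ (1 + ‖x‖) * (1 + ‖x + ej j s‖) := by
    nlinarith [norm_nonneg x, norm_nonneg (x + ej j s)]
  calc 1 + s ^ 2 ≤ (1 + |s|) ^ 2 := h5
    _ ≤ ((1 + ‖x‖) * (1 + ‖x + ej j s‖)) ^ 2 := by gcongr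
    _ = (1 + ‖x‖) ^ 2 * (1 + ‖x + ej j s‖) ^ 2 := mul_pow _ _ _
    _ ≤ _ := by
      gcongr
      · linarith [norm_nonneg (x + ej j s)]
      · omega

/-- the one dimensional square function property -/
def SQ1 (κ : 𝓢(ℝ, ℂ)) (p C : ℝ) : Prop := 0 < C ∧ ∀ (η : ℝ) (S : Finset ℤ) (ι : Type) [Fintype ι]
    (f : ι → ℝ → ℂ), (∀ i, Continuous (f i)) → (∀ i, Integrable (f i)) →
    (∃ M, ∀ i x, ‖f i x‖ ≤ M) →
    ∫⁻ x, (∑ q : S × ι, ‖cv (kap κ q.1 η) (f q.2) x‖ₑ ^ 2) ^ (p / 2) ≤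
      (ENNReal.ofReal (C * (1 + |η|) ^ 2)) ^ p * ∫⁻ x, (∑ i, ‖f i x‖ₑ ^ 2) ^ (p / 2)

lemma sq_step {κ : 𝓢(ℝ, ℂ)} {p C : ℝ} (h : SQ1 κ p C) (j : Fin d) (η : ℝ) (S : Finset ℤ)
    (ι : Type) [Fintype ι] {f : ι → Euc d → ℂ} (hf : ∀ i, DD (f i)) :
    ∫⁻ x, (∑ q : S × ι, ‖op j (kap κ q.1 η) (f q.2) x‖ₑ ^ 2) ^ (p / 2) ≤
      (ENNReal.ofReal (C * (1 + |η|) ^ 2)) ^ p * ∫⁻ x, (∑ i, ‖f i x‖ₑ ^ 2) ^ (p / 2) := by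
  have hm1 : Measurable fun x : Euc d => (∑ q : S × ι, ‖op j (kap κ q.1 η) (f q.2) x‖ₑ ^ 2) ^ (p / 2) := by
    refine Measurable.pow_const (Finset.measurable_sum _ fun q _ => ?_) _
    exact ((op_DD (kap_RD κ q.1 η) (hf q.2) j).1.enorm.measurable).pow_const 2
  have hm2 : Measurable fun x : Euc d => (∑ i, ‖f i x‖ₑ ^ 2) ^ (p / 2) := by
    refine Measurable.pow_const (Finset.measurable_sum _ fun q _ => ?_) _
    exact ((hf q).1.enorm.measurable).pow_const 2
  rw [line_trick j hm1, line_trick j hm2]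
  have hej := (ej_cont j).measurable
  have hw : Measurable ((Set.Icc (0:ℝ) 1).indicator (1 : ℝ → ENNReal)) :=
    measurable_one.indicator measurableSet_Icc
  have hp : Measurable fun x : Euc d => x j := by fun_prop
  rw [← lintegral_const_mul]
  swap
  · refine (hw.comp hp).mul (Measurable.lintegral_prod_right' (f := fun q : Euc d × ℝ =>
      (∑ i, ‖f i (q.1 + ej j q.2)‖ₑ ^ 2) ^ (p / 2)) ?_)
    exact hm2.comp (by fun_prop)
  apply lintegral_mono
  intro x
  dsimp only
  rw [mul_left_comm]
  gcongr
  choose M hM0 hM using fun i => (hf i).bdd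
  have := h.2 η S ι (fun i s => f i (x + ej j s))
    (fun i => (hf i).1.comp ((continuous_const).add (ej_cont j)))
    (fun i => (hf i).line j x) ⟨∑ i, M i, fun i s => (hM i _).trans
      (Finset.single_le_sum (f := M) (fun i _ => (hM0 i).le) (Finset.mem_univ i))⟩
  simp_rw [op_line]
  exact this

/-- iterated one-coordinate convolutions -/
def opG : (m : ℕ) → (Fin m → Fin d) → (Fin m → ℝ → ℂ) → (Euc d → ℂ) → Euc d → ℂ
  | 0, _, _, f => f
  | m + 1, c, K, f => op (c 0) (K 0) (opG m (fun i => c i.succ) (fun i => K i.succ) f)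

lemma opG_DD (m : ℕ) (c : Fin m → Fin d) (K : Fin m → ℝ → ℂ) (hK : ∀ i, RD (K i)) {f : Euc d → ℂ}
    (hf : DD f) : DD (opG m c K f) := by
  induction m with
  | zero => exact hf
  | succ m ih => exact op_DD (hK 0) (ih _ _ fun i => hK i.succ) _

lemma opG_fourier (m : ℕ) (c : Fin m → Fin d) (K : Fin m → ℝ → ℂ) (hK : ∀ i, RD (K i)) {f : Euc d → ℂ}
    (hf : DD f) (ξ : Euc d) : 𝓕 (opG m c K f) ξ = (∏ i, 𝓕 (K i) (ξ (c i))) * 𝓕 f ξ := by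
  induction m with
  | zero => simp [opG]
  | succ m ih =>
    rw [Fin.prod_univ_succ]
    unfold opG
    rw [op_fourier (hK 0) (opG_DD m _ _ (fun i => hK i.succ) hf), ih _ _ fun i => hK i.succ, mul_assoc]

lemma opG_comm (m : ℕ) (c : Fin m → Fin d) (K : Fin m → ℝ → ℂ) (hK : ∀ i, RD (K i)) {f : Euc d → ℂ}
    (hf : DD f) (j : Fin d) {L : ℝ → ℂ} (hL : RD L) :
    opG m c K (op j L f) = op j L (opG m c K f) := by
  induction m with
  | zero => rfl
  | succ m ih =>
    simp only [opG]
    rw [ih _ _ fun i => hK i.succ, op_comm (hK 0) hL (opG_DD m _ _ (fun i => hK i.succ) hf)]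

lemma opG_transpose (m : ℕ) (c : Fin m → Fin d) (K : Fin m → ℝ → ℂ) (hK : ∀ i, RD (K i))
    {f g : Euc d → ℂ} (hf : DD f) (hg : DD g) :
    ∫ x, opG m c K f x * g x = ∫ x, f x * opG m c (fun i t => K i (-t)) g x := by
  induction m generalizing g with
  | zero => rfl
  | succ m ih =>
    simp only [opG]
    rw [op_transpose (hK 0) (opG_DD m _ _ (fun i => hK i.succ) hf) hg,
      ih _ _ (fun i => hK i.succ) (op_DD (hK 0).neg hg _),
      opG_comm m _ _ (fun i => (hK i.succ).neg) hg _ (hK 0).neg]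

lemma opG_sq {κ : 𝓢(ℝ, ℂ)} {p C : ℝ} (hp : 1 < p) (h : SQ1 κ p C) (m : ℕ) (c : Fin m → Fin d) (η : Fin m → ℝ)
    (S : Finset ℤ) (ι : Type) [Fintype ι] {f : ι → Euc d → ℂ} (hf : ∀ i, DD (f i)) :
    ∫⁻ x, (∑ q : (Fin m → S) × ι, ‖opG m c (fun i => kap κ (q.1 i) (η i)) (f q.2) x‖ₑ ^ 2) ^ (p / 2) ≤
      (ENNReal.ofReal (∏ i, (C * (1 + |η i|) ^ 2))) ^ p * ∫⁻ x, (∑ i, ‖f i x‖ₑ ^ 2) ^ (p / 2) := by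
  induction m with
  | zero =>
    simp only [opG, Finset.univ_eq_empty, Finset.prod_empty, ENNReal.ofReal_one, ENNReal.one_rpow, one_mul]
    apply lintegral_mono
    intro x
    dsimp only
    rw [Fintype.sum_prod_type]
    simp
  | succ m ih =>
    have hC := h.1
    have h1 := sq_step h (c 0) (η 0) S ((Fin m → S) × ι)
      (f := fun q => opG m (fun i => c i.succ) (fun i => kap κ (q.1 i) (η i.succ)) (f q.2))
      (fun q => opG_DD m _ _ (fun i => kap_RD κ _ _) (hf q.2))
    have h2 := ih (fun i => c i.succ) (fun i => η i.succ)
    rw [Fin.prod_univ_succ, ENNReal.ofReal_mul (by positivity), ENNReal.mul_rpow_of_nonneg _ _ (by linarith), mul_assoc]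
    refine le_trans (le_of_eq ?_) (h1.trans (mul_le_mul_right h2 _))
    congr 1; ext x
    congr 1
    let e : S × ((Fin m → S) × ι) ≃ (Fin (m + 1) → S) × ι :=
      (Equiv.prodAssoc _ _ _).symm.trans ((Fin.consEquiv fun _ => S).prodCongr (Equiv.refl ι))
    rw [← Equiv.sum_comp e]
    rfl

end ndim

end

open scoped BigOperators RealInnerProductSpace
open MeasureTheory

noncomputable section

set_option linter.unusedSectionVars false

section partition
open scoped FourierTransform SchwartzMap

/-- basic even cutoff -/
def chiB : ContDiffBump (0 : ℝ) := ⟨1, 2, by norm_num, by norm_num⟩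

def chi (x : ℝ) : ℝ := chiB x

lemma chi_smooth : ContDiff ℝ (⊤ : ℕ∞) chi := chiB.contDiff

lemma chi_even (x : ℝ) : chi (-x) = chi x := chiB.neg x

lemma chi_one {x : ℝ} (h : |x| ≤ 1) : chi x = 1 :=
  chiB.one_of_mem_closedBall (by rw [mem_closedBall_zero_iff]; exact h)

lemma chi_zero {x : ℝ} (h : 2 ≤ |x|) : chi x = 0 :=
  chiB.zero_of_le_dist (by rw [dist_zero_right]; exact h)

lemma chi_nonneg (x : ℝ) : 0 ≤ chi x := chiB.nonneg

lemma chi_le_one (x : ℝ) : chi x ≤ 1 := chiB.le_one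

def phi (x : ℝ) : ℝ := chi x - chi (2 * x)

lemma phi_smooth : ContDiff ℝ (⊤ : ℕ∞) phi := by
  unfold phi
  exact chi_smooth.sub (chi_smooth.comp (contDiff_const.mul contDiff_id))

lemma phi_supp {x : ℝ} (h : phi x ≠ 0) : 1 / 2 ≤ |x| ∧ |x| ≤ 2 := by
  constructor
  · by_contra hx
    push Not at hx
    apply h
    unfold phi
    rw [chi_one (by linarith), chi_one (by rw [abs_mul, abs_two]; linarith), sub_self]
  · by_contra hx
    push Not at hx
    apply h
    unfold phi
    rw [chi_zero (by linarith), chi_zero (by rw [abs_mul, abs_two]; linarith), sub_self]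

def SN (N : ℕ) : Finset ℤ := Finset.Icc (-(N:ℤ)) N

lemma phi_sum (N : ℕ) (x : ℝ) : ∑ k ∈ SN N, phi (x / 2 ^ k) = chi (x / 2 ^ N) - chi (2 ^ (N + 1) * x) := by
  induction N with
  | zero => simp [SN, phi]
  | succ N ih =>
    have : SN (N + 1) = insert ((N:ℤ) + 1) (insert (-((N:ℤ) + 1)) (SN N)) := by
      ext k; simp only [SN, Finset.mem_insert, Finset.mem_Icc]; push_cast; omega
    rw [this, Finset.sum_insert, Finset.sum_insert, ih]
    · have e1 : phi (x / 2 ^ ((N:ℤ) + 1)) = chi (x / 2 ^ (N + 1)) - chi (x / 2 ^ N) := by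
        unfold phi
        have : ((2:ℝ) ^ ((N:ℤ) + 1)) = 2 ^ (N + 1) := by
          rw [← zpow_natCast]; push_cast; rfl
        rw [this]
        congr 2
        rw [pow_succ]; field_simp
      have e2 : phi (x / 2 ^ (-((N:ℤ) + 1))) = chi (2 ^ (N + 1) * x) - chi (2 ^ (N + 1 + 1) * x) := by
        unfold phi
        have : ((2:ℝ) ^ (-((N:ℤ) + 1))) = (2 ^ (N + 1))⁻¹ := by
          rw [zpow_neg, ← zpow_natCast]; push_cast; rfl
        rw [this, div_inv_eq_mul]
        congr 2
        · ring
        · rw [pow_succ _ (N + 1)]; ring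
      rw [e1, e2]; ring
    · simp only [SN, Finset.mem_Icc]; omega
    · simp only [SN, Finset.mem_insert, Finset.mem_Icc]; omega

lemma phi_sum_abs (N : ℕ) (x : ℝ) : |∑ k ∈ SN N, phi (x / 2 ^ k)| ≤ 1 := by
  rw [phi_sum, abs_le]
  constructor <;> linarith [chi_nonneg (x / 2 ^ N), chi_nonneg (2 ^ (N + 1) * x),
    chi_le_one (x / 2 ^ N), chi_le_one (2 ^ (N + 1) * x)]

lemma phi_sum_tendsto {x : ℝ} (hx : x ≠ 0) :
    Filter.Tendsto (fun N => ∑ k ∈ SN N, phi (x / 2 ^ k)) Filter.atTop (nhds 1) := by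
  apply tendsto_const_nhds.congr'
  obtain ⟨N1, hN1⟩ := pow_unbounded_of_one_lt |x| (by norm_num : (1:ℝ) < 2)
  obtain ⟨N2, hN2⟩ := pow_unbounded_of_one_lt (2 / |x|) (by norm_num : (1:ℝ) < 2)
  have hx' : 0 < |x| := abs_pos.2 hx
  filter_upwards [Filter.eventually_ge_atTop (max N1 N2)] with N hN
  rw [phi_sum, chi_one, chi_zero, sub_zero]
  · rw [abs_mul, abs_of_pos (by positivity)]
    rw [div_lt_iff₀ hx'] at hN2
    have : (2:ℝ) ^ N2 ≤ 2 ^ (N + 1) := pow_le_pow_right₀ (by norm_num) (by omega)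
    nlinarith
  · rw [abs_div, abs_of_pos (by positivity : (0:ℝ) < 2 ^ N), div_le_one (by positivity)]
    exact hN1.le.trans (pow_le_pow_right₀ (by norm_num) (by omega))

def phit (x : ℝ) : ℂ := ((chi (x / 2) - chi (8 * x) : ℝ) : ℂ)

lemma phit_smooth : ContDiff ℝ (⊤ : ℕ∞) phit := by
  unfold phit
  exact Complex.ofRealCLM.contDiff.comp ((chi_smooth.comp (contDiff_id.div_const 2)).sub
    (chi_smooth.comp (contDiff_const.mul contDiff_id)))

lemma phit_supp {x : ℝ} (h : phit x ≠ 0) : 1 / 8 ≤ |x| ∧ |x| ≤ 4 := by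
  constructor
  · by_contra hx
    push Not at hx
    apply h
    unfold phit
    rw [chi_one (by rw [abs_div, abs_two]; linarith), chi_one (by rw [abs_mul, abs_of_pos (by norm_num : (0:ℝ) < 8)]; linarith), sub_self]
    rfl
  · by_contra hx
    push Not at hx
    apply h
    unfold phit
    rw [chi_zero (by rw [abs_div, abs_two]; linarith), chi_zero (by rw [abs_mul, abs_of_pos (by norm_num : (0:ℝ) < 8)]; linarith), sub_self]
    rfl

lemma phit_one {x : ℝ} (h : phi x ≠ 0) : phit x = 1 := by
  obtain ⟨h1, h2⟩ := phi_supp h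
  unfold phit
  rw [chi_one (by rw [abs_div, abs_two]; linarith),
    chi_zero (by rw [abs_mul, abs_of_pos (by norm_num : (0:ℝ) < 8)]; linarith)]
  simp

lemma phit_even (x : ℝ) : phit (-x) = phit x := by
  unfold phit
  rw [neg_div, mul_neg, chi_even, chi_even]

lemma phit_compact : HasCompactSupport phit := by
  apply HasCompactSupport.intro (K := Set.Icc (-4) 4) isCompact_Icc
  intro x hx
  by_contra h
  exact hx (abs_le.1 (phit_supp h).2)

def kapS : 𝓢(ℝ, ℂ) := 𝓕⁻ (phit_compact.toSchwartzMap phit_smooth)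

lemma kapS_fourier : 𝓕 (kapS : ℝ → ℂ) = phit := by
  rw [← SchwartzMap.fourier_coe]
  unfold kapS
  rw [FourierTransform.fourier_fourierInv_eq]
  rfl

lemma kapS_even (t : ℝ) : kapS (-t) = kapS t := by
  unfold kapS
  rw [SchwartzMap.fourierInv_coe]
  have e : ((phit_compact.toSchwartzMap phit_smooth : 𝓢(ℝ, ℂ)) : ℝ → ℂ) = phit := rfl
  rw [e, Real.fourierInv_eq_fourier_neg, neg_neg, Real.fourierInv_eq_fourier_comp_neg]
  simp_rw [phit_even]

lemma kapS_bound (ξ : ℝ) : ‖𝓕 (kapS : ℝ → ℂ) ξ‖ ^ 2 ≤ 8 * min |ξ| (|ξ|⁻¹) := by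
  rw [kapS_fourier]
  by_cases h : phit ξ = 0
  · rw [h]; simp
  · obtain ⟨h1, h2⟩ := phit_supp h
    have h3 : ‖phit ξ‖ ≤ 1 := by
      unfold phit
      rw [Complex.norm_real, Real.norm_eq_abs, abs_le]
      constructor <;> linarith [chi_nonneg (ξ / 2), chi_nonneg (8 * ξ), chi_le_one (ξ / 2), chi_le_one (8 * ξ)]
    have h4 : ‖phit ξ‖ ^ 2 ≤ 1 := pow_le_one₀ (norm_nonneg _) h3
    refine h4.trans ?_
    have h5 : (1:ℝ) / 8 ≤ min |ξ| (|ξ|⁻¹) := by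
      apply le_min h1
      rw [inv_eq_one_div, div_le_div_iff₀ (by norm_num) (by linarith)]
      linarith
    linarith

lemma kap_neg (k : ℤ) (η t : ℝ) : kap kapS k η (-t) = kap kapS k (-η) t := by
  unfold kap
  rw [← kapS_even]
  congr 2
  ring

lemma sq_kapS {p : ℝ} (hp : 1 < p) : ∃ C, SQ1 kapS p C := by
  obtain ⟨C, hC, h⟩ := sq1 kapS kapS_bound hp
  exact ⟨C, hC, h⟩

end partition

end

open scoped BigOperators RealInnerProductSpace
open MeasureTheory

noncomputable section

set_option linter.unusedSectionVars false

section decay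
open scoped FourierTransform SchwartzMap LineDeriv

lemma line_iter {V : Type*} [NormedAddCommGroup V] [NormedSpace ℝ V] {U : Set V} (hU : IsOpen U)
    {f : V → ℂ} (hf : ContDiffOn ℝ (⊤ : ℕ∞) f U) (e : V) (l : ℕ) :
    ContDiffOn ℝ (⊤ : ℕ∞) ((fun (h : V → ℂ) z => fderiv ℝ h z e)^[l] f) U ∧
    ∀ (z : V) (t : ℝ), z + t • e ∈ U →
      ((fun (h : V → ℂ) z => fderiv ℝ h z e)^[l] f) (z + t • e) =
        iteratedDeriv l (fun s : ℝ => f (z + s • e)) t := by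
  induction l with
  | zero => exact ⟨hf, fun z t _ => by simp⟩
  | succ l ih =>
    obtain ⟨ih1, ih2⟩ := ih
    rw [Function.iterate_succ_apply']
    set h := ((fun (h : V → ℂ) z => fderiv ℝ h z e)^[l] f)
    refine ⟨(ih1.fderiv_of_isOpen hU (by simp)).clm_apply contDiffOn_const, fun z t hz => ?_⟩
    rw [iteratedDeriv_succ]
    have hev : (iteratedDeriv l fun s : ℝ => f (z + s • e)) =ᶠ[nhds t] fun s => h (z + s • e) := by
      have ho : IsOpen ((fun s : ℝ => z + s • e) ⁻¹' U) := hU.preimage (by fun_prop)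
      filter_upwards [ho.mem_nhds hz] with s hs
      exact (ih2 z s hs).symm
    rw [hev.deriv_eq]
    have hd : DifferentiableAt ℝ h (z + t • e) :=
      (ih1.differentiableOn (by simp)).differentiableAt (hU.mem_nhds hz)
    have hl : HasDerivAt (fun s : ℝ => z + s • e) e t := by
      simpa using ((hasDerivAt_id t).smul_const e).const_add z
    exact (hd.hasFDerivAt.comp_hasDerivAt t hl).deriv.symm

variable {J : Type} [Fintype J]

lemma schwartz_lineDeriv_iter {V : Type*} [NormedAddCommGroup V] [NormedSpace ℝ V] (g : 𝓢(V, ℂ)) (e : V) (l : ℕ) :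
    (((fun h : 𝓢(V, ℂ) => ∂_{e} h)^[l] g : 𝓢(V, ℂ)) : V → ℂ) =
      (fun (h : V → ℂ) z => fderiv ℝ h z e)^[l] g := by
  induction l with
  | zero => rfl
  | succ l ih =>
    rw [Function.iterate_succ_apply', Function.iterate_succ_apply', ← ih]
    ext z
    exact SchwartzMap.lineDerivOp_apply_eq_fderiv _ _ _

lemma schwartz_fourier_iter (g : 𝓢(EuclideanSpace ℝ J, ℂ)) (e : EuclideanSpace ℝ J) (l : ℕ)
    (w : EuclideanSpace ℝ J) :
    𝓕 ((fun h : 𝓢(EuclideanSpace ℝ J, ℂ) => ∂_{e} h)^[l] g) w = (2 * Real.pi * Complex.I * (⟪w, e⟫ : ℝ)) ^ l * 𝓕 g w := by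
  induction l with
  | zero => simp
  | succ l ih =>
    rw [Function.iterate_succ_apply', SchwartzMap.fourier_lineDerivOp_eq]
    have : (inner ℝ · e : EuclideanSpace ℝ J → ℝ).HasTemperateGrowth := by fun_prop
    rw [smul_apply, SchwartzMap.smulLeftCLM_apply_apply this, ih]
    simp only [smul_eq_mul, Complex.real_smul]
    ring

lemma four_bound_gen {V : Type*} [NormedAddCommGroup V] [InnerProductSpace ℝ V] [FiniteDimensional ℝ V]
    [MeasurableSpace V] [BorelSpace V] (f : V → ℂ) (w : V) : ‖𝓕 f w‖ ≤ ∫ v, ‖f v‖ := by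
  rw [Real.fourier_eq]
  refine (norm_integral_le_integral_norm _).trans (le_of_eq ?_)
  simp

lemma int_bound {V : Type*} [NormedAddCommGroup V] [InnerProductSpace ℝ V] [FiniteDimensional ℝ V]
    [MeasurableSpace V] [BorelSpace V] (h : 𝓢(V, ℂ)) {R M : ℝ}
    (hs : ∀ z, z ∉ Metric.closedBall (0 : V) R → h z = 0) (hM : ∀ z, ‖h z‖ ≤ M) (w : V) :
    ‖𝓕 h w‖ ≤ M * (volume (Metric.closedBall (0 : V) R)).toReal := by
  rw [SchwartzMap.fourier_coe]
  refine (four_bound_gen h w).trans ?_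
  rw [← setIntegral_eq_integral_of_forall_compl_eq_zero (s := Metric.closedBall (0 : V) R)
    (fun z hz => by rw [hs z hz, norm_zero])]
  refine (le_abs_self _).trans ?_
  rw [← Real.norm_eq_abs]
  exact norm_setIntegral_le_of_norm_le_const (isCompact_closedBall _ _).measure_lt_top
    (fun z _ => by rw [norm_norm]; exact hM z)

lemma decay_max (w : EuclideanSpace ℝ J) {D y : ℝ} (hy : 0 ≤ y) (l : ℕ) (h0 : y ≤ D) (h : ∀ i, |w i| ^ l * y ≤ D) :
    y * (1 + ‖w‖) ^ l ≤ (1 + Fintype.card J) ^ l * D := by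
  have hn : ‖w‖ ≤ ∑ i, |w i| := by
    apply le_of_sq_le_sq _ (by positivity)
    rw [EuclideanSpace.norm_sq_eq]
    exact Finset.sum_sq_le_sq_sum_of_nonneg fun i _ => norm_nonneg _
  have key : ∀ b : ℝ, 1 ≤ b → (∀ i, |w i| ≤ b) → b ^ l * y ≤ D → y * (1 + ‖w‖) ^ l ≤ (1 + Fintype.card J) ^ l * D := by
    intro b hb hi hD
    have h1 : 1 + ‖w‖ ≤ (1 + Fintype.card J) * b := by
      have : ∑ i, |w i| ≤ ∑ i : J, b := Finset.sum_le_sum fun i _ => hi i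
      rw [Finset.sum_const, Finset.card_univ, nsmul_eq_mul] at this
      linarith
    calc y * (1 + ‖w‖) ^ l ≤ y * ((1 + Fintype.card J) * b) ^ l := by gcongr
      _ = (1 + Fintype.card J) ^ l * (b ^ l * y) := by rw [mul_pow]; ring
      _ ≤ _ := by gcongr
  by_cases hall : ∀ i, |w i| ≤ 1
  · exact key 1 le_rfl hall (by simpa using h0)
  · push Not at hall
    obtain ⟨i, hi⟩ := hall
    have : Nonempty J := ⟨i⟩
    obtain ⟨i0, hi0⟩ := Finite.exists_max fun i => |w i|
    exact key _ (hi.le.trans (hi0 i)) hi0 (h i0)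

/-- Uniform Fourier decay from pure derivative bounds. -/
lemma fourier_decay [DecidableEq J] (R : ℝ) (l : ℕ) : ∃ C : ℝ, 0 < C ∧ ∀ (g : 𝓢(EuclideanSpace ℝ J, ℂ)) (M : ℝ),
    (∀ z, z ∉ Metric.closedBall (0 : EuclideanSpace ℝ J) R → g z = 0) → (∀ z, ‖g z‖ ≤ M) →
    (∀ i z, ‖iteratedDeriv l (fun t : ℝ => g (z + t • EuclideanSpace.single i 1)) 0‖ ≤ M) →
    ∀ w, ‖𝓕 (g : EuclideanSpace ℝ J → ℂ) w‖ * (1 + ‖w‖) ^ l ≤ C * M := by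
  set v := (volume (Metric.closedBall (0 : EuclideanSpace ℝ J) R)).toReal with hv
  refine ⟨(1 + Fintype.card J) ^ l * (v + 1), by positivity, fun g M hs hM hd w => ?_⟩
  have hM0 : 0 ≤ M := (norm_nonneg _).trans (hM 0)
  rw [← SchwartzMap.fourier_coe, mul_assoc]
  apply decay_max _ (norm_nonneg _)
  · refine (int_bound g hs hM w).trans ?_
    rw [← hv]; nlinarith
  · intro i
    set e : EuclideanSpace ℝ J := EuclideanSpace.single i 1 with he
    have h1 := schwartz_fourier_iter g e l w
    have h2 : ⟪w, e⟫ = w i := by simp [he, EuclideanSpace.inner_single_right]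
    have h3 : ‖𝓕 ((fun h : 𝓢(EuclideanSpace ℝ J, ℂ) => ∂_{e} h)^[l] g) w‖ ≤ M * v := by
      apply int_bound
      · intro z hz
        rw [schwartz_lineDeriv_iter]
        have hloc : (g : EuclideanSpace ℝ J → ℂ) =ᶠ[nhds z] fun _ => 0 := by
          filter_upwards [(Metric.isClosed_closedBall.isOpen_compl).mem_nhds hz] with y hy
          exact hs y hy
        have := (line_iter isOpen_univ (g.smooth ⊤).contDiffOn e l).2 z 0 (Set.mem_univ _)
        rw [zero_smul, add_zero] at this
        rw [this]
        have hc : Filter.Tendsto (fun s : ℝ => z + s • e) (nhds 0) (nhds z) := by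
          have : Continuous fun s : ℝ => z + s • e := by fun_prop
          simpa using this.tendsto 0
        have hx : (fun s : ℝ => g (z + s • e)) =ᶠ[nhds 0] fun _ => 0 := hc.eventually hloc
        rw [hx.iteratedDeriv_eq l]
        simp
      · intro z
        rw [schwartz_lineDeriv_iter]
        have := (line_iter isOpen_univ (g.smooth ⊤).contDiffOn e l).2 z 0 (Set.mem_univ _)
        rw [zero_smul, add_zero] at this
        rw [this]
        exact hd i z
    rw [h1, norm_mul, norm_pow, h2] at h3
    have h4 : |w i| ≤ ‖(2 * Real.pi * Complex.I * (w i : ℝ) : ℂ)‖ := by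
      simp only [norm_mul, Complex.norm_real, Complex.norm_I, Complex.norm_ofNat, Real.norm_eq_abs, mul_one]
      rw [abs_of_pos Real.pi_pos]
      nlinarith [Real.pi_gt_three, abs_nonneg (w i)]
    calc |w i| ^ l * ‖𝓕 g w‖ ≤ ‖(2 * Real.pi * Complex.I * (w i : ℝ) : ℂ)‖ ^ l * ‖𝓕 g w‖ := by gcongr
      _ ≤ M * v := h3
      _ ≤ _ := by nlinarith

end decay

end

open scoped BigOperators RealInnerProductSpace
open MeasureTheory

noncomputable section

set_option linter.unusedSectionVars false

section pieces
open scoped FourierTransform SchwartzMap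

variable {d : ℕ}

lemma foldr_single_aux {α : Type*} (T : Fin d → α → α) (j : Fin d) (l : ℕ) (f : α) (L : List (Fin d))
    (hL : L.Nodup) :
    L.foldr (fun i g => (T i)^[(Pi.single j l : Fin d → ℕ) i] g) f = if j ∈ L then (T j)^[l] f else f := by
  induction L with
  | nil => simp
  | cons b L ih =>
    rw [List.nodup_cons] at hL
    rw [List.foldr_cons, ih hL.2]
    by_cases hb : b = j
    · subst hb
      simp [hL.1]
    · have : j ≠ b := fun h => hb h.symm
      simp [Pi.single_eq_of_ne hb, this]

lemma foldr_zero_aux {α : Type*} (T : Fin d → α → α) (f : α) (L : List (Fin d)) :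
    L.foldr (fun i g => (T i)^[(0 : Fin d → ℕ) i] g) f = f := by
  induction L with
  | nil => simp
  | cons b L ih => rw [List.foldr_cons, ih]; simp

lemma xpd_iter (j : Fin d) (l : ℕ) (a : Euc d → Euc d → ℂ) (x ξ : Euc d) :
    (xpd j)^[l] a x ξ = (fun (h : Euc d → ℂ) z => fderiv ℝ h z (EuclideanSpace.single j 1))^[l] (fun y => a y ξ) x := by
  induction l generalizing x with
  | zero => rfl
  | succ l ih =>
    rw [Function.iterate_succ_apply', Function.iterate_succ_apply']
    unfold xpd at ih ⊢
    congr 2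
    ext y
    exact ih y

lemma smpd_x (j : Fin d) (l : ℕ) (a : Euc d → Euc d → ℂ) (x ξ : Euc d) :
    smpd 0 (Pi.single j l) a x ξ =
      (fun (h : Euc d → ℂ) z => fderiv ℝ h z (EuclideanSpace.single j 1))^[l] (fun y => a y ξ) x := by
  unfold smpd mpd xmpd
  rw [foldr_zero_aux, foldr_single_aux _ _ _ _ _ (List.nodup_finRange d), if_pos (List.mem_finRange j), xpd_iter]

lemma smpd_xi (j : Fin d) (l : ℕ) (a : Euc d → Euc d → ℂ) (x ξ : Euc d) :
    smpd (Pi.single j l) 0 a x ξ =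
      (fun (h : Euc d → ℂ) z => fderiv ℝ h z (EuclideanSpace.single j 1))^[l] (a x) ξ := by
  unfold smpd mpd xmpd
  rw [foldr_zero_aux, foldr_single_aux _ _ _ _ _ (List.nodup_finRange d), if_pos (List.mem_finRange j)]
  rfl

lemma smpd_zero (a : Euc d → Euc d → ℂ) (x ξ : Euc d) : smpd 0 0 a x ξ = a x ξ := by
  unfold smpd mpd xmpd
  rw [foldr_zero_aux, foldr_zero_aux]

lemma leib {f g : ℝ → ℂ} (l : ℕ) {A B : ℝ} (hf : ContDiffAt ℝ l f 0) (hg : ContDiffAt ℝ l g 0)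
    (hA : ∀ i ≤ l, ‖iteratedDeriv i f 0‖ ≤ A) (hB : ∀ i ≤ l, ‖iteratedDeriv i g 0‖ ≤ B) :
    ‖iteratedDeriv l (fun t => f t * g t) 0‖ ≤ 2 ^ l * (A * B) := by
  have hA0 : 0 ≤ A := (norm_nonneg _).trans (hA 0 (by simp))
  rw [iteratedDeriv_fun_mul hf hg]
  refine (norm_sum_le _ _).trans ?_
  have h2 : (2 : ℝ) ^ l = ∑ i ∈ Finset.range (l + 1), (l.choose i : ℝ) := by
    exact_mod_cast (Nat.sum_range_choose l).symm
  rw [h2, Finset.sum_mul]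
  refine Finset.sum_le_sum fun i hi => ?_
  rw [norm_mul, norm_mul, Complex.norm_natCast, mul_assoc]
  have hil : i ≤ l := Nat.lt_succ_iff.mp (Finset.mem_range.mp hi)
  gcongr
  · exact hA i hil
  · exact hB _ (Nat.sub_le _ _)

/-- uniform constants over finitely many indices -/
lemma unif_const {ι : Type*} [Fintype ι] {X : ι → Type*} {f : ∀ i, X i → ℝ}
    (h : ∀ i, ∃ M, ∀ x, f i x ≤ M) : ∃ M, 0 ≤ M ∧ ∀ i x, f i x ≤ M := by
  choose M hM using h
  refine ⟨∑ i, |M i|, by positivity, fun i x => (hM i x).trans ((le_abs_self _).trans ?_)⟩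
  exact Finset.single_le_sum (f := fun i => |M i|) (fun i _ => abs_nonneg _) (Finset.mem_univ i)

lemma unif_le {X : Type*} (l : ℕ) {f : ℕ → X → ℝ}
    (h : ∀ i, ∃ M, ∀ x, f i x ≤ M) : ∃ M, 0 ≤ M ∧ ∀ i ≤ l, ∀ x, f i x ≤ M := by
  choose M hM using h
  refine ⟨∑ i ∈ Finset.range (l + 1), |M i|, by positivity, fun i hi x => (hM i x).trans ((le_abs_self _).trans ?_)⟩
  exact Finset.single_le_sum (f := fun i => |M i|) (fun i _ => abs_nonneg _) (Finset.mem_range.2 (Nat.lt_succ_of_le hi))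

abbrev VV (d : ℕ) := EuclideanSpace ℝ (Fin d ⊕ Fin d)

def Xz (z : VV d) : Euc d := WithLp.toLp 2 fun j => z (Sum.inl j)
def Az (k : Fin d → ℤ) (z : VV d) : Euc d := WithLp.toLp 2 fun j => 2 * Real.pi * 2 ^ k j * z (Sum.inr j)

lemma Xz_smooth : ContDiff ℝ (⊤ : ℕ∞) (Xz : VV d → Euc d) := by
  rw [contDiff_euclidean]
  intro j
  simp only [Xz]
  fun_prop

lemma Az_smooth (k : Fin d → ℤ) : ContDiff ℝ (⊤ : ℕ∞) (Az k : VV d → Euc d) := by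
  rw [contDiff_euclidean]
  intro j
  simp only [Az]
  fun_prop

def GG (ψ : Euc d → ℂ) (a : Euc d → Euc d → ℂ) (k : Fin d → ℤ) (z : VV d) : ℂ :=
  ψ (Xz z) * (∏ j, (phi (z (Sum.inr j)) : ℂ)) * a (Xz z) (Az k z)

lemma phiC_smooth : ContDiff ℝ (⊤ : ℕ∞) (fun t => (phi t : ℂ)) :=
  Complex.ofRealCLM.contDiff.comp phi_smooth

lemma phi_abs (x : ℝ) : |phi x| ≤ 1 := by
  unfold phi
  rw [abs_le]
  constructor <;> linarith [chi_nonneg x, chi_le_one x, chi_nonneg (2 * x), chi_le_one (2 * x)]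

lemma phiC_norm (x : ℝ) : ‖(phi x : ℂ)‖ ≤ 1 := by
  rw [Complex.norm_real]; exact phi_abs x


lemma GG_smooth {Ω : Set (Euc d)} (hΩ : IsOpen Ω) {ψ : Euc d → ℂ} (hψ : ContDiff ℝ (⊤ : ℕ∞) ψ)
  (hψΩ : tsupport ψ ⊆ Ω) {a : Euc d → Euc d → ℂ}
  (ha : ContDiffOn ℝ (⊤ : ℕ∞) (fun p : Euc d × Euc d => a p.1 p.2) (Ω ×ˢ Set.univ))
    (k : Fin d → ℤ) : ContDiff ℝ (⊤ : ℕ∞) (GG ψ a k) := by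
  rw [contDiff_iff_contDiffAt]
  intro z
  by_cases hz : Xz z ∈ tsupport ψ
  · have h1 : ContDiffAt ℝ (⊤ : ℕ∞) (fun p : Euc d × Euc d => a p.1 p.2) (Xz z, Az k z) :=
      ha.contDiffAt ((hΩ.prod isOpen_univ).mem_nhds ⟨hψΩ hz, Set.mem_univ _⟩)
    have h2 : ContDiffAt ℝ (⊤ : ℕ∞) (fun z : VV d => a (Xz z) (Az k z)) z :=
      ContDiffAt.comp z (g := fun p : Euc d × Euc d => a p.1 p.2) (f := fun z => (Xz z, Az k z)) h1
        ((Xz_smooth.prodMk (Az_smooth k)).contDiffAt)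
    have h3 : ContDiff ℝ (⊤ : ℕ∞) (fun z : VV d => ∏ j, (phi (z (Sum.inr j)) : ℂ)) := by
      apply contDiff_prod
      intro j _
      exact phiC_smooth.comp (by fun_prop)
    exact ((hψ.comp Xz_smooth).mul h3).contDiffAt.mul h2
  · have : GG ψ a k =ᶠ[nhds z] fun _ => 0 := by
      have ho : IsOpen (Xz ⁻¹' (tsupport ψ)ᶜ : Set (VV d)) :=
        (isClosed_tsupport ψ).isOpen_compl.preimage Xz_smooth.continuous
      filter_upwards [ho.mem_nhds hz] with y hy
      have : ψ (Xz y) = 0 := image_eq_zero_of_notMem_tsupport hy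
      simp [GG, this]
    exact contDiffAt_const.congr_of_eventuallyEq this

lemma GG_supp {ψ : Euc d → ℂ} (hψc : HasCompactSupport ψ) {a : Euc d → Euc d → ℂ} : ∃ R : ℝ, ∀ k (z : VV d), z ∉ Metric.closedBall (0 : VV d) R → GG ψ a k z = 0 := by
  obtain ⟨R, hR⟩ := hψc.isCompact.isBounded.exists_norm_le
  refine ⟨Real.sqrt (R ^ 2 + 4 * d), fun k z hz => ?_⟩
  by_contra h
  apply hz
  rw [mem_closedBall_zero_iff]
  apply Real.le_sqrt_of_sq_le
  unfold GG at h
  have h1 : ψ (Xz z) ≠ 0 := fun h' => h (by simp [h'])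
  have h2 : ∀ j, |z (Sum.inr j)| ≤ 2 := by
    intro j
    refine (phi_supp (x := z (Sum.inr j)) fun h' => h ?_).2
    rw [Finset.prod_eq_zero (Finset.mem_univ j) (by simp [h'])]
    simp
  have h3 := hR _ (subset_tsupport ψ h1)
  have h4 : ‖Xz z‖ ^ 2 ≤ R ^ 2 := by gcongr
  rw [EuclideanSpace.norm_sq_eq] at h4 ⊢
  rw [Fintype.sum_sum_type]
  have h5 : ∑ j : Fin d, ‖z (Sum.inr j)‖ ^ 2 ≤ ∑ j : Fin d, (4 : ℝ) := by
    apply Finset.sum_le_sum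
    intro j _
    have := h2 j
    rw [Real.norm_eq_abs]
    nlinarith [abs_nonneg (z (Sum.inr j))]
  simp only [Finset.sum_const, Finset.card_univ, Fintype.card_fin, nsmul_eq_mul] at h5
  have : ∑ x, ‖(Xz z) x‖ ^ 2 = ∑ j : Fin d, ‖z (Sum.inl j)‖ ^ 2 := rfl
  linarith

lemma prod_phi_le (z : Fin d → ℝ) : ‖∏ j, (phi (z j) : ℂ)‖ ≤ 1 := by
  rw [norm_prod]
  exact Finset.prod_le_one (fun _ _ => norm_nonneg _) fun _ _ => phiC_norm _

lemma GG_bd {ψ : Euc d → ℂ} (hψ : ContDiff ℝ (⊤ : ℕ∞) ψ)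
  (hψc : HasCompactSupport ψ) {a : Euc d → Euc d → ℂ}
    {c : ℝ} (hc : ∀ x ∈ tsupport ψ, ∀ ξ, ‖a x ξ‖ ≤ c) :
    ∃ M : ℝ, ∀ k (z : VV d), ‖GG ψ a k z‖ ≤ M := by
  obtain ⟨B, hB⟩ := hψc.exists_bound_of_continuous hψ.continuous
  have hB0 : 0 ≤ B := (norm_nonneg _).trans (hB 0)
  refine ⟨B * 1 * |c|, fun k z => ?_⟩
  by_cases hz : Xz z ∈ tsupport ψ
  · unfold GG
    rw [norm_mul, norm_mul]
    gcongr
    · exact hB _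
    · exact prod_phi_le _
    · exact (hc _ hz _).trans (le_abs_self _)
  · have : ψ (Xz z) = 0 := image_eq_zero_of_notMem_tsupport hz
    simp only [GG, this, zero_mul, norm_zero]
    positivity

lemma line_iter0 {V : Type*} [NormedAddCommGroup V] [NormedSpace ℝ V] {U : Set V} (hU : IsOpen U)
    {f : V → ℂ} (hf : ContDiffOn ℝ (⊤ : ℕ∞) f U) (e : V) (l : ℕ) {z : V} (hz : z ∈ U) :
      iteratedDeriv l (fun s : ℝ => f (z + s • e)) 0 = ((fun (h : V → ℂ) z => fderiv ℝ h z e)^[l] f) z := by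
  have := (line_iter hU hf e l).2 z 0 (by simpa using hz)
  rw [zero_smul, add_zero] at this
  exact this.symm

lemma GG_dx {Ω : Set (Euc d)} (hΩ : IsOpen Ω) {ψ : Euc d → ℂ} (hψ : ContDiff ℝ (⊤ : ℕ∞) ψ)
  (hψc : HasCompactSupport ψ) (hψΩ : tsupport ψ ⊆ Ω) {a : Euc d → Euc d → ℂ}
  (ha : ContDiffOn ℝ (⊤ : ℕ∞) (fun p : Euc d × Euc d => a p.1 p.2) (Ω ×ˢ Set.univ))
    (hb : ∀ (j : Fin d) (l : ℕ), ∃ c, ∀ x ∈ tsupport ψ, ∀ ξ, ‖smpd 0 (Pi.single j l) a x ξ‖ ≤ c)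
    (j : Fin d) (l : ℕ) : ∃ M : ℝ, ∀ (kz : (Fin d → ℤ) × VV d),
      ‖iteratedDeriv l (fun t : ℝ => GG ψ a kz.1 (kz.2 + t • EuclideanSpace.single (Sum.inl j) 1)) 0‖ ≤ M := by
  set e : Euc d := EuclideanSpace.single j 1 with he
  have hA := unif_le (X := tsupport ψ) l (f := fun i x => ‖iteratedDeriv i (fun s : ℝ => ψ (x + s • e)) 0‖) (by
    intro i
    have hc := (line_iter isOpen_univ hψ.contDiffOn e i).1.continuousOn
    obtain ⟨C, hC⟩ := hψc.isCompact.exists_bound_of_continuousOn (hc.mono (Set.subset_univ _))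
    refine ⟨C, fun x => ?_⟩
    rw [line_iter0 isOpen_univ hψ.contDiffOn e i (Set.mem_univ _)]
    exact hC x x.2)
  have hsm : ∀ ξ, ContDiffOn ℝ (⊤ : ℕ∞) (fun y => a y ξ) Ω := by
    intro ξ
    exact ha.comp (g := fun p : Euc d × Euc d => a p.1 p.2) (f := fun y => (y, ξ))
      (contDiff_id.prodMk contDiff_const).contDiffOn (fun y hy => ⟨hy, Set.mem_univ _⟩)
  have hB := unif_le (X := tsupport ψ × Euc d) l
    (f := fun i x => ‖iteratedDeriv i (fun s : ℝ => a (x.1 + s • e) x.2) 0‖) (by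
    intro i
    obtain ⟨C, hC⟩ := hb j i
    refine ⟨C, fun x => ?_⟩
    rw [line_iter0 hΩ (hsm x.2) e i (hψΩ x.1.2), ← smpd_x]
    exact hC _ x.1.2 _)
  obtain ⟨A, hA0, hA⟩ := hA
  obtain ⟨B, hB0, hB⟩ := hB
  refine ⟨1 * (2 ^ l * (A * B)), fun kz => ?_⟩
  obtain ⟨k, z⟩ := kz
  have hX : ∀ t : ℝ, Xz (z + t • EuclideanSpace.single (Sum.inl j) 1) = Xz z + t • e := by
    intro t; ext i; simp [Xz, he, Pi.single_apply]
  have hY : ∀ (t : ℝ) i, (z + t • EuclideanSpace.single (Sum.inl j) (1:ℝ) : VV d) (Sum.inr i) = z (Sum.inr i) := by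
    intro t i; simp
  have hfun : (fun t : ℝ => GG ψ a k (z + t • EuclideanSpace.single (Sum.inl j) 1)) =
      fun t => (∏ i, (phi (z (Sum.inr i)) : ℂ)) * (ψ (Xz z + t • e) * a (Xz z + t • e) (Az k z)) := by
    ext t
    have : Az k (z + t • EuclideanSpace.single (Sum.inl j) (1:ℝ)) = Az k z := by
      unfold Az; simp only [hY]
    simp only [GG, hX, hY, this]
    ring
  dsimp only
  rw [hfun]
  by_cases hz : Xz z ∈ tsupport ψ
  · have hline : ContDiff ℝ (⊤ : ℕ∞) (fun t : ℝ => Xz z + t • e) := by fun_prop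
    rw [iteratedDeriv_const_mul_field, norm_mul]
    gcongr
    · exact prod_phi_le _
    · apply leib l _ _ (fun i hi => hA i hi ⟨_, hz⟩) (fun i hi => hB i hi (⟨_, hz⟩, _))
      · have h1 : ContDiff ℝ (⊤ : ℕ∞) (fun t : ℝ => ψ (Xz z + t • e)) := hψ.comp hline
        refine h1.contDiffAt.of_le ?_
        exact_mod_cast le_top
      · have h1 : ContDiffAt ℝ (⊤ : ℕ∞) (fun y => a y (Az k z)) (Xz z + (0:ℝ) • e) := by
          rw [zero_smul, add_zero]
          exact (hsm _).contDiffAt (hΩ.mem_nhds (hψΩ hz))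
        refine (ContDiffAt.comp (0:ℝ) h1 hline.contDiffAt).of_le ?_
        exact_mod_cast le_top
  · have hx : (fun t : ℝ => (∏ i, (phi (z (Sum.inr i)) : ℂ)) * (ψ (Xz z + t • e) * a (Xz z + t • e) (Az k z)))
        =ᶠ[nhds 0] fun _ => 0 := by
      have ho : IsOpen ((fun t : ℝ => Xz z + t • e) ⁻¹' (tsupport ψ)ᶜ) :=
        (isClosed_tsupport ψ).isOpen_compl.preimage (by fun_prop)
      filter_upwards [ho.mem_nhds (by simpa using hz)] with t ht
      have : ψ (Xz z + t • e) = 0 := image_eq_zero_of_notMem_tsupport ht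
      rw [this]; ring
    rw [hx.iteratedDeriv_eq l]
    simp
    positivity

lemma GG_dxi {Ω : Set (Euc d)} (hΩ : IsOpen Ω) {ψ : Euc d → ℂ} (hψ : ContDiff ℝ (⊤ : ℕ∞) ψ)
  (hψc : HasCompactSupport ψ) (hψΩ : tsupport ψ ⊆ Ω) {a : Euc d → Euc d → ℂ}
  (ha : ContDiffOn ℝ (⊤ : ℕ∞) (fun p : Euc d × Euc d => a p.1 p.2) (Ω ×ˢ Set.univ))
    {Λ : Fin d → Euc d → ℝ} {c0 : ℝ} (hc0 : 0 < c0) (hΛ0 : ∀ j ξ, 0 < Λ j ξ)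
    (hM : ∀ j (ξ : Euc d), c0 * |ξ j| ≤ Λ j ξ)
    (hb : ∀ (j : Fin d) (l : ℕ), ∃ c, ∀ x ∈ tsupport ψ, ∀ ξ, ‖smpd (Pi.single j l) 0 a x ξ‖ ≤ c * (Λ j ξ ^ l)⁻¹)
    (j : Fin d) (l : ℕ) : ∃ M : ℝ, ∀ (kz : (Fin d → ℤ) × VV d),
      ‖iteratedDeriv l (fun t : ℝ => GG ψ a kz.1 (kz.2 + t • EuclideanSpace.single (Sum.inr j) 1)) 0‖ ≤ M := by
  set e : Euc d := EuclideanSpace.single j 1 with he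
  have hsm : ∀ x ∈ Ω, ContDiff ℝ (⊤ : ℕ∞) (a x) := by
    intro x hx
    rw [← contDiffOn_univ]
    exact ha.comp (g := fun p : Euc d × Euc d => a p.1 p.2) (f := fun y => (x, y))
      (contDiff_const.prodMk contDiff_id).contDiffOn (fun y hy => ⟨hx, Set.mem_univ _⟩)
  obtain ⟨P, hP⟩ := hψc.exists_bound_of_continuous hψ.continuous
  have hP0 : 0 ≤ P := (norm_nonneg _).trans (hP 0)
  have hA := unif_le (X := Set.Icc (-2:ℝ) 2) l (f := fun i x => ‖iteratedDeriv i (fun s : ℝ => (phi (x + s) : ℂ)) 0‖) (by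
    intro i
    have hc : Continuous (iteratedDeriv i (fun s : ℝ => (phi s : ℂ))) :=
      phiC_smooth.continuous_iteratedDeriv i (by exact_mod_cast le_top)
    obtain ⟨C, hC⟩ := (isCompact_Icc (a := (-2:ℝ)) (b := 2)).exists_bound_of_continuousOn hc.continuousOn
    refine ⟨C, fun x => ?_⟩
    rw [iteratedDeriv_comp_const_add i (fun s : ℝ => (phi s : ℂ))]
    simpa using hC x x.2)
  have hB := unif_le (X := {q : Euc d × Euc d × (Fin d → ℤ) × ℝ // q.1 ∈ tsupport ψ ∧ 1 / 2 ≤ |q.2.2.2| ∧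
      q.2.1 j = 2 * Real.pi * 2 ^ q.2.2.1 j * q.2.2.2}) l
    (f := fun i q => ‖iteratedDeriv i (fun s : ℝ => a q.1.1 (q.1.2.1 + ((2 * Real.pi * 2 ^ q.1.2.2.1 j) * s) • e)) 0‖) (by
    intro i
    obtain ⟨C, hC⟩ := hb j i
    refine ⟨|C| * (2 / c0) ^ i, fun q => ?_⟩
    obtain ⟨⟨x, ξ, k, ζ⟩, hx, hζ, hξ⟩ := q
    dsimp only at hx hζ hξ ⊢
    have hr : 0 < 2 * Real.pi * (2:ℝ) ^ k j := by positivity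
    set r := 2 * Real.pi * (2:ℝ) ^ k j
    have hl : ContDiff ℝ i (fun t : ℝ => a x (ξ + t • e)) :=
      ((hsm x (hψΩ hx)).comp (f := fun t : ℝ => ξ + t • e) (by fun_prop)).of_le (by exact_mod_cast le_top)
    rw [iteratedDeriv_comp_const_smul (f := fun t : ℝ => a x (ξ + t • e)) hl r]
    dsimp only
    rw [mul_zero, line_iter0 isOpen_univ (hsm x (hψΩ hx)).contDiffOn e i (Set.mem_univ _), ← smpd_xi, norm_smul,
      norm_pow, Real.norm_of_nonneg hr.le]
    have h1 := hM j ξ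
    rw [hξ, abs_mul, abs_of_pos hr] at h1
    have h2 : c0 * r / 2 ≤ Λ j ξ := by
      refine le_trans ?_ h1
      have := mul_le_mul_of_nonneg_left hζ (mul_pos hc0 hr).le
      linarith
    calc r ^ i * ‖smpd (Pi.single j i) 0 a x ξ‖ ≤ r ^ i * (C * (Λ j ξ ^ i)⁻¹) := by
          gcongr; exact hC x hx ξ
      _ ≤ r ^ i * (|C| * (Λ j ξ ^ i)⁻¹) := by
          have := hΛ0 j ξ
          gcongr; exact le_abs_self _
      _ = |C| * (r / Λ j ξ) ^ i := by rw [div_pow]; ring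
      _ ≤ |C| * (2 / c0) ^ i := by
          have := hΛ0 j ξ
          gcongr ?_ * ?_ ^ i
          rw [div_le_div_iff₀ this hc0]
          linarith)
  obtain ⟨A, hA0, hA⟩ := hA
  obtain ⟨B, hB0, hB⟩ := hB
  refine ⟨(P * 1) * (2 ^ l * (A * B)), fun kz => ?_⟩
  obtain ⟨k, z⟩ := kz
  have hX : ∀ t : ℝ, Xz (z + t • EuclideanSpace.single (Sum.inr j) 1) = Xz z := by
    intro t; ext i; simp [Xz]
  have hY : ∀ (t : ℝ), Az k (z + t • EuclideanSpace.single (Sum.inr j) 1) = Az k z + ((2 * Real.pi * 2 ^ k j) * t) • e := by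
    intro t; ext i
    by_cases hij : i = j
    · subst hij
      simp [Az, he]
      ring
    · simp [Az, he, hij]
  have hfun : (fun t : ℝ => GG ψ a k (z + t • EuclideanSpace.single (Sum.inr j) 1)) =
      fun t => (ψ (Xz z) * ∏ i ∈ Finset.univ.erase j, (phi (z (Sum.inr i)) : ℂ)) *
        ((phi (z (Sum.inr j) + t) : ℂ) * a (Xz z) (Az k z + ((2 * Real.pi * 2 ^ k j) * t) • e)) := by
    ext t
    have : ∏ i, (phi ((z + t • EuclideanSpace.single (Sum.inr j) (1:ℝ) : VV d) (Sum.inr i)) : ℂ) =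
        phi (z (Sum.inr j) + t) * ∏ i ∈ Finset.univ.erase j, (phi (z (Sum.inr i)) : ℂ) := by
      rw [← Finset.mul_prod_erase _ _ (Finset.mem_univ j)]
      congr 1
      · simp
      · apply Finset.prod_congr rfl
        intro i hi
        simp [Finset.ne_of_mem_erase hi]
    simp only [GG, hX, hY]
    rw [this]
    ring
  dsimp only
  rw [hfun, iteratedDeriv_const_mul_field, norm_mul]
  by_cases hz : Xz z ∈ tsupport ψ
  swap
  · have : ψ (Xz z) = 0 := image_eq_zero_of_notMem_tsupport hz
    rw [this, zero_mul, norm_zero, zero_mul]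
    positivity
  gcongr
  · rw [norm_mul]
    gcongr
    · exact hP _
    · rw [norm_prod]
      exact Finset.prod_le_one (fun _ _ => norm_nonneg _) fun _ _ => phiC_norm _
  · by_cases h2 : 1 / 2 ≤ |z (Sum.inr j)| ∧ |z (Sum.inr j)| ≤ 2
    · apply leib l _ _ (fun i hi => hA i hi ⟨_, abs_le.1 h2.2⟩)
        (fun i hi => hB i hi ⟨(Xz z, Az k z, k, z (Sum.inr j)), hz, h2.1, rfl⟩)
      · exact (phiC_smooth.comp (f := fun t : ℝ => z (Sum.inr j) + t) (by fun_prop)).contDiffAt.of_le (by exact_mod_cast le_top)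
      · exact ((hsm _ (hψΩ hz)).comp (f := fun t : ℝ => Az k z + ((2 * Real.pi * 2 ^ k j) * t) • e)
          (by fun_prop)).contDiffAt.of_le (by exact_mod_cast le_top)
    · have hx : (fun t : ℝ => (phi (z (Sum.inr j) + t) : ℂ) * a (Xz z) (Az k z + ((2 * Real.pi * 2 ^ k j) * t) • e))
          =ᶠ[nhds 0] fun _ => 0 := by
        have hcl : IsClosed {s : ℝ | 1 / 2 ≤ |s| ∧ |s| ≤ 2} :=
          (isClosed_le continuous_const continuous_abs).inter (isClosed_le continuous_abs continuous_const)
        have ho : IsOpen ((fun t : ℝ => z (Sum.inr j) + t) ⁻¹' {s : ℝ | 1 / 2 ≤ |s| ∧ |s| ≤ 2}ᶜ) :=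
          hcl.isOpen_compl.preimage (by fun_prop)
        filter_upwards [ho.mem_nhds (by simpa using h2)] with t ht
        have : phi (z (Sum.inr j) + t) = 0 := by
          by_contra h
          exact ht (phi_supp h)
        rw [this]; simp
      rw [hx.iteratedDeriv_eq l]
      simp
      positivity

/-- Uniform Fourier decay of the symbol pieces. -/
lemma GG_main {Ω : Set (Euc d)} (hΩ : IsOpen Ω) {Λ : Fin d → Euc d → ℝ} (hΛ : IsWeightVector Λ)
    {a : Euc d → Euc d → ℂ} (ha : IsSymbol Ω (fun _ => 1) Λ a)
    {ψ : Euc d → ℂ} (hψ : ContDiff ℝ (⊤ : ℕ∞) ψ) (hψc : HasCompactSupport ψ) (hψΩ : tsupport ψ ⊆ Ω) (l : ℕ) :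
    ∃ C : ℝ, 0 ≤ C ∧ ∀ k : Fin d → ℤ, ∃ g : 𝓢(VV d, ℂ), (∀ z, g z = GG ψ a k z) ∧
      ∀ w, ‖𝓕 (g : VV d → ℂ) w‖ * (1 + ‖w‖) ^ l ≤ C := by
  obtain ⟨hs, hbd⟩ := ha
  obtain ⟨-, hpos, C0, c0, -, hc0, -, hM, -⟩ := hΛ
  have hK := hψc.isCompact
  obtain ⟨R, hR⟩ := GG_supp (a := a) hψc
  obtain ⟨c, hc, hca⟩ := hbd _ hK hψΩ 0 0
  obtain ⟨M1, hM1⟩ := GG_bd (a := a) hψ hψc (c := c) (fun x hx ξ => by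
    have := hca x hx ξ
    rw [smpd_zero] at this
    simpa using this)
  have h1 := GG_dx hΩ hψ hψc hψΩ hs (fun j l => by
    obtain ⟨c, -, h⟩ := hbd _ hK hψΩ 0 (Pi.single j l)
    refine ⟨c, fun x hx ξ => ?_⟩
    simpa using h x hx ξ)
  have h2 := GG_dxi hΩ hψ hψc hψΩ hs hc0 hpos hM (fun j l => by
    obtain ⟨c, -, h⟩ := hbd _ hK hψΩ (Pi.single j l) 0
    refine ⟨c, fun x hx ξ => ?_⟩
    have := h x hx ξ
    rw [Finset.prod_eq_single j (fun b _ hb => by simp [Pi.single_eq_of_ne hb]) (by simp), Pi.single_eq_same, mul_one] at this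
    exact this)
  obtain ⟨M2, hM20, hM2⟩ := unif_const (fun j => h1 j l)
  obtain ⟨M3, hM30, hM3⟩ := unif_const (fun j => h2 j l)
  obtain ⟨C, hC, hdec⟩ := fourier_decay (J := Fin d ⊕ Fin d) R l
  refine ⟨C * (|M1| + M2 + M3), by positivity, fun k => ?_⟩
  have hcs : HasCompactSupport (GG ψ a k) :=
    HasCompactSupport.of_support_subset_isCompact (isCompact_closedBall 0 R) fun z hz => by
      by_contra h
      exact hz (hR k z h)
  refine ⟨hcs.toSchwartzMap (GG_smooth hΩ hψ hψΩ hs k), fun z => rfl, ?_⟩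
  apply hdec
  · exact hR k
  · intro z
    exact (hM1 k z).trans (by linarith [le_abs_self M1])
  · rintro (j | j) z
    · exact (hM2 j (k, z)).trans (by linarith [abs_nonneg M1])
    · exact (hM3 j (k, z)).trans (by linarith [abs_nonneg M1])

end pieces

end

open scoped BigOperators RealInnerProductSpace
open MeasureTheory

noncomputable section

set_option linter.unusedSectionVars false

section pairing
open scoped FourierTransform SchwartzMap

variable {d : ℕ}

/-- square function for the diagonal family -/
lemma sq_diag {p C : ℝ} (hp : 1 < p) (h : SQ1 kapS p C) (η : Fin d → ℝ) (S : Finset ℤ)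
    {f : Euc d → ℂ} (hf : DD f) :
    (∫⁻ x, ((∑ k : Fin d → S, ‖opG d id (fun i => kap kapS (k i) (η i)) f x‖ₑ ^ 2) ^ (1 / 2 : ℝ)) ^ p) ^ (1 / p) ≤
      ENNReal.ofReal (∏ i, (C * (1 + |η i|) ^ 2)) * (∫⁻ x, ‖f x‖ₑ ^ p) ^ (1 / p) := by
  have h1 := opG_sq hp h d id η S Unit (f := fun _ => f) (fun _ => hf)
  have hp0 : 0 < p := by linarith
  have h2 : ∫⁻ x, ((∑ k : Fin d → S, ‖opG d id (fun i => kap kapS (k i) (η i)) f x‖ₑ ^ 2) ^ (1 / 2 : ℝ)) ^ p ≤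
      (ENNReal.ofReal (∏ i, (C * (1 + |η i|) ^ 2))) ^ p * ∫⁻ x, ‖f x‖ₑ ^ p := by
    refine le_trans (le_of_eq ?_) (h1.trans (le_of_eq ?_))
    · apply lintegral_congr
      intro x
      rw [← ENNReal.rpow_mul, Fintype.sum_prod_type]
      simp only [Finset.univ_unique, Finset.sum_singleton]
      congr 1
      ring
    · congr 1
      apply lintegral_congr
      intro x
      simp only [Finset.univ_unique, Finset.sum_singleton]
      rw [← ENNReal.rpow_natCast, ← ENNReal.rpow_mul]
      congr 1
      push_cast
      ring
  calc _ ≤ ((ENNReal.ofReal (∏ i, (C * (1 + |η i|) ^ 2))) ^ p * ∫⁻ x, ‖f x‖ₑ ^ p) ^ (1 / p) := by gcongr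
    _ = _ := by
      rw [ENNReal.mul_rpow_of_nonneg _ _ (by positivity), ← ENNReal.rpow_mul, mul_one_div_cancel hp0.ne', ENNReal.rpow_one]

lemma pair_bound {p q Cp Cq : ℝ} (hpq : p.HolderConjugate q) (hCp : SQ1 kapS p Cp) (hCq : SQ1 kapS q Cq)
    (η : Fin d → ℝ) (S : Finset ℤ) {f g : Euc d → ℂ} (hf : DD f) (hg : DD g) :
    ∑ k : Fin d → S, ‖∫ x, opG d id (fun i => kap kapS (k i) (η i)) (opG d id (fun i => kap kapS (k i) 0) f) x * g x‖ₑ ≤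
      ENNReal.ofReal (Cp ^ d) * ENNReal.ofReal (∏ i, (Cq * (1 + |η i|) ^ 2)) *
        ((∫⁻ x, ‖f x‖ₑ ^ p) ^ (1 / p) * (∫⁻ x, ‖g x‖ₑ ^ q) ^ (1 / q)) := by
  set U : (Fin d → S) → Euc d → ℂ := fun k => opG d id (fun i => kap kapS (k i) 0) f with hU
  set V : (Fin d → S) → Euc d → ℂ := fun k => opG d id (fun i => kap kapS (k i) (-η i)) g with hV
  have hUD : ∀ k, DD (U k) := fun k => opG_DD d _ _ (fun i => kap_RD _ _ _) hf
  have hVD : ∀ k, DD (V k) := fun k => opG_DD d _ _ (fun i => kap_RD _ _ _) hg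
  have h1 : ∀ k : Fin d → S, ‖∫ x, opG d id (fun i => kap kapS (k i) (η i)) (U k) x * g x‖ₑ ≤
      ∫⁻ x, ‖U k x‖ₑ * ‖V k x‖ₑ := by
    intro k
    rw [opG_transpose d _ _ (fun i => kap_RD _ _ _) (hUD k) hg]
    simp only [kap_neg]
    refine (enorm_integral_le_lintegral_enorm _).trans (le_of_eq ?_)
    simp only [enorm_mul, hV]
  have hm1 : ∀ k, Measurable fun x => ‖U k x‖ₑ := fun k => (hUD k).1.measurable.enorm
  have hm2 : ∀ k, Measurable fun x => ‖V k x‖ₑ := fun k => (hVD k).1.measurable.enorm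
  calc _ ≤ ∑ k : Fin d → S, ∫⁻ x, ‖U k x‖ₑ * ‖V k x‖ₑ := Finset.sum_le_sum fun k _ => h1 k
    _ = ∫⁻ x, ∑ k : Fin d → S, ‖U k x‖ₑ * ‖V k x‖ₑ :=
        (lintegral_finsetSum _ fun k _ => (hm1 k).mul (hm2 k)).symm
    _ ≤ ∫⁻ x, ((∑ k : Fin d → S, ‖U k x‖ₑ ^ 2) ^ (1 / 2 : ℝ)) * ((∑ k : Fin d → S, ‖V k x‖ₑ ^ 2) ^ (1 / 2 : ℝ)) := by
        apply lintegral_mono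
        intro x
        dsimp only
        have := ENNReal.inner_le_Lp_mul_Lq Finset.univ (fun k => ‖U k x‖ₑ) (fun k => ‖V k x‖ₑ)
          (p := 2) (q := 2) (by rw [Real.holderConjugate_iff]; norm_num)
        simpa only [ENNReal.rpow_two] using this
    _ ≤ (∫⁻ x, ((∑ k : Fin d → S, ‖U k x‖ₑ ^ 2) ^ (1 / 2 : ℝ)) ^ p) ^ (1 / p) *
        (∫⁻ x, ((∑ k : Fin d → S, ‖V k x‖ₑ ^ 2) ^ (1 / 2 : ℝ)) ^ q) ^ (1 / q) := by
        apply ENNReal.lintegral_mul_le_Lp_mul_Lq _ hpq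
        · exact ((Finset.measurable_fun_sum _ fun k _ => (hm1 k).pow_const 2).pow_const _).aemeasurable
        · exact ((Finset.measurable_fun_sum _ fun k _ => (hm2 k).pow_const 2).pow_const _).aemeasurable
    _ ≤ (ENNReal.ofReal (∏ i : Fin d, (Cp * (1 + |(0 : Fin d → ℝ) i|) ^ 2)) * (∫⁻ x, ‖f x‖ₑ ^ p) ^ (1 / p)) *
        (ENNReal.ofReal (∏ i, (Cq * (1 + |(-η) i|) ^ 2)) * (∫⁻ x, ‖g x‖ₑ ^ q) ^ (1 / q)) := by
        gcongr
        · exact sq_diag hpq.lt hCp 0 S hf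
        · exact sq_diag hpq.symm.lt hCq (-η) S hg
    _ = _ := by
        simp only [Pi.zero_apply, abs_zero, add_zero, one_pow, mul_one, Finset.prod_const, Finset.card_univ,
          Fintype.card_fin, Pi.neg_apply, abs_neg]
        ring

end pairing

end

open scoped BigOperators RealInnerProductSpace
open MeasureTheory

noncomputable section

set_option linter.unusedSectionVars false

section assembly
open scoped FourierTransform SchwartzMap

variable {d : ℕ}

def ee (s : ℝ) : ℂ := Complex.exp (((2 * Real.pi * s : ℝ) : ℂ) * Complex.I)

lemma ee_norm (s : ℝ) : ‖ee s‖ = 1 := Complex.norm_exp_ofReal_mul_I _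

lemma ee_cont : Continuous ee := by unfold ee; fun_prop

lemma ee_add (s t : ℝ) : ee (s + t) = ee s * ee t := by
  unfold ee
  rw [← Complex.exp_add]
  congr 1
  push_cast
  ring

lemma ee_sum {ι : Type*} (s : Finset ι) (f : ι → ℝ) : ee (∑ i ∈ s, f i) = ∏ i ∈ s, ee (f i) := by
  unfold ee
  rw [← Complex.exp_sum]
  congr 1
  push_cast
  rw [Finset.mul_sum, Finset.sum_mul]

lemma phit_le (x : ℝ) : ‖phit x‖ ≤ 1 := by
  unfold phit
  rw [Complex.norm_real, Real.norm_eq_abs, abs_le]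
  constructor <;> linarith [chi_nonneg (x / 2), chi_le_one (x / 2), chi_nonneg (8 * x), chi_le_one (8 * x)]

def mult (k : Fin d → ℤ) (η : Fin d → ℝ) (ω : Euc d) : ℂ :=
  ∏ j, (ee (η j * (ω j / 2 ^ k j)) * phit (ω j / 2 ^ k j))

lemma kapS_four (k : ℤ) (η ξ : ℝ) : 𝓕 (kap kapS k η) ξ = ee (η * (ξ / 2 ^ k)) * phit (ξ / 2 ^ k) := by
  rw [kap_fourier, kapS_fourier]
  unfold ee
  congr 2
  push_cast
  ring

lemma mult_norm (k : Fin d → ℤ) (η : Fin d → ℝ) (ω : Euc d) : ‖mult k η ω‖ ≤ 1 := by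
  unfold mult
  rw [norm_prod]
  refine Finset.prod_le_one (fun _ _ => norm_nonneg _) fun j _ => ?_
  rw [norm_mul, ee_norm, one_mul]
  exact phit_le _

lemma mult_cont (k : Fin d → ℤ) : Continuous fun q : (Fin d → ℝ) × Euc d => mult k q.1 q.2 := by
  unfold mult
  have h1 := ee_cont
  have h2 := phit_smooth.continuous
  fun_prop

def Wk (u : Euc d → ℂ) (k : Fin d → ℤ) (η : Fin d → ℝ) : Euc d → ℂ :=
  opG d id (fun i => kap kapS (k i) (η i)) (opG d id (fun i => kap kapS (k i) 0) u)

lemma Wk_inv {u : Euc d → ℂ} (hu : DD u) (hi : Integrable (𝓕 u)) (k : Fin d → ℤ) (η : Fin d → ℝ) (x : Euc d) :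
    Wk u k η x = ∫ ω, ee ⟪ω, x⟫ * (mult k η ω * mult k 0 ω * 𝓕 u ω) := by
  have h1 : DD (opG d id (fun i => kap kapS (k i) 0) u) := opG_DD d _ _ (fun i => kap_RD _ _ _) hu
  have h2 : DD (Wk u k η) := opG_DD d _ _ (fun i => kap_RD _ _ _) h1
  have h3 : 𝓕 (Wk u k η) = fun ω => mult k η ω * mult k 0 ω * 𝓕 u ω := by
    ext ω
    unfold Wk
    rw [opG_fourier d _ _ (fun i => kap_RD _ _ _) h1, opG_fourier d _ _ (fun i => kap_RD _ _ _) hu]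
    simp only [kapS_four, mult, id, Pi.zero_apply]
    ring
  have h4 : Integrable (𝓕 (Wk u k η)) := by
    rw [h3]
    refine hi.bdd_mul (c := 1) ?_ ?_
    · have := mult_cont k
      have h5 : Continuous fun ω : Euc d => mult k η ω * mult k 0 ω :=
        (this.comp (f := fun ω : Euc d => (η, ω)) (by fun_prop)).mul
          (this.comp (f := fun ω : Euc d => ((0 : Fin d → ℝ), ω)) (by fun_prop))
      exact h5.aestronglyMeasurable
    · refine Filter.Eventually.of_forall fun ω => ?_
      rw [norm_mul]
      exact mul_le_one₀ (mult_norm _ _ _) (norm_nonneg _) (mult_norm _ _ _)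
  have h5 := h2.1.fourierInv_fourier_eq h2.integrable h4
  rw [← h5, h3, Real.fourierInv_eq']
  rfl

def zk (k : Fin d → ℤ) (x ω : Euc d) : VV d := WithLp.toLp 2 (Sum.elim (fun j => x j) (fun j => ω j / 2 ^ k j))

lemma zk_cont (k : Fin d → ℤ) : Continuous fun q : Euc d × Euc d => zk k q.1 q.2 := by
  unfold zk
  refine (PiLp.continuous_toLp 2 _).comp (continuous_pi fun i => ?_)
  rcases i with j | j
  · simp only [Sum.elim_inl]; fun_prop
  · simp only [Sum.elim_inr]; fun_prop

lemma GG_zk (ψ : Euc d → ℂ) (a : Euc d → Euc d → ℂ) (k : Fin d → ℤ) (x ω : Euc d) :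
    GG ψ a k (zk k x ω) = ψ x * (∏ j, (phi (ω j / 2 ^ k j) : ℂ)) * a x ((2 * Real.pi) • ω) := by
  have h1 : Xz (zk k x ω) = x := by ext j; simp [Xz, zk]
  have h2 : Az k (zk k x ω) = (2 * Real.pi) • ω := by
    ext j
    simp only [Az, zk, Sum.elim_inr, PiLp.smul_apply, smul_eq_mul]
    have : (2:ℝ) ^ k j ≠ 0 := by positivity
    field_simp
  unfold GG
  rw [h1, h2]
  simp [zk]

lemma GG_phit (ψ : Euc d → ℂ) (a : Euc d → Euc d → ℂ) (k : Fin d → ℤ) (x ω : Euc d) :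
    GG ψ a k (zk k x ω) = GG ψ a k (zk k x ω) * ((∏ j, phit (ω j / 2 ^ k j)) * ∏ j, phit (ω j / 2 ^ k j)) := by
  by_cases h : ∀ j, phi (ω j / 2 ^ k j) ≠ 0
  · have : ∏ j, phit (ω j / 2 ^ k j) = 1 := Finset.prod_eq_one fun j _ => phit_one (h j)
    rw [this]; simp
  · push Not at h
    obtain ⟨j, hj⟩ := h
    rw [GG_zk, Finset.prod_eq_zero (i := j) (Finset.mem_univ j) (by simp [hj])]
    simp

lemma inner_zk (k : Fin d → ℤ) (w : VV d) (x ω : Euc d) :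
    ⟪w, zk k x ω⟫ = ⟪Xz w, x⟫ + ∑ j, w (Sum.inr j) * (ω j / 2 ^ k j) := by
  simp only [PiLp.inner_apply, Fintype.sum_sum_type, zk, Xz, Sum.elim_inl, Sum.elim_inr]
  congr 1
  apply Finset.sum_congr rfl
  intro j _
  simp only [RCLike.inner_apply, conj_trivial]
  ring

/-- the k-th piece -/
def Tk (G : VV d → ℂ) (u : Euc d → ℂ) (k : Fin d → ℤ) (x : Euc d) : ℂ :=
  ∫ ω, ee ⟪ω, x⟫ * (G (zk k x ω) * 𝓕 u ω)

lemma Tk_eq {u : Euc d → ℂ} (hu : DD u) (hi : Integrable (𝓕 u)) (k : Fin d → ℤ) (ψ : Euc d → ℂ)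
    (a : Euc d → Euc d → ℂ) (g : 𝓢(VV d, ℂ)) (hg : ∀ z, g z = GG ψ a k z) (x : Euc d) :
    Tk g u k x = ∫ w : VV d, 𝓕 (g : VV d → ℂ) w * (ee ⟪Xz w, x⟫ * Wk u k (fun j => w (Sum.inr j)) x) := by
  have hgi : Integrable (𝓕 (g : VV d → ℂ)) := by
    rw [← SchwartzMap.fourier_coe]; exact (𝓕 g).integrable
  have hinv : ∀ z, g z = ∫ w, ee ⟪w, z⟫ * 𝓕 (g : VV d → ℂ) w := by
    intro z
    have h5 := g.continuous.fourierInv_fourier_eq g.integrable hgi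
    conv_lhs => rw [← h5, Real.fourierInv_eq']
    rfl
  have hX : Continuous (Xz : VV d → Euc d) := Xz_smooth.continuous
  have hη : Continuous fun w : VV d => fun j : Fin d => w (Sum.inr j) := by fun_prop
  have hm := mult_cont (d := d) k
  have he := ee_cont
  set Φ : Euc d → VV d → ℂ := fun ω w => (ee ⟪Xz w, x⟫ * ee ⟪ω, x⟫ * (mult k (fun j => w (Sum.inr j)) ω * mult k 0 ω)) *
    (𝓕 u ω * 𝓕 (g : VV d → ℂ) w) with hΦ
  have hintg : Integrable (Function.uncurry Φ) (volume.prod volume) := by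
    refine (hi.mul_prod hgi).bdd_mul (c := 1) ?_ ?_
    · apply Continuous.aestronglyMeasurable
      refine Continuous.mul (Continuous.mul ?_ ?_) (Continuous.mul ?_ ?_)
      · exact he.comp (Continuous.inner (hX.comp continuous_snd) continuous_const)
      · exact he.comp (Continuous.inner continuous_fst continuous_const)
      · exact hm.comp (f := fun q : Euc d × VV d => ((fun j => q.2 (Sum.inr j)), q.1))
          ((hη.comp continuous_snd).prodMk continuous_fst)
      · exact hm.comp (f := fun q : Euc d × VV d => ((0 : Fin d → ℝ), q.1)) (by fun_prop)
    · refine Filter.Eventually.of_forall fun q => ?_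
      rw [norm_mul, norm_mul, norm_mul, ee_norm, ee_norm, one_mul, one_mul]
      exact mul_le_one₀ (mult_norm _ _ _) (norm_nonneg _) (mult_norm _ _ _)
  have h1 : ∀ ω, ee ⟪ω, x⟫ * (g (zk k x ω) * 𝓕 u ω) = ∫ w, Φ ω w := by
    intro ω
    have h2 : ∀ w, Φ ω w = (ee ⟪ω, x⟫ * ((∏ j, phit (ω j / 2 ^ k j)) * ∏ j, phit (ω j / 2 ^ k j)) * 𝓕 u ω) *
        (ee ⟪w, zk k x ω⟫ * 𝓕 (g : VV d → ℂ) w) := by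
      intro w
      have h0 : mult k 0 ω = ∏ j, phit (ω j / 2 ^ k j) := by
        unfold mult
        apply Finset.prod_congr rfl
        intro j _
        simp [ee]
      have h3 : mult k (fun j => w (Sum.inr j)) ω = ee (∑ j, w (Sum.inr j) * (ω j / 2 ^ k j)) * ∏ j, phit (ω j / 2 ^ k j) := by
        unfold mult
        rw [Finset.prod_mul_distrib, ee_sum]
      simp only [hΦ]
      rw [h0, h3, inner_zk, ee_add]
      ring
    simp only [h2]
    rw [integral_const_mul, ← hinv, hg]
    conv_lhs => rw [GG_phit]
    ring
  unfold Tk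
  simp only [h1]
  rw [integral_integral_swap hintg]
  congr 1
  ext w
  rw [Wk_inv hu hi, ← integral_const_mul, ← integral_const_mul]
  congr 1
  ext ω
  simp only [hΦ]
  ring

lemma Tk_cont {u : Euc d → ℂ} (hi : Integrable (𝓕 u)) (hc : Continuous (𝓕 u)) (k : Fin d → ℤ) (g : 𝓢(VV d, ℂ)) :
    Continuous (Tk g u k) := by
  obtain ⟨M, hM⟩ : ∃ M, ∀ z, ‖g z‖ ≤ M := ⟨_, fun z => SchwartzMap.norm_le_seminorm ℝ g z⟩
  have hz := zk_cont (d := d) k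
  have he := ee_cont
  unfold Tk
  refine continuous_of_dominated (bound := fun ω => M * ‖𝓕 u ω‖) ?_ ?_ (hi.norm.const_mul M) ?_
  · intro x
    have h2 : Continuous fun ω : Euc d => zk k x ω := hz.comp (f := fun ω : Euc d => (x, ω)) (by fun_prop)
    have h1 : Continuous fun ω : Euc d => ee ⟪ω, x⟫ * (g (zk k x ω) * 𝓕 u ω) :=
      (he.comp (by fun_prop)).mul ((g.continuous.comp h2).mul hc)
    exact h1.aestronglyMeasurable
  · intro x
    refine Filter.Eventually.of_forall fun ω => ?_
    rw [norm_mul, norm_mul, ee_norm, one_mul]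
    gcongr
    exact hM _
  · refine Filter.Eventually.of_forall fun ω => ?_
    have h2 : Continuous fun x : Euc d => zk k x ω := hz.comp (f := fun x : Euc d => (x, ω)) (by fun_prop)
    exact (he.comp (by fun_prop)).mul ((g.continuous.comp h2).mul continuous_const)

lemma Wk_cont {u : Euc d → ℂ} (hu : DD u) (hi : Integrable (𝓕 u)) (hc : Continuous (𝓕 u)) (k : Fin d → ℤ) :
    Continuous fun q : Euc d × VV d => Wk u k (fun j => q.2 (Sum.inr j)) q.1 := by
  simp only [Wk_inv hu hi]
  have hm := mult_cont (d := d) k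
  have he := ee_cont
  have hη : Continuous fun w : VV d => fun j : Fin d => w (Sum.inr j) := by fun_prop
  refine continuous_of_dominated (bound := fun ω => ‖𝓕 u ω‖) ?_ ?_ hi.norm ?_
  · intro q
    apply Continuous.aestronglyMeasurable
    refine Continuous.mul (he.comp (by fun_prop)) (Continuous.mul (Continuous.mul ?_ ?_) hc)
    · exact hm.comp (f := fun ω : Euc d => ((fun j => q.2 (Sum.inr j)), ω)) (by fun_prop)
    · exact hm.comp (f := fun ω : Euc d => ((0 : Fin d → ℝ), ω)) (by fun_prop)
  · intro q
    refine Filter.Eventually.of_forall fun ω => ?_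
    rw [norm_mul, norm_mul, norm_mul, ee_norm, one_mul]
    have := mul_le_one₀ (mult_norm k (fun j => q.2 (Sum.inr j)) ω) (norm_nonneg _) (mult_norm k 0 ω)
    exact mul_le_of_le_one_left (norm_nonneg _) this
  · refine Filter.Eventually.of_forall fun ω => ?_
    refine Continuous.mul (he.comp (by fun_prop)) (Continuous.mul (Continuous.mul ?_ continuous_const) continuous_const)
    exact hm.comp (f := fun q : Euc d × VV d => ((fun j => q.2 (Sum.inr j)), ω)) ((hη.comp continuous_snd).prodMk continuous_const)

lemma Wk_bdd {u : Euc d → ℂ} (hu : DD u) (hi : Integrable (𝓕 u)) (k : Fin d → ℤ) (η : Fin d → ℝ) (x : Euc d) :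
    ‖Wk u k η x‖ ≤ ∫ ω, ‖𝓕 u ω‖ := by
  rw [Wk_inv hu hi]
  refine norm_integral_le_of_norm_le hi.norm (Filter.Eventually.of_forall fun ω => ?_)
  rw [norm_mul, norm_mul, norm_mul, ee_norm, one_mul]
  exact mul_le_of_le_one_left (norm_nonneg _) (mul_le_one₀ (mult_norm _ _ _) (norm_nonneg _) (mult_norm _ _ _))

lemma Tk_pair {u : Euc d → ℂ} (hu : DD u) (hi : Integrable (𝓕 u)) (hc : Continuous (𝓕 u)) (k : Fin d → ℤ)
    (ψ : Euc d → ℂ) (a : Euc d → Euc d → ℂ) (g : 𝓢(VV d, ℂ)) (hg : ∀ z, g z = GG ψ a k z)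
    {h : Euc d → ℂ} (hh : Continuous h) (hhc : HasCompactSupport h) :
    ∫ x, Tk g u k x * h x =
      ∫ w : VV d, 𝓕 (g : VV d → ℂ) w * ∫ x, Wk u k (fun j => w (Sum.inr j)) x * (ee ⟪Xz w, x⟫ * h x) := by
  have hgi : Integrable (𝓕 (g : VV d → ℂ)) := by
    rw [← SchwartzMap.fourier_coe]; exact (𝓕 g).integrable
  have hX : Continuous (Xz : VV d → Euc d) := Xz_smooth.continuous
  have he := ee_cont
  have hhi : Integrable h := hh.integrable_of_hasCompactSupport hhc
  set Φ : Euc d → VV d → ℂ := fun x w => (Wk u k (fun j => w (Sum.inr j)) x * ee ⟪Xz w, x⟫) *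
    (h x * 𝓕 (g : VV d → ℂ) w) with hΦ
  have hintg : Integrable (Function.uncurry Φ) (volume.prod volume) := by
    refine (hhi.mul_prod hgi).bdd_mul (c := ∫ ω, ‖𝓕 u ω‖) ?_ ?_
    · apply Continuous.aestronglyMeasurable
      refine Continuous.mul (Wk_cont hu hi hc k) ?_
      exact he.comp (Continuous.inner (hX.comp continuous_snd) continuous_fst)
    · refine Filter.Eventually.of_forall fun q => ?_
      rw [norm_mul, ee_norm, mul_one]
      exact Wk_bdd hu hi _ _ _
  have h1 : ∀ x, Tk g u k x * h x = ∫ w, Φ x w := by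
    intro x
    rw [Tk_eq hu hi k ψ a g hg, ← integral_mul_const]
    congr 1
    ext w
    simp only [hΦ]
    ring
  simp only [h1]
  rw [integral_integral_swap hintg]
  congr 1
  ext w
  rw [← integral_const_mul]
  congr 1
  ext x
  simp only [hΦ]
  ring

lemma sum_lintegral_le {α ι : Type*} [MeasurableSpace α] {μ : Measure α} (s : Finset ι) (f : ι → α → ENNReal) :
    ∑ i ∈ s, ∫⁻ x, f i x ∂μ ≤ ∫⁻ x, ∑ i ∈ s, f i x ∂μ := by
  classical
  induction s using Finset.induction_on with
  | empty => simp
  | insert b s hb ih =>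
    simp only [Finset.sum_insert hb]
    exact (add_le_add le_rfl ih).trans (le_lintegral_add _ _)

/-- The uniform bilinear estimate. -/
lemma vN_pair {p q Cp Cq CL : ℝ} (hpq : p.HolderConjugate q) (hCp : SQ1 kapS p Cp) (hCq : SQ1 kapS q Cq)
    (hCL : 0 ≤ CL) (ψ : Euc d → ℂ) (a : Euc d → Euc d → ℂ) (g : (Fin d → ℤ) → 𝓢(VV d, ℂ))
    (hg : ∀ k z, g k z = GG ψ a k z)
    (hdec : ∀ k w, ‖𝓕 (g k : VV d → ℂ) w‖ * (1 + ‖w‖) ^ (2 * d + (2 * d + 1)) ≤ CL) :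
    ∃ D : ENNReal, D ≠ ⊤ ∧ ∀ (u : Euc d → ℂ), DD u → Integrable (𝓕 u) → Continuous (𝓕 u) →
      ∀ (h : Euc d → ℂ), Continuous h → HasCompactSupport h → ∀ S : Finset ℤ,
      ‖∫ x, (∑ k : Fin d → S, Tk (g fun j => k j) u (fun j => k j) x) * h x‖ₑ ≤
        D * ((∫⁻ x, ‖u x‖ₑ ^ p) ^ (1 / p) * (∫⁻ x, ‖h x‖ₑ ^ q) ^ (1 / q)) := by
  have hCq0 := hCq.1
  have hCp0 := hCp.1
  have hJ : Integrable fun w : VV d => ((1 + ‖w‖) ^ (2 * d + 1))⁻¹ := by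
    have := integrable_one_add_norm (E := VV d) (μ := volume) (r := (2 * d + 1 : ℕ)) (by
      simp only [finrank_euclideanSpace, Fintype.card_sum, Fintype.card_fin]; push_cast; linarith)
    refine this.congr (Filter.Eventually.of_forall fun x => ?_)
    simp only
    rw [Real.rpow_neg (by positivity), Real.rpow_natCast]
  refine ⟨ENNReal.ofReal (CL * Cp ^ d * Cq ^ d) * ∫⁻ w : VV d, ENNReal.ofReal ((1 + ‖w‖) ^ (2 * d + 1))⁻¹, ?_, ?_⟩
  · refine ENNReal.mul_ne_top ENNReal.ofReal_ne_top ?_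
    rw [← ofReal_integral_eq_lintegral_ofReal hJ (Filter.Eventually.of_forall fun w => by positivity)]
    exact ENNReal.ofReal_ne_top
  intro u hu hi hc h hh hhc S
  set A := (∫⁻ x, ‖u x‖ₑ ^ p) ^ (1 / p) * (∫⁻ x, ‖h x‖ₑ ^ q) ^ (1 / q) with hA
  have hX : Continuous (Xz : VV d → Euc d) := Xz_smooth.continuous
  have he := ee_cont
  have e1 : ∫ x, (∑ k : Fin d → S, Tk (g fun j => k j) u (fun j => k j) x) * h x =
      ∑ k : Fin d → S, ∫ w : VV d, 𝓕 (g (fun j => k j) : VV d → ℂ) w *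
        ∫ x, Wk u (fun j => k j) (fun j => w (Sum.inr j)) x * (ee ⟪Xz w, x⟫ * h x) := by
    simp only [Finset.sum_mul]
    rw [integral_finsetSum]
    · apply Finset.sum_congr rfl
      intro k _
      exact Tk_pair hu hi hc _ ψ a _ (hg _) hh hhc
    · intro k _
      exact ((Tk_cont hi hc _ _).mul hh).integrable_of_hasCompactSupport hhc.mul_left
  rw [e1]
  have hw : ∀ w : VV d, ∑ k : Fin d → S, ‖𝓕 (g (fun j => k j) : VV d → ℂ) w *
        ∫ x, Wk u (fun j => k j) (fun j => w (Sum.inr j)) x * (ee ⟪Xz w, x⟫ * h x)‖ₑ ≤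
      ENNReal.ofReal (CL * Cp ^ d * Cq ^ d) * ENNReal.ofReal ((1 + ‖w‖) ^ (2 * d + 1))⁻¹ * A := by
    intro w
    have h1 : ∀ k, ‖𝓕 (g k : VV d → ℂ) w‖ₑ ≤ ENNReal.ofReal (CL * ((1 + ‖w‖) ^ (2 * d + (2 * d + 1)))⁻¹) := by
      intro k
      rw [← ofReal_norm]
      apply ENNReal.ofReal_le_ofReal
      rw [← div_eq_mul_inv, le_div_iff₀ (by positivity)]
      exact hdec k w
    have hgD : DD (fun x => ee ⟪Xz w, x⟫ * h x) :=
      DD.of_compact ((he.comp (by fun_prop)).mul hh) hhc.mul_left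
    have h2 := pair_bound hpq hCp hCq (fun j => w (Sum.inr j)) S hu hgD
    have h3 : ∫⁻ x, ‖ee ⟪Xz w, x⟫ * h x‖ₑ ^ q = ∫⁻ x, ‖h x‖ₑ ^ q := by
      apply lintegral_congr
      intro x
      rw [enorm_mul, ← ofReal_norm (ee _), ee_norm, ENNReal.ofReal_one, one_mul]
    rw [h3, ← hA] at h2
    have h4 : ∏ i, (Cq * (1 + |w (Sum.inr i)|) ^ 2) ≤ Cq ^ d * (1 + ‖w‖) ^ (2 * d) := by
      calc _ ≤ ∏ i : Fin d, (Cq * (1 + ‖w‖) ^ 2) := by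
            refine Finset.prod_le_prod (fun _ _ => by positivity) fun i _ => ?_
            gcongr
            rw [← Real.norm_eq_abs]
            exact PiLp.norm_apply_le w _
        _ = _ := by
          rw [Finset.prod_const, Finset.card_univ, Fintype.card_fin, mul_pow, ← pow_mul]
    calc _ ≤ ∑ k : Fin d → S, ENNReal.ofReal (CL * ((1 + ‖w‖) ^ (2 * d + (2 * d + 1)))⁻¹) *
          ‖∫ x, Wk u (fun j => k j) (fun j => w (Sum.inr j)) x * (ee ⟪Xz w, x⟫ * h x)‖ₑ := by
          refine Finset.sum_le_sum fun k _ => ?_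
          rw [enorm_mul]
          gcongr
          exact h1 _
      _ = ENNReal.ofReal (CL * ((1 + ‖w‖) ^ (2 * d + (2 * d + 1)))⁻¹) * ∑ k : Fin d → S,
          ‖∫ x, Wk u (fun j => k j) (fun j => w (Sum.inr j)) x * (ee ⟪Xz w, x⟫ * h x)‖ₑ := by
          rw [Finset.mul_sum]
      _ ≤ ENNReal.ofReal (CL * ((1 + ‖w‖) ^ (2 * d + (2 * d + 1)))⁻¹) *
          (ENNReal.ofReal (Cp ^ d) * ENNReal.ofReal (Cq ^ d * (1 + ‖w‖) ^ (2 * d)) * A) := by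
          gcongr
          refine h2.trans ?_
          gcongr
      _ = _ := by
          rw [← mul_assoc, ← ENNReal.ofReal_mul (by positivity), ← ENNReal.ofReal_mul (by positivity),
            ← ENNReal.ofReal_mul (by positivity)]
          congr 2
          rw [pow_add]
          field_simp
  calc _ ≤ ∑ k : Fin d → S, ∫⁻ w : VV d, ‖𝓕 (g (fun j => k j) : VV d → ℂ) w *
        ∫ x, Wk u (fun j => k j) (fun j => w (Sum.inr j)) x * (ee ⟪Xz w, x⟫ * h x)‖ₑ := by
        refine (enorm_sum_le _ _).trans (Finset.sum_le_sum fun k _ => ?_)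
        exact enorm_integral_le_lintegral_enorm _
    _ ≤ _ := sum_lintegral_le _ _
    _ ≤ ∫⁻ w : VV d, ENNReal.ofReal (CL * Cp ^ d * Cq ^ d) * ENNReal.ofReal ((1 + ‖w‖) ^ (2 * d + 1))⁻¹ * A :=
        lintegral_mono hw
    _ = _ := by
        have hm : Measurable fun w : VV d => ENNReal.ofReal ((1 + ‖w‖) ^ (2 * d + 1))⁻¹ := by fun_prop
        rw [lintegral_mul_const _ (hm.const_mul _), lintegral_const_mul _ hm]

end assembly

end

open scoped BigOperators RealInnerProductSpace
open MeasureTheory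

noncomputable section

set_option linter.unusedSectionVars false

section final
open scoped FourierTransform SchwartzMap

variable {d : ℕ}

lemma pdo_eq (a : Euc d → Euc d → ℂ) (u : Euc d → ℂ) (x : Euc d) :
    pdo a u x = ∫ ω, ee ⟪ω, x⟫ * (a x ((2 * Real.pi) • ω) * 𝓕 u ω) := by
  unfold pdo
  have h1 := Measure.integral_comp_smul (volume : Measure (Euc d))
    (fun ξ : Euc d => Complex.exp (Complex.I * (⟪x, ξ⟫ : ℝ)) * a x ξ *
      ∫ y : Euc d, Complex.exp (-(Complex.I * (⟪y, ξ⟫ : ℝ))) * u y) (2 * Real.pi)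
  have hpi : 0 < 2 * Real.pi := by positivity
  rw [finrank_euclideanSpace, Fintype.card_fin, abs_of_pos (by positivity), Complex.real_smul] at h1
  rw [Complex.ofReal_inv] at h1
  rw [← h1]
  congr 1
  ext ω
  have h2 : ∫ y : Euc d, Complex.exp (-(Complex.I * (⟪y, (2 * Real.pi) • ω⟫ : ℝ))) * u y = 𝓕 u ω := by
    rw [Real.fourier_eq']
    congr 1
    ext y
    rw [smul_eq_mul, real_inner_smul_right]
    congr 2
    push_cast
    ring
  rw [h2, real_inner_smul_right, real_inner_comm, mul_assoc]
  congr 1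
  unfold ee
  congr 1
  ring

lemma sum_phi_prod (N : ℕ) (ω : Euc d) :
    ∑ k : Fin d → SN N, ∏ j, phi (ω j / 2 ^ (k j : ℤ)) = ∏ j, ∑ k ∈ SN N, phi (ω j / 2 ^ k) := by
  have : ∀ j, ∑ k ∈ SN N, phi (ω j / 2 ^ k) = ∑ k : SN N, phi (ω j / 2 ^ (k : ℤ)) := by
    intro j
    rw [Finset.sum_coe_sort (SN N) (fun k => phi (ω j / 2 ^ k))]
  simp only [this]
  rw [Finset.prod_univ_sum]
  rw [Fintype.piFinset_univ]

def RN (N : ℕ) (ω : Euc d) : ℝ := ∏ j, ∑ k ∈ SN N, phi (ω j / 2 ^ k)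

lemma RN_abs (N : ℕ) (ω : Euc d) : |RN N ω| ≤ 1 := by
  unfold RN
  rw [Finset.abs_prod]
  exact Finset.prod_le_one (fun _ _ => abs_nonneg _) fun j _ => phi_sum_abs N _

lemma RN_cont (N : ℕ) : Continuous (RN N : Euc d → ℝ) := by
  have := phi_smooth.continuous
  unfold RN
  fun_prop

lemma ae_coord (j : Fin d) : ∀ᵐ ω : Euc d, ω j ≠ 0 := by
  let L : Submodule ℝ (Euc d) := LinearMap.ker (EuclideanSpace.proj j : Euc d →L[ℝ] ℝ).toLinearMap
  have hL : L ≠ ⊤ := by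
    intro h
    have : EuclideanSpace.single j (1:ℝ) ∈ L := by rw [h]; trivial
    simp [L] at this
  have := Measure.addHaar_submodule (volume : Measure (Euc d)) L hL
  rw [ae_iff]
  refine measure_mono_null ?_ this
  intro ω hω
  simpa [L] using hω

lemma RN_tendsto : ∀ᵐ ω : Euc d, Filter.Tendsto (fun N => RN N ω) Filter.atTop (nhds 1) := by
  have : ∀ᵐ ω : Euc d, ∀ j, ω j ≠ 0 := ae_all_iff.2 ae_coord
  filter_upwards [this] with ω hω
  have h := tendsto_finsetProd (Finset.univ : Finset (Fin d)) (fun j _ => phi_sum_tendsto (hω j))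
  simpa [RN] using h

def vN (g : (Fin d → ℤ) → 𝓢(VV d, ℂ)) (u : Euc d → ℂ) (N : ℕ) (x : Euc d) : ℂ :=
  ∑ k : Fin d → SN N, Tk (g fun j => k j) u (fun j => k j) x

lemma vN_eq {u : Euc d → ℂ} (hi : Integrable (𝓕 u)) (hc : Continuous (𝓕 u))
    (ψ : Euc d → ℂ) (a : Euc d → Euc d → ℂ) (g : (Fin d → ℤ) → 𝓢(VV d, ℂ))
    (hg : ∀ k z, g k z = GG ψ a k z) (N : ℕ) (x : Euc d) :
    vN g u N x = ∫ ω, ee ⟪ω, x⟫ * (ψ x * (RN N ω : ℂ) * a x ((2 * Real.pi) • ω) * 𝓕 u ω) := by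
  unfold vN Tk
  rw [← integral_finsetSum]
  · congr 1
    ext ω
    simp only [hg, GG_zk]
    have : (RN N ω : ℂ) = ∑ k : Fin d → SN N, ∏ j, (phi (ω j / 2 ^ (k j : ℤ)) : ℂ) := by
      unfold RN
      rw [← sum_phi_prod]
      push_cast
      rfl
    rw [this, Finset.mul_sum, Finset.sum_mul, Finset.sum_mul, Finset.mul_sum]
  · intro k _
    have hz := zk_cont (d := d) (fun j => k j)
    have h2 : Continuous fun ω : Euc d => zk (fun j => k j) x ω := hz.comp (f := fun ω : Euc d => (x, ω)) (by fun_prop)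
    have he := ee_cont
    set G := g fun j => k j
    have : Integrable fun ω : Euc d => (ee ⟪ω, x⟫ * G (zk (fun j => k j) x ω)) * 𝓕 u ω := by
      refine hi.bdd_mul (c := SchwartzMap.seminorm ℝ 0 0 G) ?_ ?_
      · exact ((he.comp (by fun_prop)).mul (G.continuous.comp h2)).aestronglyMeasurable
      · refine Filter.Eventually.of_forall fun ω => ?_
        rw [norm_mul, ee_norm, one_mul]
        exact SchwartzMap.norm_le_seminorm ℝ G _
    simpa only [mul_assoc] using this

lemma vN_tendsto {u : Euc d → ℂ} (hi : Integrable (𝓕 u)) (hc : Continuous (𝓕 u)) {Ω : Set (Euc d)}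
    {ψ : Euc d → ℂ} (hψΩ : tsupport ψ ⊆ Ω) {a : Euc d → Euc d → ℂ}
    (ha : ContDiffOn ℝ (⊤ : ℕ∞) (fun p : Euc d × Euc d => a p.1 p.2) (Ω ×ˢ Set.univ))
    {c : ℝ} (hca : ∀ x ∈ tsupport ψ, ∀ ξ, ‖a x ξ‖ ≤ c) (g : (Fin d → ℤ) → 𝓢(VV d, ℂ))
    (hg : ∀ k z, g k z = GG ψ a k z) (x : Euc d) :
    Filter.Tendsto (fun N => vN g u N x) Filter.atTop (nhds (ψ x * pdo a u x)) := by
  simp only [vN_eq hi hc ψ a g hg]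
  by_cases hx : ψ x = 0
  · simp [hx]
  have hxt : x ∈ tsupport ψ := subset_tsupport ψ hx
  have hax : Continuous (a x) := by
    have : ContDiffOn ℝ (⊤ : ℕ∞) (a x) Set.univ :=
      ha.comp (g := fun p : Euc d × Euc d => a p.1 p.2) (f := fun y => (x, y))
      (contDiff_const.prodMk contDiff_id).contDiffOn (fun y hy => ⟨hψΩ hxt, Set.mem_univ _⟩)
    exact continuousOn_univ.1 this.continuousOn
  have he := ee_cont
  have e : ψ x * pdo a u x = ∫ ω, ee ⟪ω, x⟫ * (ψ x * ((1 : ℝ) : ℂ) * a x ((2 * Real.pi) • ω) * 𝓕 u ω) := by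
    rw [pdo_eq, ← integral_const_mul]
    congr 1
    ext ω
    push_cast
    ring
  rw [e]
  refine tendsto_integral_of_dominated_convergence (fun ω => ‖ψ x‖ * 1 * c * ‖𝓕 u ω‖) ?_ (hi.norm.const_mul _) ?_ ?_
  · intro N
    have := RN_cont (d := d) N
    apply Continuous.aestronglyMeasurable
    refine Continuous.mul (he.comp (by fun_prop)) (Continuous.mul (Continuous.mul (by fun_prop) ?_) hc)
    exact hax.comp (by fun_prop)
  · intro N
    refine Filter.Eventually.of_forall fun ω => ?_
    rw [norm_mul, norm_mul, norm_mul, norm_mul, ee_norm, one_mul]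
    gcongr
    · rw [Complex.norm_real]; exact RN_abs N ω
    · exact hca x hxt _
  · filter_upwards [RN_tendsto (d := d)] with ω hω
    have h1 : Filter.Tendsto (fun N => ((RN N ω : ℝ) : ℂ)) Filter.atTop (nhds ((1:ℝ) : ℂ)) :=
      (Complex.continuous_ofReal.tendsto 1).comp hω
    exact (((h1.const_mul _).mul_const _).mul_const _).const_mul _

lemma vN_bound {p q : ℝ} (hpq : p.HolderConjugate q) {D : ENNReal} {u : Euc d → ℂ} (g : (Fin d → ℤ) → 𝓢(VV d, ℂ))
    (hi : Integrable (𝓕 u)) (hc : Continuous (𝓕 u))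
    (hD : ∀ (h : Euc d → ℂ), Continuous h → HasCompactSupport h → ∀ S : Finset ℤ,
      ‖∫ x, (∑ k : Fin d → S, Tk (g fun j => k j) u (fun j => k j) x) * h x‖ₑ ≤
        D * ((∫⁻ x, ‖u x‖ₑ ^ p) ^ (1 / p) * (∫⁻ x, ‖h x‖ₑ ^ q) ^ (1 / q))) (N : ℕ) :
    ∫⁻ x, ‖vN g u N x‖ₑ ^ p ≤ (D * (∫⁻ x, ‖u x‖ₑ ^ p) ^ (1 / p)) ^ p := by
  have hvc : Continuous (vN g u N) := continuous_finsetSum _ fun k _ => Tk_cont hi hc _ _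
  refine dual_bound (H := ℂ) hvc hpq ?_
  intro h hh hhc
  have hsc : HasCompactSupport fun x => (starRingEnd ℂ) (h x) := hhc.comp_left (map_zero _)
  have hcc : Continuous fun x => (starRingEnd ℂ) (h x) := Complex.continuous_conj.comp hh
  have h1 := hD (fun x => (starRingEnd ℂ) (h x)) hcc hsc (SN N)
  have hintg : Integrable fun x => vN g u N x * (starRingEnd ℂ) (h x) :=
    (hvc.mul hcc).integrable_of_hasCompactSupport hsc.mul_left
  have h2 : ∫ x, ⟪h x, vN g u N x⟫ = (∫ x, vN g u N x * (starRingEnd ℂ) (h x)).re := by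
    have := integral_re hintg
    simp only [RCLike.re_to_complex] at this
    rw [← this]
    congr 1
  have h3 : ∀ x, ‖(starRingEnd ℂ) (h x)‖ₑ = ‖h x‖ₑ := by
    intro x
    rw [← ofReal_norm, ← ofReal_norm, RCLike.norm_conj]
  simp only [h3] at h1
  rw [h2, mul_assoc]
  refine le_trans ?_ h1
  rw [← ofReal_norm]
  exact ENNReal.ofReal_le_ofReal (Complex.re_le_norm _)

end final

/-- `L^p` boundedness of zero-order `m`-pseudodifferential operators. -/
theorem stmt_9 {n : ℕ} (Ω : Set (Euc n)) (hΩ : IsOpen Ω)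
    (Λ : Fin n → Euc n → ℝ) (hΛ : IsWeightVector Λ)
    (a : Euc n → Euc n → ℂ) (ha : IsSymbol Ω (fun _ => 1) Λ a)
    (p : ℝ) (hp : 1 < p)
    (ψ : Euc n → ℂ) (hψ : ContDiff ℝ (⊤ : ℕ∞) ψ) (hψc : HasCompactSupport ψ)
    (hψΩ : tsupport ψ ⊆ Ω)
    (K : Set (Euc n)) (hK : IsCompact K) (hKΩ : K ⊆ Ω) :
    ∃ C > (0:ℝ), ∀ u : Euc n → ℂ,
      ContDiff ℝ (⊤ : ℕ∞) u → HasCompactSupport u → tsupport u ⊆ K →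
      eLpNorm (fun x => ψ x * pdo a u x) (ENNReal.ofReal p) volume ≤
        ENNReal.ofReal C * eLpNorm u (ENNReal.ofReal p) volume := by
  have hp0 : 0 < p := by linarith
  have hpq : p.HolderConjugate p.conjExponent := Real.HolderConjugate.conjExponent hp
  obtain ⟨Cp, hCp⟩ := sq_kapS hp
  obtain ⟨Cq, hCq⟩ := sq_kapS hpq.symm.lt
  obtain ⟨CL, hCL0, hCL⟩ := GG_main hΩ hΛ ha hψ hψc hψΩ (2 * n + (2 * n + 1))
  choose g hg hdec using hCL
  obtain ⟨D, hDtop, hD⟩ := vN_pair hpq hCp hCq hCL0 ψ a g hg hdec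
  obtain ⟨c, -, hca⟩ := ha.2 _ hψc.isCompact hψΩ 0 0
  have hca' : ∀ x ∈ tsupport ψ, ∀ ξ, ‖a x ξ‖ ≤ c := fun x hx ξ => by
    have := hca x hx ξ
    rw [smpd_zero] at this
    simpa using this
  refine ⟨D.toReal + 1, by positivity, fun u hu huc _ => ?_⟩
  have huD : DD u := DD.of_compact hu.continuous huc
  let us : SchwartzMap (Euc n) ℂ := huc.toSchwartzMap hu
  have hfc : FourierTransform.fourier u = (FourierTransform.fourier us : SchwartzMap (Euc n) ℂ) :=
    (SchwartzMap.fourier_coe us).symm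
  have hi : Integrable (FourierTransform.fourier u) := by rw [hfc]; exact SchwartzMap.integrable _
  have hc : Continuous (FourierTransform.fourier u) := by rw [hfc]; exact SchwartzMap.continuous _
  have hb := vN_bound hpq g hi hc (hD u huD hi hc)
  have hlim := vN_tendsto hi hc hψΩ ha.1 hca' g hg
  have hF : ∫⁻ x, ‖ψ x * pdo a u x‖ₑ ^ p ≤ (D * (∫⁻ x, ‖u x‖ₑ ^ p) ^ (1 / p)) ^ p := by
    have hvc : ∀ N, Continuous (vN g u N) := fun N => continuous_finsetSum _ fun k _ => Tk_cont hi hc _ _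
    have hm : ∀ N, Measurable fun x => ‖vN g u N x‖ₑ ^ p := fun N => (hvc N).measurable.enorm.pow_const p
    have e : ∀ x, ‖ψ x * pdo a u x‖ₑ ^ p = Filter.liminf (fun N => ‖vN g u N x‖ₑ ^ p) Filter.atTop := by
      intro x
      have h1 : Filter.Tendsto (fun N => ‖vN g u N x‖ₑ ^ p) Filter.atTop (nhds (‖ψ x * pdo a u x‖ₑ ^ p)) :=
        ((ENNReal.continuous_rpow_const (y := p)).tendsto _).comp ((continuous_enorm.tendsto _).comp (hlim x))
      exact h1.liminf_eq.symm
    simp only [e]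
    refine (lintegral_liminf_le hm).trans ?_
    refine Filter.liminf_le_of_le (by isBoundedDefault) ?_
    intro b hbb
    obtain ⟨N, hN⟩ := hbb.exists
    exact hN.trans (hb N)
  have hpne : ENNReal.ofReal p ≠ 0 := by simpa using hp0
  rw [eLpNorm_eq_lintegral_rpow_enorm_toReal hpne ENNReal.ofReal_ne_top,
    eLpNorm_eq_lintegral_rpow_enorm_toReal hpne ENNReal.ofReal_ne_top, ENNReal.toReal_ofReal hp0.le]
  calc (∫⁻ x, ‖ψ x * pdo a u x‖ₑ ^ p) ^ (1 / p) ≤ ((D * (∫⁻ x, ‖u x‖ₑ ^ p) ^ (1 / p)) ^ p) ^ (1 / p) := by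
        gcongr
    _ = D * (∫⁻ x, ‖u x‖ₑ ^ p) ^ (1 / p) := by
        rw [← ENNReal.rpow_mul, mul_one_div_cancel hp0.ne', ENNReal.rpow_one]
    _ ≤ _ := by
        gcongr
        rw [← ENNReal.ofReal_toReal hDtop]
        apply ENNReal.ofReal_le_ofReal
        simp

end
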